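/- Let M > 0 and let σ be a modulus of continuity. Then there exist r₀ > 0 (depending only on n, λ, Λ, M, σ) and a modulus of continuity σ₁ such that for every u ∈ P₁⁺(0,M,σ), the free boundary satisfies ∂Ω ∩ B(0,r₀) ⊆ {x : x₁ ≤ σ₁(|x|)·|x|}. In particular the free boundary approaches the fixed boundary Π tangentially at the origin. (Theorem C: tangential touch.) -/

import Mathlib

open Metric Set MeasureTheory Filter

noncomputable section

attribute [local instance] Matrix.normedAddCommGroup Matrix.normedSpace

/-- Euclidean space ℝⁿ. -/
abbrev En (n : ℕ) := EuclideanSpace ℝ (Fin n)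

/-- The open half-space `{x : x₁ > 0}`. -/
def HplusSet (n : ℕ) [NeZero n] : Set (En n) := {x | 0 < x 0}

/-- The closed half-space `{x : x₁ ≥ 0}`. -/
def HcloSet (n : ℕ) [NeZero n] : Set (En n) := {x | 0 ≤ x 0}

/-- The hyperplane `Π = {x : x₁ = 0}`. -/
def PiSet (n : ℕ) [NeZero n] : Set (En n) := {x | x 0 = 0}

/-- The half-ball `B⁺(z,r)`. -/
def Bplus (n : ℕ) [NeZero n] (z : En n) (r : ℝ) : Set (En n) := HplusSet n ∩ ball z r

/-- Operator norm of a matrix acting on Euclidean space. -/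
def matOpNorm {n : ℕ} (N : Matrix (Fin n) (Fin n) ℝ) : ℝ :=
  ‖(Matrix.toEuclideanCLM (𝕜 := ℝ) N : EuclideanSpace ℝ (Fin n) →L[ℝ] EuclideanSpace ℝ (Fin n))‖

/-- The structural assumptions on the fully nonlinear operator `F`:
uniform ellipticity with constants `0 < lam ≤ Lam`, positive one-homogeneity,
convexity (on symmetric matrices) and `C¹` smoothness. -/
structure EllipticF (n : ℕ) (lam Lam : ℝ) (F : Matrix (Fin n) (Fin n) ℝ → ℝ) : Prop where
  lam_pos : 0 < lam
  lam_le_Lam : lam ≤ Lam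
  elliptic_lower : ∀ A N : Matrix (Fin n) (Fin n) ℝ, A.IsSymm → N.PosSemidef →
    lam * matOpNorm N ≤ F (A + N) - F A
  elliptic_upper : ∀ A N : Matrix (Fin n) (Fin n) ℝ, A.IsSymm → N.PosSemidef →
    F (A + N) - F A ≤ Lam * matOpNorm N
  homogeneous : ∀ (t : ℝ) (A : Matrix (Fin n) (Fin n) ℝ), F (t • A) = t * F A
  convexF : ConvexOn ℝ {A : Matrix (Fin n) (Fin n) ℝ | A.IsSymm} F
  smoothF : ContDiff ℝ 1 F

/-- The quadratic polynomial `x ↦ c + b·x + ½ xᵀAx`. -/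
def quadPoly {n : ℕ} (c : ℝ) (b : En n) (A : Matrix (Fin n) (Fin n) ℝ) (x : En n) : ℝ :=
  c + ∑ i, b i * x i + (1 / 2) * ∑ i, ∑ j, A i j * x i * x j

/-- `u` is a viscosity solution of `F(D²u) = g` in the open set `D`. -/
def ViscositySol {n : ℕ} (F : Matrix (Fin n) (Fin n) ℝ → ℝ) (g : En n → ℝ) (D : Set (En n))
    (u : En n → ℝ) : Prop :=
  ∀ x₀ ∈ D,
    (∀ (c : ℝ) (b : En n) (A : Matrix (Fin n) (Fin n) ℝ), A.IsSymm →
      IsLocalMaxOn (fun x => u x - quadPoly c b A x) D x₀ → g x₀ ≤ F A) ∧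
    (∀ (c : ℝ) (b : En n) (A : Matrix (Fin n) (Fin n) ℝ), A.IsSymm →
      IsLocalMinOn (fun x => u x - quadPoly c b A x) D x₀ → F A ≤ g x₀)

/-- Membership in the class `P_r⁺(z,M)` of local solutions, with associated open set `Ω`. -/
structure MemPplus {n : ℕ} [NeZero n] (F : Matrix (Fin n) (Fin n) ℝ → ℝ) (z : En n) (r M : ℝ)
    (u : En n → ℝ) (Ω : Set (En n)) : Prop where
  cont : ContinuousOn u (closure (Bplus n z r))
  Ω_open : IsOpen Ω
  Ω_sub : Ω ⊆ HplusSet n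
  sol : ViscositySol F (Ω.indicator fun _ => (1 : ℝ)) (Bplus n z r) u
  vanish : ∀ x ∈ Bplus n z r \ Ω, u x = 0 ∧ HasGradientAt u 0 x
  bdd : ∀ x ∈ Bplus n z r, |u x| ≤ M
  bdry_zero : ∀ x ∈ PiSet n ∩ ball (0 : En n) 1, u x = 0
  z_bdry : z ∈ frontier Ω

/-- Membership in the class `P_∞⁺(0,M)` of global solutions, with associated open set `Ω`. -/
structure MemPinf {n : ℕ} [NeZero n] (F : Matrix (Fin n) (Fin n) ℝ → ℝ) (M : ℝ)
    (u : En n → ℝ) (Ω : Set (En n)) : Prop where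
  cont : ContinuousOn u (HcloSet n)
  Ω_open : IsOpen Ω
  Ω_sub : Ω ⊆ HplusSet n
  sol : ViscositySol F (Ω.indicator fun _ => (1 : ℝ)) (HplusSet n) u
  vanish : ∀ x ∈ HplusSet n \ Ω, u x = 0 ∧ HasGradientAt u 0 x
  growth : ∀ x, |u x| ≤ M * (‖x‖ ^ 2 + 1)
  bdry_zero : ∀ x ∈ PiSet n, u x = 0
  zero_bdry : (0 : En n) ∈ frontier Ω

/-- The density `V_r(z,u) = vol(Ω⁻(u) ∩ B⁺(z,r)) / rⁿ`. -/
def Vr {n : ℕ} [NeZero n] (u : En n → ℝ) (Ω : Set (En n)) (z : En n) (r : ℝ) : ℝ :=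
  (volume ({x ∈ Ω | u x < 0} ∩ Bplus n z r)).toReal / r ^ n

/-- A modulus of continuity: nonnegative, nondecreasing on `(0,∞)` and tending to `0` at `0⁺`. -/
def IsModulus (σ : ℝ → ℝ) : Prop :=
  (∀ r : ℝ, 0 < r → 0 ≤ σ r) ∧ (∀ ⦃r s : ℝ⦄, 0 < r → r ≤ s → σ r ≤ σ s) ∧
    Tendsto σ (nhdsWithin 0 (Ioi 0)) (nhds 0)

namespace TC
open Topology Asymptotics

variable {n : ℕ}

def dotp (b : Fin n → ℝ) (y : En n) : ℝ := ∑ i, b i * y i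
def qf (A : Matrix (Fin n) (Fin n) ℝ) (y : En n) : ℝ := ∑ i, ∑ j, A i j * y i * y j
def trQ (Q A : Matrix (Fin n) (Fin n) ℝ) : ℝ := ∑ i, ∑ j, Q i j * A i j

structure Ell (lam Lam : ℝ) (Q : Matrix (Fin n) (Fin n) ℝ) : Prop where
  lam_pos : 0 < lam
  symm : ∀ i j, Q i j = Q j i
  psd : ∀ N : Matrix (Fin n) (Fin n) ℝ, N.PosSemidef → 0 ≤ trQ Q N
  lower : ∀ ξ : En n, lam * ‖ξ‖ ^ 2 ≤ qf Q ξ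
  upper : ∀ ξ : En n, qf Q ξ ≤ Lam * ‖ξ‖ ^ 2
  tr_lo : lam ≤ trQ Q 1
  tr_hi : trQ Q 1 ≤ Lam

def SubAt (Q : Matrix (Fin n) (Fin n) ℝ) (u : En n → ℝ) (a : ℝ) (x0 : En n) : Prop :=
  ∀ (b : Fin n → ℝ) (A : Matrix (Fin n) (Fin n) ℝ), A.IsSymm →
    (∀ᶠ y in 𝓝 (0 : En n), u (x0 + y) ≤ u x0 + dotp b y + 1 / 2 * qf A y) → a ≤ trQ Q A

def T2 (f : En n → ℝ) (x0 : En n) (b : Fin n → ℝ) (A : Matrix (Fin n) (Fin n) ℝ) : Prop :=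
  (fun y => f (x0 + y) - f x0 - dotp b y - 1 / 2 * qf A y) =o[𝓝 0] (fun y : En n => ‖y‖ ^ 2)

def LAt (Q : Matrix (Fin n) (Fin n) ℝ) (f : En n → ℝ) (x : En n) (l : ℝ) : Prop :=
  ∃ b A, A.IsSymm ∧ T2 f x b A ∧ trQ Q A = l

lemma abs_coord (y : En n) (i : Fin n) : |y i| ≤ ‖y‖ := by
  have := EuclideanSpace.norm_sq_eq y
  have h2 : ‖y i‖ ^ 2 ≤ ‖y‖ ^ 2 := by
    rw [this]; exact Finset.single_le_sum (f := fun i => ‖y i‖ ^ 2) (fun _ _ => by positivity) (Finset.mem_univ i)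
  exact abs_le_of_sq_le_sq' (by simpa using h2) (norm_nonneg _) |> abs_le.mpr

lemma normsq (y : En n) : ‖y‖ ^ 2 = ∑ i, y i ^ 2 := by
  rw [EuclideanSpace.norm_sq_eq]; simp

lemma dotp_add (b b' : Fin n → ℝ) (y : En n) : dotp (b + b') y = dotp b y + dotp b' y := by
  simp [dotp, add_mul, Finset.sum_add_distrib]
lemma dotp_sub (b b' : Fin n → ℝ) (y : En n) : dotp (b - b') y = dotp b y - dotp b' y := by
  simp [dotp, sub_mul, Finset.sum_sub_distrib]
lemma dotp_smul (c : ℝ) (b : Fin n → ℝ) (y : En n) : dotp (c • b) y = c * dotp b y := by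
  simp [dotp, Finset.mul_sum, mul_assoc]
lemma qf_add (b b' : Matrix (Fin n) (Fin n) ℝ) (y : En n) : qf (b + b') y = qf b y + qf b' y := by
  simp [qf, add_mul, Finset.sum_add_distrib]
lemma qf_sub (b b' : Matrix (Fin n) (Fin n) ℝ) (y : En n) : qf (b - b') y = qf b y - qf b' y := by
  simp [qf, sub_mul, Finset.sum_sub_distrib]
lemma qf_smul (c : ℝ) (b : Matrix (Fin n) (Fin n) ℝ) (y : En n) : qf (c • b) y = c * qf b y := by
  simp [qf, Finset.mul_sum, mul_assoc]
lemma qf_one (y : En n) : qf 1 y = ‖y‖ ^ 2 := by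
  rw [normsq]; simp [qf, Matrix.one_apply, pow_two]
lemma trQ_add (Q b b' : Matrix (Fin n) (Fin n) ℝ) : trQ Q (b + b') = trQ Q b + trQ Q b' := by
  simp [trQ, mul_add, Finset.sum_add_distrib]
lemma trQ_sub (Q b b' : Matrix (Fin n) (Fin n) ℝ) : trQ Q (b - b') = trQ Q b - trQ Q b' := by
  simp [trQ, mul_sub, Finset.sum_sub_distrib]
lemma trQ_smul (Q : Matrix (Fin n) (Fin n) ℝ) (c : ℝ) (b : Matrix (Fin n) (Fin n) ℝ) :
    trQ Q (c • b) = c * trQ Q b := by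
  simp [trQ, Finset.mul_sum, mul_left_comm]

lemma dotp_smul_right (b : Fin n → ℝ) (c : ℝ) (y : En n) : dotp b (c • y) = c * dotp b y := by
  simp only [dotp, Finset.mul_sum, PiLp.smul_apply, smul_eq_mul]
  exact Finset.sum_congr rfl fun i _ => by ring
lemma qf_smul_right (A : Matrix (Fin n) (Fin n) ℝ) (c : ℝ) (y : En n) :
    qf A (c • y) = c ^ 2 * qf A y := by
  simp only [qf, Finset.mul_sum, PiLp.smul_apply, smul_eq_mul]
  exact Finset.sum_congr rfl fun i _ => Finset.sum_congr rfl fun j _ => by ring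

lemma dotp_bound (b : Fin n → ℝ) (y : En n) : |dotp b y| ≤ (∑ i, |b i|) * ‖y‖ := by
  rw [dotp, Finset.sum_mul]
  refine (Finset.abs_sum_le_sum_abs _ _).trans (Finset.sum_le_sum fun i _ => ?_)
  rw [abs_mul]; exact mul_le_mul_of_nonneg_left (abs_coord y i) (abs_nonneg _)
lemma qf_bound (A : Matrix (Fin n) (Fin n) ℝ) (y : En n) :
    |qf A y| ≤ (∑ i, ∑ j, |A i j|) * ‖y‖ ^ 2 := by
  rw [qf, Finset.sum_mul]
  refine (Finset.abs_sum_le_sum_abs _ _).trans (Finset.sum_le_sum fun i _ => ?_)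
  rw [Finset.sum_mul]
  refine (Finset.abs_sum_le_sum_abs _ _).trans (Finset.sum_le_sum fun j _ => ?_)
  rw [abs_mul, abs_mul, mul_assoc, pow_two]
  have := abs_coord y i; have := abs_coord y j
  gcongr

lemma SubAt.congr_le {Q : Matrix (Fin n) (Fin n) ℝ} {u v : En n → ℝ} {a : ℝ} {x : En n}
    (h : SubAt Q u a x) (hx : u x = v x) (hle : ∀ᶠ y in 𝓝 (0 : En n), u (x + y) ≤ v (x + y)) :
    SubAt Q v a x := by
  intro b A hA hv
  refine h b A hA ?_
  filter_upwards [hv, hle] with y h1 h2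
  rw [hx]; linarith

lemma ev_shift {p : En n → Prop} {x : En n} (h : ∀ᶠ z in 𝓝 x, p z) :
    ∀ᶠ y in 𝓝 (0 : En n), p (x + y) := by
  have : Tendsto (fun y : En n => x + y) (𝓝 0) (𝓝 x) := by
    have : Continuous (fun y : En n => x + y) := by fun_prop
    simpa using this.tendsto 0
  exact this.eventually h

lemma SubAt.congr {Q : Matrix (Fin n) (Fin n) ℝ} {u v : En n → ℝ} {a : ℝ} {x : En n}
    (h : SubAt Q u a x) (hle : ∀ᶠ z in 𝓝 x, u z = v z) :
    SubAt Q v a x :=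
  h.congr_le hle.self_of_nhds ((ev_shift hle).mono fun _ h => h.le)

lemma SubAt.mono {Q : Matrix (Fin n) (Fin n) ℝ} {u : En n → ℝ} {a a' : ℝ} {x : En n}
    (h : SubAt Q u a x) (h' : a' ≤ a) : SubAt Q u a' x :=
  fun b A hA hv => h'.trans (h b A hA hv)

lemma SubAt.add_T2 {Q : Matrix (Fin n) (Fin n) ℝ} {lam Lam : ℝ} (hQ : Ell lam Lam Q)
    {u f : En n → ℝ} {a l : ℝ} {x : En n}
    (h : SubAt Q u a x) (hf : LAt Q f x l) : SubAt Q (fun z => u z + f z) (a + l) x := by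
  obtain ⟨b', A', hA', hT, rfl⟩ := hf
  intro b A hA hv
  refine le_of_forall_pos_le_add fun ε hε => ?_
  have hT0 : 0 < trQ Q 1 := hQ.lam_pos.trans_le hQ.tr_lo
  set e := ε / (2 * trQ Q 1)
  have he : 0 < e := by positivity
  have := h (b - b') (A - A' + (2 * e) • 1) (by
    refine (hA.sub hA').add ?_
    exact Matrix.isSymm_one.smul _) ?_
  · rw [trQ_add, trQ_sub, trQ_smul] at this
    have h3 : 2 * e * trQ Q 1 = ε := by simp only [e]; field_simp
    linarith
  · filter_upwards [hv, hT.bound he] with y h1 h2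
    rw [dotp_sub, qf_add, qf_sub, qf_smul, qf_one]
    simp only [Real.norm_eq_abs, abs_pow, abs_norm] at h2
    have := (abs_le.1 h2).1
    linarith

lemma subAt_const {Q : Matrix (Fin n) (Fin n) ℝ} {lam Lam : ℝ} (hQ : Ell lam Lam Q) (c : ℝ)
    (x : En n) : SubAt Q (fun _ => c) 0 x := by
  intro b A hA hv
  refine hQ.psd A (Matrix.PosSemidef.of_dotProduct_mulVec_nonneg ?_ fun ξ => ?_)
  · rw [Matrix.IsHermitian, Matrix.conjTranspose_eq_transpose_of_trivial]; exact hA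
  · set y : En n := WithLp.toLp 2 ξ
    have e1 : star ξ ⬝ᵥ (A.mulVec ξ) = qf A y := by
      simp only [dotProduct, Matrix.mulVec, qf, y, Finset.mul_sum, Pi.star_apply, star_trivial]
      exact Finset.sum_congr rfl fun i _ => Finset.sum_congr rfl fun j _ => by ring
    rw [e1]
    have ht : Tendsto (fun t : ℝ => t • y) (𝓝[≠] 0) (𝓝 0) := by
      have : Continuous (fun t : ℝ => t • y) := by fun_prop
      have := this.tendsto 0
      rw [zero_smul] at this
      exact this.mono_left nhdsWithin_le_nhds
    have ht' : Tendsto (fun t : ℝ => (-t) • y) (𝓝[≠] 0) (𝓝 0) := by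
      simpa using ht.neg
    obtain ⟨t, h1, h2, h3⟩ := ((ht.eventually hv).and ((ht'.eventually hv).and
      self_mem_nhdsWithin)).exists
    simp only [dotp_smul_right, qf_smul_right] at h1 h2
    have h3 : t ≠ 0 := h3
    have : 0 ≤ t ^ 2 * qf A y := by linarith [neg_sq t ▸ h2]
    have ht2 : 0 < t ^ 2 := by positivity
    exact nonneg_of_mul_nonneg_right this ht2

lemma LAt.subAt {Q : Matrix (Fin n) (Fin n) ℝ} {lam Lam : ℝ} (hQ : Ell lam Lam Q)
    {f : En n → ℝ} {l : ℝ} {x : En n} (hf : LAt Q f x l) : SubAt Q f l x := by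
  have := (subAt_const hQ 0 x).add_T2 hQ hf
  simpa using this

lemma SubAt.le_of_max {Q : Matrix (Fin n) (Fin n) ℝ} {u : En n → ℝ} {a : ℝ} {x : En n}
    (h : SubAt Q u a x) (hm : ∀ᶠ z in 𝓝 x, u z ≤ u x) : a ≤ 0 := by
  have := h 0 0 (by simp [Matrix.IsSymm]) ((ev_shift hm).mono fun y hy => by
    simpa [dotp, qf] using hy)
  simpa [trQ] using this

lemma T2.add {f g : En n → ℝ} {x : En n} {b b' : Fin n → ℝ} {A A' : Matrix (Fin n) (Fin n) ℝ}
    (hf : T2 f x b A) (hg : T2 g x b' A') : T2 (fun z => f z + g z) x (b + b') (A + A') := by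
  refine (IsLittleO.add hf hg).congr_left fun y => ?_
  rw [dotp_add, qf_add]; ring

lemma T2.const_mul {f : En n → ℝ} {x : En n} {b : Fin n → ℝ} {A : Matrix (Fin n) (Fin n) ℝ}
    (c : ℝ) (hf : T2 f x b A) : T2 (fun z => c * f z) x (c • b) (c • A) := by
  refine (IsLittleO.const_mul_left hf c).congr_left fun y => ?_
  rw [dotp_smul, qf_smul]; ring

lemma T2_const (c : ℝ) (x : En n) : T2 (fun _ => c) x 0 0 := by
  refine (isLittleO_zero _ _).congr_left fun y => ?_
  simp [dotp, qf]

def outer (b b' : Fin n → ℝ) : Matrix (Fin n) (Fin n) ℝ := fun i j => b i * b' j + b' i * b j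

lemma outer_symm (b b' : Fin n → ℝ) : (outer b b').IsSymm := by
  ext i j; simp [outer, Matrix.transpose]; ring

lemma qf_outer (b b' : Fin n → ℝ) (y : En n) : qf (outer b b') y = 2 * (dotp b y * dotp b' y) := by
  have : qf (outer b b') y = dotp b y * dotp b' y + dotp b' y * dotp b y := by
    simp only [qf, outer, dotp, Finset.sum_mul_sum, ← Finset.sum_add_distrib]
    exact Finset.sum_congr rfl fun i _ => Finset.sum_congr rfl fun j _ => by ring
  rw [this]; ring

lemma T2.mul {f g : En n → ℝ} {x : En n} {b b' : Fin n → ℝ} {A A' : Matrix (Fin n) (Fin n) ℝ}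
    (hf : T2 f x b A) (hg : T2 g x b' A') :
    T2 (fun z => f z * g z) x (f x • b' + g x • b) (f x • A' + g x • A + outer b b') := by
  have tn : Tendsto (fun y : En n => ‖y‖) (𝓝 0) (𝓝 0) := by
    simpa using (continuous_norm (E := En n)).tendsto 0
  have hn1 : (fun y : En n => ‖y‖) =o[𝓝 0] (fun _ : En n => (1 : ℝ)) := by
    rw [isLittleO_one_iff]; exact tn
  have hn2 : (fun y : En n => ‖y‖ ^ 2) =o[𝓝 0] (fun _ : En n => (1 : ℝ)) := by
    rw [isLittleO_one_iff]; simpa using tn.pow 2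
  have hl : ∀ b : Fin n → ℝ, (fun y : En n => dotp b y) =o[𝓝 0] (fun _ : En n => (1 : ℝ)) := by
    intro b
    refine IsBigO.trans_isLittleO (IsBigO.of_bound (∑ i, |b i|) ?_) hn1
    exact Eventually.of_forall fun y => by simpa using dotp_bound b y
  have hq : ∀ A : Matrix (Fin n) (Fin n) ℝ, (fun y : En n => 1 / 2 * qf A y) =O[𝓝 0] (fun y : En n => ‖y‖ ^ 2) := by
    intro A
    refine IsBigO.const_mul_left (IsBigO.of_bound (∑ i, ∑ j, |A i j|) ?_) _
    exact Eventually.of_forall fun y => by simpa using qf_bound A y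
  have hc : ∀ c : ℝ, (fun _ : En n => c) =O[𝓝 0] (fun _ : En n => (1 : ℝ)) :=
    fun c => isBigO_const_const c one_ne_zero _
  set r1 := fun y => f (x + y) - f x - dotp b y - 1 / 2 * qf A y
  set r2 := fun y => g (x + y) - g x - dotp b' y - 1 / 2 * qf A' y
  have hr1 : r1 =o[𝓝 0] (fun y : En n => ‖y‖ ^ 2) := hf
  have hr2 : r2 =o[𝓝 0] (fun y : En n => ‖y‖ ^ 2) := hg
  have hG : (fun y => g x + dotp b' y + 1 / 2 * qf A' y + r2 y) =O[𝓝 0] (fun _ : En n => (1 : ℝ)) :=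
    (((hc _).add (hl b').isBigO).add ((hq A').trans hn2.isBigO)).add (hr2.isBigO.trans hn2.isBigO)
  have hF : (fun y => f x + dotp b y + 1 / 2 * qf A y) =O[𝓝 0] (fun _ : En n => (1 : ℝ)) :=
    (((hc _).add (hl b).isBigO).add ((hq A).trans hn2.isBigO))
  have k1 := hr1.mul_isBigO hG
  have k2 := hF.mul_isLittleO hr2
  have k3 := (hl b).mul_isBigO (hq A')
  have k4 := (hl b').mul_isBigO (hq A)
  have k5 := ((hq A).trans_isLittleO hn2).mul_isBigO (hq A')
  simp only [mul_one, one_mul] at k1 k2 k3 k4 k5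
  refine ((((k1.add k2).add k3).add k4).add k5).congr_left fun y => ?_
  rw [dotp_add, qf_add, qf_add, dotp_smul, dotp_smul, qf_smul, qf_smul, qf_outer]
  simp only [r1, r2]; ring

lemma LAt.add {Q : Matrix (Fin n) (Fin n) ℝ} {f g : En n → ℝ} {x : En n} {l m : ℝ}
    (hf : LAt Q f x l) (hg : LAt Q g x m) : LAt Q (fun z => f z + g z) x (l + m) := by
  obtain ⟨b, A, hA, h, rfl⟩ := hf
  obtain ⟨b', A', hA', h', rfl⟩ := hg
  exact ⟨_, _, hA.add hA', h.add h', trQ_add _ _ _⟩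

lemma LAt.const_mul {Q : Matrix (Fin n) (Fin n) ℝ} {f : En n → ℝ} {x : En n} {l : ℝ} (c : ℝ)
    (hf : LAt Q f x l) : LAt Q (fun z => c * f z) x (c * l) := by
  obtain ⟨b, A, hA, h, rfl⟩ := hf
  exact ⟨_, _, hA.smul c, h.const_mul c, trQ_smul _ _ _⟩

lemma LAt_const {Q : Matrix (Fin n) (Fin n) ℝ} (c : ℝ) (x : En n) : LAt Q (fun _ => c) x 0 :=
  ⟨0, 0, by simp [Matrix.IsSymm], T2_const c x, by simp [trQ]⟩

lemma T2_coord (i : Fin n) (x : En n) : T2 (fun z => z i) x (Pi.single i 1) 0 := by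
  refine (isLittleO_zero _ _).congr_left fun y => ?_
  simp [dotp, qf, Pi.single_apply]

lemma LAt_coord {Q : Matrix (Fin n) (Fin n) ℝ} (i : Fin n) (x : En n) :
    LAt Q (fun z => z i) x 0 :=
  ⟨_, 0, by simp [Matrix.IsSymm], T2_coord i x, by simp [trQ]⟩

lemma LAt_coord_sq {Q : Matrix (Fin n) (Fin n) ℝ} (i : Fin n) (x : En n) :
    LAt Q (fun z => z i ^ 2) x (2 * Q i i) := by
  have := (T2_coord i x).mul (T2_coord i x)
  simp only [smul_zero, zero_add, ← pow_two] at this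
  refine ⟨_, _, outer_symm _ _, this, ?_⟩
  simp [trQ, outer, Pi.single_apply, mul_add, Finset.sum_add_distrib]; ring

lemma T2_dist (y x : En n) : T2 (fun z => ‖z - y‖ ^ 2) x (fun i => 2 * (x i - y i)) ((2 : ℝ) • 1) := by
  refine (isLittleO_zero _ _).congr_left fun w => ?_
  rw [qf_smul, qf_one]
  simp only [normsq, dotp, Finset.mul_sum, ← Finset.sum_sub_distrib, PiLp.sub_apply, PiLp.add_apply]
  symm
  exact Finset.sum_eq_zero fun i _ => by ring

lemma LAt_dist {Q : Matrix (Fin n) (Fin n) ℝ} (y x : En n) :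
    LAt Q (fun z => ‖z - y‖ ^ 2) x (2 * trQ Q 1) :=
  ⟨_, _, Matrix.isSymm_one.smul _, T2_dist y x, trQ_smul _ _ _⟩

/-- Maximum principle. -/
lemma MP {Q : Matrix (Fin n) (Fin n) ℝ} {lam Lam : ℝ} (hQ : Ell lam Lam Q) {u : En n → ℝ}
    {U K : Set (En n)} (hU : IsOpen U) (hK : IsCompact K) (hUK : U ⊆ K) (hc : ContinuousOn u K)
    (hs : ∀ x ∈ U, SubAt Q u 0 x) {m : ℝ} (hb : ∀ x ∈ K, x ∉ U → u x ≤ m) :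
    ∀ x ∈ K, u x ≤ m := by
  intro x hx
  have hT0 : 0 < trQ Q 1 := hQ.lam_pos.trans_le hQ.tr_lo
  obtain ⟨D, hD⟩ := hK.isBounded.exists_norm_le
  refine le_of_forall_pos_le_add fun ε hε => ?_
  set e := ε / (D ^ 2 + 1)
  have he : 0 < e := by positivity
  have hc' : ContinuousOn (fun z => u z + e * ‖z - 0‖ ^ 2) K := hc.add (by fun_prop)
  obtain ⟨z, hz, hmax⟩ := hK.exists_isMaxOn ⟨x, hx⟩ hc'
  have hzU : z ∉ U := by
    intro hzU
    have h1 := (hs z hzU).add_T2 hQ ((LAt_dist (Q := Q) 0 z).const_mul e)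
    have := h1.le_of_max (by
      filter_upwards [hU.mem_nhds hzU] with w hw
      exact hmax (hUK hw))
    have : 0 < e * (2 * trQ Q 1) := by positivity
    linarith
  have h1 := hmax hx
  have h2 := hb z hz hzU
  have h3 : ‖z‖ ^ 2 ≤ D ^ 2 := pow_le_pow_left₀ (norm_nonneg _) (hD z hz) 2
  simp only [sub_zero, Set.mem_ofPred_eq] at h1
  have h4 : e * D ^ 2 ≤ ε := by
    simp only [e]; rw [div_mul_eq_mul_div, div_le_iff₀ (by positivity)]; nlinarith
  have h5 : e * ‖z‖ ^ 2 ≤ e * D ^ 2 := by gcongr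
  have h6 : 0 ≤ e * ‖x‖ ^ 2 := by positivity
  linarith

lemma SubAt.translate {Q : Matrix (Fin n) (Fin n) ℝ} {u : En n → ℝ} {a : ℝ} {x c : En n}
    (h : SubAt Q u a (x + c)) : SubAt Q (fun z => u (z + c)) a x := by
  intro b A hA hv
  refine h b A hA (hv.mono fun y hy => ?_)
  rwa [add_right_comm]

lemma SubAt.scale {Q : Matrix (Fin n) (Fin n) ℝ} {u : En n → ℝ} {a s : ℝ} (hs : 0 < s) {x : En n}
    (h : SubAt Q u a (s • x)) : SubAt Q (fun z => u (s • z) / s ^ 2) a x := by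
  intro b A hA hv
  refine h (s • b) A hA ?_
  have : Tendsto (fun y : En n => s⁻¹ • y) (𝓝 0) (𝓝 0) := by
    have : Continuous (fun y : En n => s⁻¹ • y) := by fun_prop
    simpa using this.tendsto 0
  filter_upwards [this.eventually hv] with y hy
  simp only [smul_add, smul_inv_smul₀ hs.ne', dotp_smul_right, qf_smul_right, dotp_smul] at hy ⊢
  rw [div_le_iff₀ (by positivity)] at hy
  refine hy.trans (le_of_eq ?_)
  field_simp

end TC

namespace TC
open Topology Asymptotics MvPolynomial

variable {n : ℕ}

abbrev Po (n : ℕ) := MvPolynomial (Fin n) ℝ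

def ev (p : Po n) (x : En n) : ℝ := MvPolynomial.eval (fun i => x i) p

def Lpoly (Q : Matrix (Fin n) (Fin n) ℝ) (p : Po n) : Po n :=
  ∑ i, ∑ j, C (Q i j) * pderiv i (pderiv j p)

def Gam (Q : Matrix (Fin n) (Fin n) ℝ) (p q : Po n) : Po n :=
  ∑ i, ∑ j, C (Q i j) * (pderiv i p * pderiv j q)

lemma pderiv_comm' (i j : Fin n) (p : Po n) : pderiv i (pderiv j p) = pderiv j (pderiv i p) := by
  induction p using MvPolynomial.induction_on with
  | C a => simp
  | add p q hp hq => simp [hp, hq]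
  | mul_X p k hp =>
    simp only [pderiv_mul, map_add, hp, pderiv_X]
    rcases eq_or_ne k i with rfl | h1 <;> rcases eq_or_ne k j with rfl | h2 <;>
      simp [Pi.single_apply, *]

lemma ev_add (p q : Po n) (x : En n) : ev (p + q) x = ev p x + ev q x := by simp [ev]
lemma ev_sub (p q : Po n) (x : En n) : ev (p - q) x = ev p x - ev q x := by simp [ev]
lemma ev_mul (p q : Po n) (x : En n) : ev (p * q) x = ev p x * ev q x := by simp [ev]
lemma ev_C (c : ℝ) (x : En n) : ev (C c) x = c := by simp [ev]
lemma ev_X (i : Fin n) (x : En n) : ev (X i) x = x i := by simp [ev]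
lemma ev_pow (p : Po n) (k : ℕ) (x : En n) : ev (p ^ k) x = ev p x ^ k := by simp [ev]
lemma ev_sum {ι : Type*} (s : Finset ι) (p : ι → Po n) (x : En n) :
    ev (∑ i ∈ s, p i) x = ∑ i ∈ s, ev (p i) x := by simp [ev]

lemma ev_cont (p : Po n) : Continuous (ev p) := by
  unfold ev
  refine (MvPolynomial.continuous_eval p).comp ?_
  fun_prop

def hess (p : Po n) (x : En n) : Matrix (Fin n) (Fin n) ℝ := fun i j => ev (pderiv i (pderiv j p)) x

lemma T2_ev (p : Po n) (x : En n) :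
    T2 (ev p) x (fun i => ev (pderiv i p) x) (hess p x) := by
  induction p using MvPolynomial.induction_on with
  | C a =>
    have h := T2_const a x
    unfold T2 at h ⊢
    refine h.congr_left fun y => ?_
    simp [ev, dotp, qf, hess]
  | add p q hp hq =>
    have h := hp.add hq
    unfold T2 at h ⊢
    refine h.congr_left fun y => ?_
    have e1 : (fun i => ev (pderiv i (p + q)) x) = (fun i => ev (pderiv i p) x) + fun i => ev (pderiv i q) x := by
      ext; simp [ev]
    have e2 : hess (p + q) x = hess p x + hess q x := by
      ext; simp [ev, hess]
    rw [e1, e2, ev_add, ev_add]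
  | mul_X p k hp =>
    have h := hp.mul (T2_coord k x)
    unfold T2 at h ⊢
    refine h.congr_left fun y => ?_
    have e1 : (fun i => ev (pderiv i (p * X k)) x) = ev p x • Pi.single k 1 + x k • fun i => ev (pderiv i p) x := by
      ext z
      simp only [pderiv_mul, pderiv_X, ev_mul, ev_add, ev_X, Pi.add_apply, Pi.smul_apply, smul_eq_mul]
      rcases eq_or_ne k z with rfl | h1 <;> simp [Pi.single_apply, ev, *] <;> ring
    have e2 : hess (p * X k) x
      = ev p x • (0 : Matrix (Fin n) (Fin n) ℝ) + x k • hess p x +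
        outer (fun i => ev (pderiv i p) x) (Pi.single k 1) := by
      ext i j
      simp only [hess, pderiv_mul, map_add, pderiv_X, ev_mul, ev_add, ev_X, smul_zero, zero_add, Matrix.add_apply, Matrix.smul_apply, smul_eq_mul, outer]
      rcases eq_or_ne k i with rfl | h1 <;> rcases eq_or_ne k j with rfl | h2 <;>
      simp [Pi.single_apply, ev, *] <;> ring
    rw [e1, e2, ev_mul, ev_mul, ev_X, ev_X]

lemma LAt_ev (Q : Matrix (Fin n) (Fin n) ℝ) (p : Po n) (x : En n) :
    LAt Q (ev p) x (ev (Lpoly Q p) x) := by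
  refine ⟨_, _, ?_, T2_ev p x, ?_⟩
  · ext i j; simp [hess, Matrix.transpose, pderiv_comm' i j]
  · simp [trQ, Lpoly, ev, hess]

lemma Lpoly_add (Q : Matrix (Fin n) (Fin n) ℝ) (p q : Po n) :
    Lpoly Q (p + q) = Lpoly Q p + Lpoly Q q := by
  simp [Lpoly, mul_add, Finset.sum_add_distrib]
lemma Lpoly_sub (Q : Matrix (Fin n) (Fin n) ℝ) (p q : Po n) :
    Lpoly Q (p - q) = Lpoly Q p - Lpoly Q q := by
  simp [Lpoly, mul_sub, Finset.sum_sub_distrib]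
lemma Lpoly_C_mul (Q : Matrix (Fin n) (Fin n) ℝ) (c : ℝ) (p : Po n) :
    Lpoly Q (C c * p) = C c * Lpoly Q p := by
  simp only [Lpoly, Finset.mul_sum, pderiv_C_mul]
  exact Finset.sum_congr rfl fun i _ => Finset.sum_congr rfl fun j _ => by ring
lemma Lpoly_pderiv (Q : Matrix (Fin n) (Fin n) ℝ) (k : Fin n) (p : Po n) :
    Lpoly Q (pderiv k p) = pderiv k (Lpoly Q p) := by
  simp only [Lpoly, map_sum, pderiv_C_mul]
  exact Finset.sum_congr rfl fun i _ => Finset.sum_congr rfl fun j _ => by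
    rw [pderiv_comm' j k, pderiv_comm' i k]
lemma Lpoly_mul (Q : Matrix (Fin n) (Fin n) ℝ) (hQ : ∀ i j, Q i j = Q j i) (p q : Po n) :
    Lpoly Q (p * q) = p * Lpoly Q q + q * Lpoly Q p + 2 * Gam Q p q := by
  have h : Gam Q p q = ∑ i, ∑ j, C (Q i j) * (pderiv j p * pderiv i q) := by
    rw [Gam, Finset.sum_comm]
    exact Finset.sum_congr rfl fun i _ => Finset.sum_congr rfl fun j _ => by rw [hQ]
  rw [two_mul]; nth_rewrite 1 [h]
  simp only [Lpoly, Gam, Finset.mul_sum, pderiv_mul, map_add, ← Finset.sum_add_distrib]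
  exact Finset.sum_congr rfl fun i _ => Finset.sum_congr rfl fun j _ => by ring

def Zp (y : En n) (ρ : ℝ) : Po n := C (ρ ^ 2) - ∑ i, (X i - C (y i)) ^ 2

lemma ev_Zp (y : En n) (ρ : ℝ) (x : En n) : ev (Zp y ρ) x = ρ ^ 2 - ‖x - y‖ ^ 2 := by
  rw [normsq]; simp [Zp, ev]

lemma totalDegree_pderiv (i : Fin n) (p : Po n) (k : ℕ) (h : p.totalDegree ≤ k + 1) :
    (pderiv i p).totalDegree ≤ k := by
  refine Finset.sup_le fun m hm => ?_
  rw [mem_support_iff, coeff_pderiv] at hm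
  have hs : m + Finsupp.single i 1 ∈ p.support := by
    rw [mem_support_iff]; intro h0; simp [h0] at hm
  have := (le_totalDegree hs).trans h
  rw [Finsupp.sum_add_index' (by simp) (by simp)] at this
  simpa using this

lemma totalDegree_Lpoly (Q : Matrix (Fin n) (Fin n) ℝ) (p : Po n) (k : ℕ)
    (h : p.totalDegree ≤ k + 2) : (Lpoly Q p).totalDegree ≤ k := by
  refine (totalDegree_finsetSum _ _).trans (Finset.sup_le fun i _ => ?_)
  refine (totalDegree_finsetSum _ _).trans (Finset.sup_le fun j _ => ?_)
  refine (totalDegree_mul _ _).trans ?_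
  rw [totalDegree_C, zero_add]
  exact totalDegree_pderiv _ _ _ (totalDegree_pderiv _ _ _ h)

lemma totalDegree_Zp (y : En n) (ρ : ℝ) : (Zp y ρ).totalDegree ≤ 2 := by
  refine (totalDegree_sub _ _).trans (max_le (by rw [totalDegree_C]; omega) ?_)
  refine (totalDegree_finsetSum _ _).trans (Finset.sup_le fun i _ => ?_)
  refine (totalDegree_pow _ _).trans ?_
  have : (X i - C (y i) : Po n).totalDegree ≤ 1 :=
    (totalDegree_sub _ _).trans (max_le (by simp) (by simp))
  omega

lemma harm_bdd {Q : Matrix (Fin n) (Fin n) ℝ} {lam Lam : ℝ} (hQ : Ell lam Lam Q) {y : En n} {ρ m : ℝ}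
    {p : Po n} (hp : Lpoly Q p = 0) (hb : ∀ x ∈ sphere y ρ, ev p x ≤ m) :
    ∀ x ∈ closedBall y ρ, ev p x ≤ m := by
  refine MP hQ isOpen_ball (isCompact_closedBall y ρ) ball_subset_closedBall
    (ev_cont p).continuousOn (fun x _ => ?_) fun x hx hx' => hb x ?_
  · have := (LAt_ev Q p x).subAt hQ
    rwa [hp, show ev (0 : Po n) x = 0 by simp [ev]] at this
  · simp only [mem_closedBall, mem_ball, mem_sphere, not_lt] at *
    linarith

lemma ev_neg (p : Po n) (x : En n) : ev (-p) x = - ev p x := by simp [ev]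
lemma Lpoly_neg (Q : Matrix (Fin n) (Fin n) ℝ) (p : Po n) : Lpoly Q (-p) = - Lpoly Q p := by
  simp [Lpoly]

lemma eq_zero_of_ball {q : Po n} {y : En n} {ρ : ℝ} (hρ : 0 < ρ) (h : ∀ x ∈ ball y ρ, ev q x = 0) :
    q = 0 := by
  have hc : Continuous (fun z : Fin n → ℝ => (WithLp.toLp 2 z : En n)) := by fun_prop
  have ho : IsOpen ((fun z : Fin n → ℝ => (WithLp.toLp 2 z : En n)) ⁻¹' ball y ρ) :=
    isOpen_ball.preimage hc
  obtain ⟨δ, hδ, hb⟩ := Metric.isOpen_iff.1 ho (fun i => y i) (by simp [hρ])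
  refine MvPolynomial.funext_set (fun i => ball (y i) δ) (fun i => ?_) fun x hx => ?_
  · rw [Real.ball_eq_Ioo]; exact Ioo_infinite (by linarith)
  · have : x ∈ ball (fun i => y i) δ := by rw [ball_pi _ hδ]; exact hx
    have := h _ (hb this)
    simpa [ev] using this

lemma star {Q : Matrix (Fin n) (Fin n) ℝ} {lam Lam : ℝ} (hQ : Ell lam Lam Q) (y : En n) {ρ : ℝ}
    (hρ : 0 < ρ) {f : En n → ℝ} (hf : ContinuousOn f (sphere y ρ)) {ε : ℝ} (hε : 0 < ε) :
    ∃ h : Po n, Lpoly Q h = 0 ∧ ∀ x ∈ sphere y ρ, |ev h x - f x| ≤ ε := by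
  obtain ⟨p, hp⟩ : ∃ p : Po n, ∀ x ∈ sphere y ρ, |ev p x - f x| ≤ ε := by
    have : CompactSpace (sphere y ρ) := isCompact_iff_compactSpace.1 (isCompact_sphere y ρ)
    let c : Fin n → C(sphere y ρ, ℝ) := fun i => ⟨fun x => x.1 i, by fun_prop⟩
    let φ : Po n →ₐ[ℝ] C(sphere y ρ, ℝ) := aeval c
    have hφ : ∀ p x, φ p x = ev p x.1 := by
      intro p x
      induction p using MvPolynomial.induction_on with
      | C a => simp [φ, ev]
      | add p q hp hq => simp [hp, hq, ev_add]
      | mul_X p k hp => rw [map_mul, ContinuousMap.mul_apply, hp, ev_mul]; simp [φ, ev, c]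
    have hs : φ.range.SeparatesPoints := by
      intro x z hxz
      have : ∃ i, x.1 i ≠ z.1 i := by
        by_contra! hcon
        exact hxz (Subtype.ext (by ext i; exact hcon i))
      obtain ⟨i, hi⟩ := this
      refine ⟨_, ⟨φ (X i), ⟨X i, rfl⟩, rfl⟩, ?_⟩
      simpa [hφ, ev_X] using hi
    obtain ⟨⟨g, ⟨p, rfl⟩⟩, hg⟩ := ContinuousMap.exists_mem_subalgebra_near_continuous_of_separatesPoints
      φ.range hs (fun x => f x.1) (continuousOn_iff_continuous_domRestrict.1 hf) ε hε
    refine ⟨p, fun x hx => ?_⟩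
    have := (hg ⟨x, hx⟩).le
    rw [← hφ p ⟨x, hx⟩]; exact this
  set k := (Lpoly Q p).totalDegree
  let Φ : restrictTotalDegree (Fin n) ℝ k →ₗ[ℝ] restrictTotalDegree (Fin n) ℝ k :=
    { toFun := fun q => ⟨Lpoly Q (Zp y ρ * q.1), by
        rw [mem_restrictTotalDegree]
        refine totalDegree_Lpoly _ _ _ ((totalDegree_mul _ _).trans ?_)
        have := totalDegree_Zp y ρ
        have := (mem_restrictTotalDegree _ _ _).1 q.2
        omega⟩
      map_add' := fun q q' => by ext1; simp [mul_add, Lpoly_add]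
      map_smul' := fun c q => by
        ext1
        simp only [SetLike.val_smul, RingHom.id_apply, MvPolynomial.smul_eq_C_mul]
        rw [mul_left_comm, Lpoly_C_mul] }
  have hinj : Function.Injective Φ := by
    rw [injective_iff_map_eq_zero]
    intro q hq
    have hq : Lpoly Q (Zp y ρ * q.1) = 0 := congrArg Subtype.val hq
    have hz : ∀ x ∈ sphere y ρ, ev (Zp y ρ * q.1) x = 0 := by
      intro x hx
      rw [mem_sphere, dist_eq_norm] at hx
      rw [ev_mul, ev_Zp, hx]; ring
    have h1 := harm_bdd hQ hq (fun x hx => (hz x hx).le)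
    have h2 := harm_bdd hQ (p := -(Zp y ρ * q.1)) (by rw [Lpoly_neg, hq, neg_zero])
      (fun x hx => (by rw [ev_neg, hz x hx, neg_zero] : ev (-(Zp y ρ * q.1)) x = 0).le)
    have : q.1 = 0 := by
      refine eq_zero_of_ball (y := y) hρ fun x hx => ?_
      have e1 := h1 x (ball_subset_closedBall hx)
      have e2 := h2 x (ball_subset_closedBall hx)
      rw [ev_neg] at e2
      have e3 : ev (Zp y ρ) x * ev q.1 x = 0 := by rw [← ev_mul]; linarith
      rw [mem_ball, dist_eq_norm] at hx
      have e4 : 0 < ev (Zp y ρ) x := by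
        rw [ev_Zp, sub_pos]; exact pow_lt_pow_left₀ hx (norm_nonneg _) two_ne_zero
      exact (mul_eq_zero.1 e3).resolve_left e4.ne'
    exact Subtype.ext this
  obtain ⟨q, hq⟩ := LinearMap.injective_iff_surjective.1 hinj
    ⟨Lpoly Q p, (mem_restrictTotalDegree _ _ _).2 le_rfl⟩
  have hq : Lpoly Q (Zp y ρ * q.1) = Lpoly Q p := congrArg Subtype.val hq
  refine ⟨p - Zp y ρ * q.1, by rw [Lpoly_sub, hq, sub_self], fun x hx => ?_⟩
  have := hp x hx
  rw [mem_sphere, dist_eq_norm] at hx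
  rw [ev_sub, ev_mul, ev_Zp, hx]
  simpa using this

end TC

namespace TC
open Topology Asymptotics MvPolynomial

variable {n : ℕ} {Q : Matrix (Fin n) (Fin n) ℝ} {lam Lam : ℝ}

def bil (Q : Matrix (Fin n) (Fin n) ℝ) (a b : En n) : ℝ := ∑ i, ∑ j, Q i j * a i * b j

lemma qf_lin (hs : ∀ i j, Q i j = Q j i) (α β : ℝ) (a b : En n) :
    qf Q (α • a + β • b) = α ^ 2 * qf Q a + 2 * (α * β * bil Q a b) + β ^ 2 * qf Q b := by
  have h : bil Q a b = ∑ i, ∑ j, Q i j * b i * a j := by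
    rw [bil, Finset.sum_comm]
    exact Finset.sum_congr rfl fun i _ => Finset.sum_congr rfl fun j _ => by rw [hs]; ring
  rw [two_mul]; nth_rewrite 1 [h]
  simp only [qf, bil, Finset.mul_sum, ← Finset.sum_add_distrib, PiLp.add_apply, PiLp.smul_apply,
    smul_eq_mul]
  exact Finset.sum_congr rfl fun i _ => Finset.sum_congr rfl fun j _ => by ring

def gv (p : Po n) (x : En n) : En n := WithLp.toLp 2 fun i => ev (pderiv i p) x

lemma ev_Gam (p q : Po n) (x : En n) : ev (Gam Q p q) x = bil Q (gv p x) (gv q x) := by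
  simp only [Gam, ev_sum, ev_mul, ev_C, bil, gv, mul_assoc]
lemma bil_self (a : En n) : bil Q a a = qf Q a := rfl

lemma Ell.lam_le (hQ : Ell lam Lam Q) : lam ≤ Lam := hQ.tr_lo.trans hQ.tr_hi
lemma Ell.T_pos (hQ : Ell lam Lam Q) : 0 < trQ Q 1 := hQ.lam_pos.trans_le hQ.tr_lo

lemma grad_Zp (y x : En n) (ρ : ℝ) : gv (Zp y ρ) x = (-2 : ℝ) • (x - y) := by
  ext i
  simp [gv, Zp, pderiv_pow, ev, pderiv_X, Pi.single_apply, Finset.sum_ite_eq]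

lemma Lpoly_Zp (y x : En n) (ρ : ℝ) : ev (Lpoly Q (Zp y ρ)) x = - 2 * trQ Q 1 := by
  simp only [Lpoly, ev_sum, ev_mul, ev_C, trQ, Finset.mul_sum]
  refine Finset.sum_congr rfl fun i _ => Finset.sum_congr rfl fun j _ => ?_
  have : pderiv i (pderiv j (Zp y ρ)) = C (-2 * (1 : Matrix (Fin n) (Fin n) ℝ) i j) := by
    have e : pderiv j (Zp y ρ) = C (-2) * (X j - C (y j)) := by
      simp only [Zp, map_sub, pderiv_C, map_sum, pderiv_pow, zero_sub]
      rw [Finset.sum_eq_single j]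
      · simp only [pderiv_X_self, map_sub, pderiv_C, map_neg, map_ofNat]; norm_num
      · intro k _ hk; simp [pderiv_X, hk]
      · simp
    rw [e, pderiv_C_mul, map_sub, pderiv_C, pderiv_X]
    rcases eq_or_ne j i with rfl | h
    · simp
    · simp [h, Matrix.one_apply, h.symm]
  rw [this, ev_C]; ring

lemma bernstein (hQ : Ell lam Lam Q) {y : En n} {ρ m : ℝ} (hρ : 0 < ρ) {h : Po n}
    (hh : Lpoly Q h = 0) (hb : ∀ x ∈ closedBall y ρ, |ev h x| ≤ m) (k : Fin n) :
    ∀ x ∈ closedBall y (ρ / 2), |ev (pderiv k h) x| ≤ 5 * (Lam / lam) * m / ρ := by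
  set p := pderiv k h with hp
  have hl := hQ.lam_pos
  have hL := hQ.lam_le
  have hL0 : 0 < Lam := hl.trans_le hL
  have hLp : Lpoly Q p = 0 := by rw [hp, Lpoly_pderiv, hh, map_zero]
  have hm : 0 ≤ m := (abs_nonneg _).trans (hb y (by simp [hρ.le]))
  set K := 14 * Lam * ρ ^ 2 / lam
  have hK : 0 ≤ K := by positivity
  set Z := Zp y ρ with hZ
  set φ : Po n := (Z * p) * (Z * p) + C K * (h * h) with hφ
  have key : ∀ x ∈ ball y ρ, 0 ≤ ev (Lpoly Q φ) x := by
    intro x hx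
    rw [mem_ball, dist_eq_norm] at hx
    have e0 : ev (Lpoly Q φ) x = 2 * (ev Z x ^ 2 * qf Q (gv p x)
        + ev p x ^ 2 * (ev Z x * ev (Lpoly Q Z) x + qf Q (gv Z x))
        + 4 * (ev Z x * ev p x * bil Q (gv Z x) (gv p x)) + K * qf Q (gv h x)) := by
      have : φ = (Z * Z) * (p * p) + C K * (h * h) := by rw [hφ]; ring
      have g1 : Gam Q (Z * Z) (p * p) = 4 * (Z * p * Gam Q Z p) := by
        simp only [Gam, Finset.mul_sum, pderiv_mul]
        exact Finset.sum_congr rfl fun i _ => Finset.sum_congr rfl fun j _ => by ring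
      rw [this, Lpoly_add, Lpoly_C_mul, Lpoly_mul Q hQ.symm (Z * Z), Lpoly_mul Q hQ.symm Z Z,
        Lpoly_mul Q hQ.symm p p, Lpoly_mul Q hQ.symm h h, g1, hLp, hh]
      have t2 : ev (2 : Po n) x = 2 := by simp [ev]
      have t4 : ev (4 : Po n) x = 4 := by simp [ev]
      have t0 : ev (0 : Po n) x = 0 := by simp [ev]
      simp only [ev_add, ev_mul, ev_C, ev_Gam, bil_self, t2, t4, t0]
      ring
    have e1 := hQ.lower ((ev Z x) • gv p x + (2 * ev p x) • gv Z x)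
    rw [qf_lin hQ.symm] at e1
    have hbs : bil Q (gv p x) (gv Z x) = bil Q (gv Z x) (gv p x) := by
      rw [bil, Finset.sum_comm]
      exact Finset.sum_congr rfl fun i _ => Finset.sum_congr rfl fun j _ => by rw [hQ.symm]; ring
    rw [hbs] at e1
    have e1' : 0 ≤ lam * ‖(ev Z x) • gv p x + (2 * ev p x) • gv Z x‖ ^ 2 := by positivity
    have e2 := hQ.lower (gv h x)
    have e3 : ev p x ^ 2 ≤ ‖gv h x‖ ^ 2 := by
      have := abs_coord (gv h x) k
      have := pow_le_pow_left₀ (abs_nonneg _) this 2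
      rwa [sq_abs] at this
    have e4 := hQ.upper (gv Z x)
    rw [hZ, grad_Zp, norm_smul] at e4
    have e5 : ev (Lpoly Q Z) x = -2 * trQ Q 1 := Lpoly_Zp y x ρ
    have e6 : 0 ≤ ev Z x ∧ ev Z x ≤ ρ ^ 2 := by
      rw [hZ, ev_Zp]
      have := pow_le_pow_left₀ (norm_nonneg _) hx.le 2
      exact ⟨by linarith, by nlinarith [norm_nonneg (x - y)]⟩
    have e7 : qf Q (gv Z x) ≤ 4 * Lam * ρ ^ 2 := by
      rw [hZ, grad_Zp]
      have := pow_le_pow_left₀ (norm_nonneg _) hx.le 2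
      refine e4.trans ?_
      norm_num
      nlinarith
    have e8 : ev Z x * trQ Q 1 ≤ ρ ^ 2 * Lam :=
      mul_le_mul e6.2 hQ.tr_hi hQ.T_pos.le (by positivity)
    have e9 : K * qf Q (gv h x) ≥ 14 * Lam * ρ ^ 2 * ev p x ^ 2 := by
      have : lam * ev p x ^ 2 ≤ qf Q (gv h x) := le_trans (by gcongr) e2
      calc K * qf Q (gv h x) ≥ K * (lam * ev p x ^ 2) := by gcongr
        _ = _ := by simp only [K]; field_simp
    rw [e0, e5]
    have e10 : ev p x ^ 2 * qf Q (gv Z x) ≤ ev p x ^ 2 * (4 * Lam * ρ ^ 2) := by gcongr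
    have e11 : ev p x ^ 2 * (ev Z x * trQ Q 1) ≤ ev p x ^ 2 * (ρ ^ 2 * Lam) := by gcongr
    nlinarith
  have hmax : ∀ x ∈ closedBall y ρ, ev φ x ≤ K * m ^ 2 := by
    refine MP hQ isOpen_ball (isCompact_closedBall y ρ) ball_subset_closedBall
      (ev_cont φ).continuousOn (fun x hx => ((LAt_ev Q φ x).subAt hQ).mono (key x hx))
      fun x hx hx' => ?_
    have hn : ‖x - y‖ = ρ := by
      simp only [mem_closedBall, mem_ball, not_lt, dist_eq_norm] at hx hx'
      linarith
    have := hb x hx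
    simp only [hφ, hZ, ev_add, ev_mul, ev_C, ev_Zp, hn]
    have h2 : ev h x ^ 2 ≤ m ^ 2 := by
      rw [← sq_abs]; exact pow_le_pow_left₀ (abs_nonneg _) this 2
    nlinarith
  intro x hx
  have h1 := hmax x (closedBall_subset_closedBall (by linarith) hx)
  rw [mem_closedBall, dist_eq_norm] at hx
  simp only [hφ, hZ, ev_add, ev_mul, ev_C, ev_Zp] at h1
  have h2 : ‖x - y‖ ^ 2 ≤ (ρ / 2) ^ 2 := pow_le_pow_left₀ (norm_nonneg _) hx 2
  have h3 : 3 / 4 * ρ ^ 2 ≤ ρ ^ 2 - ‖x - y‖ ^ 2 := by nlinarith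
  have h4 : (3 / 4 * ρ ^ 2) ^ 2 * ev p x ^ 2 ≤ K * m ^ 2 := by
    have : (3 / 4 * ρ ^ 2) ^ 2 ≤ (ρ ^ 2 - ‖x - y‖ ^ 2) ^ 2 := pow_le_pow_left₀ (by positivity) h3 2
    have : (3 / 4 * ρ ^ 2) ^ 2 * ev p x ^ 2 ≤ (ρ ^ 2 - ‖x - y‖ ^ 2) ^ 2 * ev p x ^ 2 := by gcongr
    nlinarith [mul_nonneg hK (mul_self_nonneg (ev h x))]
  set a := Lam / lam with ha
  have ha1 : 1 ≤ a := (one_le_div hl).2 hL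
  have hKa : K = 14 * a * ρ ^ 2 := by simp only [K, ha]; ring
  rw [hKa] at h4
  have h5 : (ρ * ev p x) ^ 2 ≤ (5 * a * m) ^ 2 := by
    have h6 : ρ ^ 2 * ((ρ * ev p x) ^ 2 * (9 / 16)) ≤ ρ ^ 2 * (14 * a * m ^ 2) := by nlinarith
    have h7 := le_of_mul_le_mul_left h6 (by positivity)
    have : a * m ^ 2 ≤ a * a * m ^ 2 := by
      have := mul_nonneg (mul_nonneg (sub_nonneg.2 ha1) (by positivity : 0 ≤ a)) (sq_nonneg m)
      nlinarith
    nlinarith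
  have h6 := abs_le_of_sq_le_sq h5 (by positivity)
  rw [abs_mul, abs_of_pos hρ] at h6
  rw [le_div_iff₀ hρ]; linarith

lemma hasDeriv_ev (p : Po n) (x w : En n) (t : ℝ) :
    HasDerivAt (fun t : ℝ => ev p (x + t • w)) (dotp (fun i => ev (pderiv i p) (x + t • w)) w) t := by
  rw [hasDerivAt_iff_isLittleO_nhds_zero]
  have h := T2_ev p (x + t • w)
  have ht : Tendsto (fun s : ℝ => s • w) (𝓝 0) (𝓝 0) := by
    have : Continuous (fun s : ℝ => s • w) := by fun_prop
    simpa using this.tendsto 0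
  have h1 := h.comp_tendsto ht
  have h2 : (fun s : ℝ => s ^ 2) =o[𝓝 0] (fun s : ℝ => s) := by
    simpa using isLittleO_pow_id (𝕜 := ℝ) (n := 2) (by norm_num)
  have h3 : ((fun y : En n => ‖y‖ ^ 2) ∘ fun s : ℝ => s • w) =O[𝓝 0] (fun s : ℝ => s ^ 2) := by
    refine IsBigO.of_bound (‖w‖ ^ 2) (Eventually.of_forall fun s => ?_)
    simp [norm_smul, mul_pow, mul_comm]
  have h4 := (h1.trans_isBigO h3).trans h2
  have h5 := h4.add (h2.const_mul_left (1 / 2 * qf (hess p (x + t • w)) w))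
  refine h5.congr_left fun s => ?_
  simp only [Function.comp, dotp_smul_right, qf_smul_right, smul_eq_mul, add_smul, add_assoc]
  ring

lemma mv {g g' : ℝ → ℝ} {a b G : ℝ} (hab : a ≤ b) (hg : ∀ t ∈ Icc a b, HasDerivAt g (g' t) t)
    (hG : ∀ t ∈ Icc a b, |g' t| ≤ G) : |g b - g a| ≤ G * (b - a) := by
  have := Convex.norm_image_sub_le_of_norm_hasDerivWithin_le (f := g) (f' := g') (s := Icc a b)
    (x := a) (y := b) (C := G) (fun x hx => (hg x hx).hasDerivWithinAt) (fun x hx => hG x hx)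
    (convex_Icc a b) (by simp [hab]) (by simp [hab])
  simpa [abs_of_nonneg (sub_nonneg.2 hab)] using this

lemma harm_lip (hQ : Ell lam Lam Q) {y : En n} {ρ m : ℝ} (hρ : 0 < ρ) {h : Po n}
    (hh : Lpoly Q h = 0) (hb : ∀ x ∈ closedBall y ρ, |ev h x| ≤ m) {x z : En n}
    (hx : x ∈ closedBall y (ρ / 2)) (hz : z ∈ closedBall y (ρ / 2)) :
    |ev h z - ev h x| ≤ n * (5 * (Lam / lam) * m / ρ) * ‖z - x‖ := by
  have := mv (g := fun t => ev h (x + t • (z - x))) (a := 0) (b := 1)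
    (G := n * (5 * (Lam / lam) * m / ρ) * ‖z - x‖) zero_le_one
    (fun t _ => hasDeriv_ev h x (z - x) t) (fun t ht => by
      refine (dotp_bound _ _).trans ?_
      gcongr
      calc _ ≤ ∑ i : Fin n, 5 * (Lam / lam) * m / ρ := by
            refine Finset.sum_le_sum fun i _ => bernstein hQ hρ hh hb i _ ?_
            have := (convex_closedBall y (ρ / 2)).add_smul_sub_mem hx hz ht
            exact this
        _ = _ := by simp)
  simpa using this

lemma LAt_quad (b : Fin n → ℝ) {A : Matrix (Fin n) (Fin n) ℝ} (hA : A.IsSymm) (x0 x : En n) :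
    LAt Q (fun z => dotp b (z - x0) + 1 / 2 * qf A (z - x0)) x (trQ Q A) := by
  refine ⟨fun i => b i + ∑ j, A i j * (x - x0) j, A, hA, ?_, rfl⟩
  refine (isLittleO_zero _ _).congr_left fun w => ?_
  have h1 := qf_lin (Q := A) (fun i j => (hA.apply i j).symm) 1 1 w (x - x0)
  simp only [one_smul] at h1
  beta_reduce
  rw [show x + w - x0 = w + (x - x0) by abel, h1]
  have h2 : dotp (fun i => b i + ∑ j, A i j * (x - x0) j) w = dotp b w + bil A w (x - x0) := by
    simp only [dotp, bil, add_mul, Finset.sum_add_distrib, Finset.sum_mul]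
    congr 1
    exact Finset.sum_congr rfl fun i _ => Finset.sum_congr rfl fun j _ => by ring
  have h3 : dotp b (w + (x - x0)) = dotp b w + dotp b (x - x0) := by
    simp [dotp, mul_add, Finset.sum_add_distrib]
  rw [h2, h3]; ring

lemma repl_up (hQ : Ell lam Lam Q) {y : En n} {ρ A ε : ℝ} (hA : 0 ≤ A) {U : En n → ℝ}
    (hc : ContinuousOn U (closedBall y ρ)) (hs : ∀ x ∈ ball y ρ, SubAt Q U (-A) x) {h : Po n}
    (hh : Lpoly Q h = 0) (hb : ∀ x ∈ sphere y ρ, U x ≤ ev h x + ε) :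
    ∀ x ∈ closedBall y ρ, U x ≤ ev h x + ε + A * ρ ^ 2 / (2 * lam) := by
  have hT := hQ.T_pos
  have hl := hQ.lam_pos
  set c := A / (2 * trQ Q 1)
  have hc0 : 0 ≤ c := by positivity
  have key := MP hQ (u := fun x => U x + ev (-h) x + c * ‖x - y‖ ^ 2) (m := ε + c * ρ ^ 2) isOpen_ball
    (isCompact_closedBall y ρ) ball_subset_closedBall
    ((hc.add (ev_cont _).continuousOn).add (by fun_prop)) (fun x hx => ?_) (fun x hx hx' => ?_)
  · intro x hx
    have := key x hx
    rw [ev_neg] at this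
    have h1 : c * ρ ^ 2 ≤ A * ρ ^ 2 / (2 * lam) := by
      simp only [c]; rw [div_mul_eq_mul_div]
      have := hQ.tr_lo
      gcongr
    have : 0 ≤ c * ‖x - y‖ ^ 2 := by positivity
    linarith
  · have := ((hs x hx).add_T2 hQ (LAt_ev Q (-h) x)).add_T2 hQ ((LAt_dist (Q := Q) y x).const_mul c)
    refine this.mono ?_
    have e1 : c * (2 * trQ Q 1) = A := by simp only [c]; field_simp
    rw [Lpoly_neg, hh, neg_zero, e1]; simp [ev]
  · have hn : ‖x - y‖ = ρ := by
      simp only [mem_closedBall, mem_ball, not_lt, dist_eq_norm] at hx hx'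
      linarith
    have := hb x (by rw [mem_sphere, dist_eq_norm]; exact hn)
    rw [ev_neg, hn]; linarith

lemma SubAt.add (hQ : Ell lam Lam Q) {u v : En n → ℝ} {a b r : ℝ} {x0 : En n} (hr : 0 < r)
    (hu : ContinuousOn u (ball x0 r)) (hv : ContinuousOn v (ball x0 r))
    (su : ∀ x ∈ ball x0 r, SubAt Q u a x) (sv : ∀ x ∈ ball x0 r, SubAt Q v b x) :
    SubAt Q (fun x => u x + v x) (a + b) x0 := by
  intro p A hA ht
  by_contra! hlt
  have hT := hQ.T_pos
  set e := (a + b - trQ Q A) / (4 * trQ Q 1)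
  have he : 0 < e := by have : 0 < a + b - trQ Q A := by linarith
                        positivity
  obtain ⟨δ, hδ, hb⟩ := Metric.eventually_nhds_iff_ball.1 ht
  set ρ := min δ r / 2
  have hρ : 0 < ρ := by positivity
  have hρr : ρ < r := by have := min_le_right δ r; simp only [ρ]; linarith
  have hρδ : ρ < δ := by have := min_le_left δ r; simp only [ρ]; linarith
  have hsub : closedBall x0 ρ ⊆ ball x0 r := closedBall_subset_ball hρr
  -- reduce v to b = 0
  set β := -b / (2 * trQ Q 1)
  obtain ⟨h, hh, happ⟩ := star hQ x0 hρ (f := fun x => v x + β * ‖x - x0‖ ^ 2)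
    (((hv.mono hsub).add (by fun_prop)).mono sphere_subset_closedBall) (ε := e * ρ ^ 2 / 4) (by positivity)
  have hbT : β * (2 * trQ Q 1) = -b := by simp only [β]; field_simp
  have k1 := repl_up hQ (y := x0) (ρ := ρ) (A := 0) (ε := e * ρ ^ 2 / 4) le_rfl
    (U := fun x => v x + β * ‖x - x0‖ ^ 2) ((hv.mono hsub).add (by fun_prop))
    (fun x hx => by
      have := (sv x (hsub (ball_subset_closedBall hx))).add_T2 hQ ((LAt_dist (Q := Q) x0 x).const_mul β)
      rw [hbT] at this
      simpa using this) hh (fun x hx => by have := (abs_le.1 (happ x hx)).1; linarith) x0 (by simp [hρ.le])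
  set B : Matrix (Fin n) (Fin n) ℝ := (-1 : ℝ) • (A + (2 * e) • 1)
  have hBs : B.IsSymm := (hA.add (Matrix.isSymm_one.smul _)).smul _
  have hBt : trQ Q B = - trQ Q A - 2 * e * trQ Q 1 := by
    simp only [B, trQ_smul, trQ_add]; ring
  have key := MP hQ (u := fun x => u x + ev h x + (-β) * ‖x - x0‖ ^ 2 + (dotp (-p) (x - x0) + 1 / 2 * qf B (x - x0)))
    (m := u x0 + v x0 - e * ρ ^ 2 + e * ρ ^ 2 / 4) isOpen_ball
    (isCompact_closedBall x0 ρ) ball_subset_closedBall ?_ (fun x hx => ?_) (fun x hx hx' => ?_) x0 (by simp [hρ.le])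
  · simp [dotp, qf] at key k1
    have : 0 < e * ρ ^ 2 := by positivity
    linarith
  · refine (((hu.mono hsub).add (ev_cont _).continuousOn).add (by fun_prop)).add ?_
    unfold dotp qf
    fun_prop
  · have := (((su x (hsub (ball_subset_closedBall hx))).add_T2 hQ (LAt_ev Q h x)).add_T2 hQ
      ((LAt_dist (Q := Q) x0 x).const_mul (-β))).add_T2 hQ (LAt_quad (Q := Q) (-p) hBs x0 x)
    refine this.mono ?_
    rw [hh, neg_mul, hbT, hBt]
    have e1 : 4 * (e * trQ Q 1) = a + b - trQ Q A := by simp only [e]; field_simp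
    simp only [ev, map_zero]
    linarith
  · have hn : ‖x - x0‖ = ρ := by
      simp only [mem_closedBall, mem_ball, not_lt, dist_eq_norm] at hx hx'
      linarith
    have h1 := (abs_le.1 (happ x (by rw [mem_sphere, dist_eq_norm]; exact hn))).2
    have h2 := hb (x - x0) (by simp [hn, hρδ])
    simp only [add_sub_cancel] at h2
    simp only [B, qf_smul, qf_add, qf_one, hn] at h1 ⊢
    have : dotp (-p) (x - x0) = - dotp p (x - x0) := by simp [dotp]
    rw [this]
    linarith

end TC

namespace TC
open Topology Asymptotics MvPolynomial

variable {n : ℕ} [NeZero n] {Q : Matrix (Fin n) (Fin n) ℝ} {lam Lam : ℝ}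

def e1 (n : ℕ) [NeZero n] : En n := EuclideanSpace.single (0 : Fin n) (1 : ℝ)

lemma e1_zero : (e1 n) 0 = 1 := by simp [e1]
lemma e1_ne {i : Fin n} (h : i ≠ 0) : (e1 n) i = 0 := by simp [e1, h]
lemma norm_e1 : ‖e1 n‖ = 1 := by simp [e1]
lemma add_e1_zero (x : En n) (t : ℝ) : (x + t • e1 n) 0 = x 0 + t := by simp [e1]

lemma dotp_e1 (b : Fin n → ℝ) : dotp b (e1 n) = b 0 := by
  simp [dotp, e1]

lemma hasDeriv_e1 (p : Po n) (x : En n) (t : ℝ) :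
    HasDerivAt (fun t : ℝ => ev p (x + t • e1 n)) (ev (pderiv 0 p) (x + t • e1 n)) t := by
  have := hasDeriv_ev p x (e1 n) t
  rwa [dotp_e1] at this

lemma third_diff (h : Po n) (x : En n) {s G : ℝ} (hs : 0 ≤ s)
    (hG : ∀ t ∈ Icc (-(3 * s)) 0, |ev (pderiv 0 (pderiv 0 (pderiv 0 h))) (x + t • e1 n)| ≤ G) :
    |ev h x - 3 * ev h (x + (-s) • e1 n) + 3 * ev h (x + (-(2 * s)) • e1 n)
      - ev h (x + (-(3 * s)) • e1 n)| ≤ G * s ^ 3 := by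
  set g0 : ℝ → ℝ := fun t => ev h (x + t • e1 n)
  set g1 : ℝ → ℝ := fun t => ev (pderiv 0 h) (x + t • e1 n)
  set g2 : ℝ → ℝ := fun t => ev (pderiv 0 (pderiv 0 h)) (x + t • e1 n)
  have d0 : ∀ t, HasDerivAt g0 (g1 t) t := fun t => hasDeriv_e1 _ _ _
  have d1 : ∀ t, HasDerivAt g1 (g2 t) t := fun t => hasDeriv_e1 _ _ _
  have d2 : ∀ t, HasDerivAt g2 (ev (pderiv 0 (pderiv 0 (pderiv 0 h))) (x + t • e1 n)) t :=
    fun t => hasDeriv_e1 _ _ _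
  have sh : ∀ {g g' : ℝ → ℝ}, (∀ t, HasDerivAt g (g' t) t) → ∀ t, HasDerivAt (fun t => g (t - s)) (g' (t - s)) t := by
    intro g g' hg t
    simpa using (hg (t - s)).comp_sub_const t s
  have s2 : ∀ t ∈ Icc (-(2 * s)) 0, |g2 t - g2 (t - s)| ≤ G * s := by
    intro t ht
    have := mv (a := t - s) (b := t) (G := G) (by linarith) (fun r _ => d2 r) (fun r hr =>
      hG r ⟨by linarith [hr.1, ht.1], by linarith [hr.2, ht.2]⟩)
    simpa using this
  have s1 : ∀ t ∈ Icc (-s) 0, |(g1 t - g1 (t - s)) - (g1 (t - s) - g1 (t - s - s))| ≤ G * s * s := by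
    intro t ht
    have := mv (g := fun t => g1 t - g1 (t - s)) (a := t - s) (b := t) (G := G * s) (by linarith)
      (fun r _ => (d1 r).sub (sh d1 r)) (fun r hr =>
      s2 r ⟨by linarith [hr.1, ht.1], by linarith [hr.2, ht.2]⟩)
    simpa using this
  have := mv (g := fun t => (g0 t - g0 (t - s)) - (g0 (t - s) - g0 (t - s - s))) (a := -s) (b := 0)
    (G := G * s * s) (by linarith)
      (fun r _ => ((d0 r).sub (sh d0 r)).sub ((sh d0 r).sub (sh (sh d0) r))) (fun r hr => s1 r hr)
  have e0 : g0 0 = ev h x := by simp [g0]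
  simp only [zero_sub, sub_neg_eq_add, zero_add, e0] at this
  rw [show -s - s = -(2 * s) by ring, show -(2 * s) - s = -(3 * s) by ring] at this
  convert this using 1
  · congr 1; ring
  · ring

structure Loc (Q : Matrix (Fin n) (Fin n) ℝ) (v : En n → ℝ) (R κ : ℝ) : Prop where
  cont : ContinuousOn v (ball 0 R)
  zero : ∀ x : En n, x 0 ≤ 0 → v x = 0
  sub : ∀ x ∈ ball (0 : En n) R, 0 < x 0 → SubAt Q v 0 x
  sup : ∀ x ∈ ball (0 : En n) R, 0 < x 0 → SubAt Q (fun z => -v z) (-1) x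
  one : ∀ x ∈ ball (0 : En n) R, 0 < x 0 → v x ≠ 0 → SubAt Q v 1 x
  kink : ∀ x ∈ ball (0 : En n) R, x 0 = 0 → ∀ c > κ, ∀ᶠ t in 𝓝[>] (0 : ℝ), |v (x + t • e1 n)| ≤ c * t

lemma cont_coord (i : Fin n) : Continuous (fun x : En n => x i) := by fun_prop

lemma kink_aux (hQ : Ell lam Lam Q) {w : En n → ℝ} {x : En n} {c c' : ℝ} (hx : x 0 = 0) (hcc : c' < c)
    (hz : ∀ x : En n, x 0 ≤ 0 → w x = 0)
    (hk : ∀ᶠ t in 𝓝[>] (0 : ℝ), |w (x + t • e1 n)| ≤ c' * t) :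
    SubAt Q (fun z => w z + c * max (z 0) 0) (-1) x := by
  intro b A hA ht
  exfalso
  have hp : ∀ r : ℝ, Tendsto (fun t : ℝ => (r * t) • e1 n) (𝓝[>] 0) (𝓝 0) := by
    intro r
    have : Continuous (fun t : ℝ => (r * t) • e1 n) := by fun_prop
    have := this.tendsto 0
    rw [mul_zero, zero_smul] at this
    exact this.mono_left nhdsWithin_le_nhds
  set α := |qf A (e1 n)|
  have hlt : ∀ᶠ t in 𝓝[>] (0 : ℝ), t * α < c - c' := by
    have : Tendsto (fun t : ℝ => t * α) (𝓝[>] 0) (𝓝 0) := by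
      have : Continuous (fun t : ℝ => t * α) := by fun_prop
      simpa using (this.tendsto 0).mono_left nhdsWithin_le_nhds
    exact this.eventually_lt_const (by linarith)
  obtain ⟨t, h1, h2, h3, h4, h5⟩ := (((hp 1).eventually ht).and (((hp (-1)).eventually ht).and
    (hk.and (hlt.and self_mem_nhdsWithin)))).exists
  have h5 : 0 < t := h5
  have w0 : w x = 0 := hz x hx.le
  simp only [one_mul, neg_mul, dotp_smul_right, qf_smul_right, dotp_e1, add_e1_zero, hx, zero_add, w0] at h1 h2
  rw [hz (x + (-t) • e1 n) (by rw [add_e1_zero]; linarith)] at h2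
  rw [max_eq_left h5.le] at h1
  rw [max_eq_right (by linarith)] at h2
  simp only [max_self, mul_zero, zero_add, add_zero, neg_sq] at h1 h2
  have h6 := (abs_le.1 h3).1
  have h7 : qf A (e1 n) ≤ α := le_abs_self _
  have h8 : t ^ 2 * qf A (e1 n) ≤ t * (t * α) := by rw [pow_two, mul_assoc]; gcongr
  have h9 : t * (t * α) < t * (c - c') := by gcongr
  nlinarith

lemma kink_sub (hQ : Ell lam Lam Q) {w : En n → ℝ} {x : En n} {c κ a : ℝ} (ha : -1 ≤ a) (hcc : κ < c)
    (hz : ∀ x : En n, x 0 ≤ 0 → w x = 0) (hs : 0 < x 0 → SubAt Q w a x)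
    (hk : x 0 = 0 → ∀ c > κ, ∀ᶠ t in 𝓝[>] (0 : ℝ), |w (x + t • e1 n)| ≤ c * t) :
    SubAt Q (fun z => w z + c * max (z 0) 0) (-1) x := by
  rcases lt_trichotomy (x 0) 0 with h | h | h
  · refine ((subAt_const hQ 0 x).congr ?_).mono (by norm_num)
    have : ∀ᶠ z : En n in 𝓝 x, z 0 < 0 := (cont_coord 0).continuousAt.eventually_lt_const h
    filter_upwards [this] with z hz'
    rw [hz z hz'.le, max_eq_right hz'.le]; simp
  · exact kink_aux hQ h (c' := (κ + c) / 2) (by linarith) hz (hk h _ (by linarith))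
  · have := (hs h).add_T2 hQ ((LAt_coord (Q := Q) 0 x).const_mul c)
    refine (this.congr ?_).mono (by linarith)
    have : ∀ᶠ z : En n in 𝓝 x, 0 < z 0 := (cont_coord 0).continuousAt.eventually_const_lt h
    filter_upwards [this] with z hz'
    rw [max_eq_left hz'.le]

/-- interior approximation by harmonic polynomials -/
lemma approx_int (hQ : Ell lam Lam Q) {U : En n → ℝ} {y : En n} {ρ ε : ℝ} (hρ : 0 < ρ) (hε : 0 < ε)
    (hc : ContinuousOn U (closedBall y ρ)) (h1 : ∀ x ∈ ball y ρ, SubAt Q U (-1) x)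
    (h2 : ∀ x ∈ ball y ρ, SubAt Q (fun z => - U z) (-1) x) :
    ∃ h : Po n, Lpoly Q h = 0 ∧ ∀ x ∈ closedBall y ρ, |U x - ev h x| ≤ ε + ρ ^ 2 / (2 * lam) := by
  obtain ⟨h, hh, ha⟩ := star hQ y hρ (hc.mono sphere_subset_closedBall) hε
  refine ⟨h, hh, fun x hx => ?_⟩
  have k1 := repl_up hQ (ε := ε) zero_le_one hc h1 hh (fun x hx => by have := (abs_le.1 (ha x hx)).1; linarith) x hx
  have k2 := repl_up hQ (ε := ε) zero_le_one hc.neg h2 (h := -h) (by rw [Lpoly_neg, hh, neg_zero]) (fun x hx => by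
    have := (abs_le.1 (ha x hx)).2; rw [ev_neg]; simp only [Pi.neg_apply]; linarith) x hx
  rw [ev_neg] at k2
  simp only [one_mul, Pi.neg_apply] at k1 k2
  rw [abs_le]; constructor <;> linarith

lemma approx_bdry (hQ : Ell lam Lam Q) {v : En n → ℝ} {R κ : ℝ} (hv : Loc Q v R κ) {y : En n} {ρ ε : ℝ}
    (hκ : 0 ≤ κ) (hy : y 0 = 0) (hR : ‖y‖ + ρ < R) (hρ : 0 < ρ) (hε : 0 < ε) :
    ∃ h : Po n, Lpoly Q h = 0 ∧ (∀ x ∈ sphere y ρ, |ev h x - v x| ≤ ε) ∧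
      ∀ x ∈ closedBall y ρ, |v x - ev h x| ≤ ε + (κ + ε) * ρ + ρ ^ 2 / (2 * lam) := by
  have hsub : closedBall y ρ ⊆ ball 0 R := by
    intro x hx
    rw [mem_closedBall, dist_eq_norm] at hx
    rw [mem_ball, dist_zero_right]
    calc ‖x‖ = ‖y + (x - y)‖ := by congr 1; abel
      _ ≤ ‖y‖ + ‖x - y‖ := norm_add_le _ _
      _ < R := by linarith
  have hX : ∀ x ∈ closedBall y ρ, max (x 0) 0 ≤ ρ := by
    intro x hx
    rw [mem_closedBall, dist_eq_norm] at hx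
    have := (abs_le.1 (abs_coord (x - y) 0)).2
    simp only [PiLp.sub_apply, hy, sub_zero] at this
    exact max_le (by linarith) hρ.le
  have hc : ContinuousOn v (closedBall y ρ) := hv.cont.mono hsub
  have hm : ContinuousOn (fun z : En n => (κ + ε) * max (z 0) 0) (closedBall y ρ) := by fun_prop
  obtain ⟨h, hh, ha⟩ := star hQ y hρ (hc.mono sphere_subset_closedBall) hε
  refine ⟨h, hh, ha, fun x hx => ?_⟩
  have k1 := repl_up hQ (ε := ε + (κ + ε) * ρ) zero_le_one (hc.add hm) (fun x hx => kink_sub hQ (a := 0) (κ := κ) (by norm_num) (by linarith)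
    hv.zero (hv.sub x (hsub (ball_subset_closedBall hx))) (hv.kink x (hsub (ball_subset_closedBall hx)))) hh
    (fun x hx => by
      have := (abs_le.1 (ha x hx)).1
      have h3 := hX x (sphere_subset_closedBall hx)
      have : (κ + ε) * max (x 0) 0 ≤ (κ + ε) * ρ := by gcongr
      simp only [Pi.add_apply] at *
      linarith) x hx
  have k2 := repl_up hQ (ε := ε + (κ + ε) * ρ) (h := -h) zero_le_one (hc.neg.add hm) (fun x hx => kink_sub hQ (w := fun z => - v z) (a := -1) (κ := κ) le_rfl (by linarith)
    (fun x hx => by simp [hv.zero x hx]) (hv.sup x (hsub (ball_subset_closedBall hx)))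
    (fun h c hc => by simpa using hv.kink x (hsub (ball_subset_closedBall hx)) h c hc)) (by rw [Lpoly_neg, hh, neg_zero])
    (fun x hx => by
      have := (abs_le.1 (ha x hx)).2
      have h3 := hX x (sphere_subset_closedBall hx)
      have : (κ + ε) * max (x 0) 0 ≤ (κ + ε) * ρ := by gcongr
      rw [ev_neg]
      simp only [Pi.add_apply, Pi.neg_apply] at *
      linarith) x hx
  rw [ev_neg] at k2
  have h3 : 0 ≤ (κ + ε) * max (x 0) 0 := by positivity
  simp only [one_mul, Pi.neg_apply, Pi.add_apply] at k1 k2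
  rw [abs_le]; constructor <;> linarith

end TC

namespace TC
open Topology Asymptotics MvPolynomial

variable {n : ℕ} [NeZero n] {Q : Matrix (Fin n) (Fin n) ℝ} {lam Lam : ℝ}

lemma harm_abs (hQ : Ell lam Lam Q) {y : En n} {ρ m : ℝ} {p : Po n} (hp : Lpoly Q p = 0)
    (hb : ∀ x ∈ sphere y ρ, |ev p x| ≤ m) : ∀ x ∈ closedBall y ρ, |ev p x| ≤ m := by
  intro x hx
  have h1 := harm_bdd hQ hp (fun x hx => (abs_le.1 (hb x hx)).2) x hx
  have h2 := harm_bdd hQ (p := -p) (m := m) (by rw [Lpoly_neg, hp, neg_zero]) (fun x hx => by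
    have := (abs_le.1 (hb x hx)).1; rw [ev_neg]; linarith) x hx
  rw [ev_neg] at h2
  rw [abs_le]; constructor <;> linarith

lemma in_ball {y x : En n} {r R : ℝ} (hx : x ∈ ball y r) (hR : ‖y‖ + r ≤ R) : x ∈ ball (0 : En n) R := by
  rw [mem_ball, dist_eq_norm] at hx
  rw [mem_ball, dist_zero_right]
  calc ‖x‖ = ‖y + (x - y)‖ := by congr 1; abel
      _ ≤ ‖y‖ + ‖x - y‖ := norm_add_le _ _
      _ < R := by linarith

/-- growth step -/
lemma growth_step (lam Lam : ℝ) (hl : 0 < lam) (hL : lam ≤ Lam) :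
    ∃ ρ : ℝ, 0 < ρ ∧ ρ ≤ 1 / 64 ∧ ∃ δ : ℝ, 0 < δ ∧ ∀ (Q : Matrix (Fin n) (Fin n) ℝ), Ell lam Lam Q →
      ∀ (v : En n → ℝ) (R κ : ℝ), Loc Q v R κ → 0 ≤ κ → ∀ (y : En n), y 0 = 0 → ∀ r S : ℝ, 0 < r →
      ‖y‖ + r ≤ R → (∀ x ∈ ball y r, |v x| ≤ S) → r ^ 2 ≤ δ * S → r * κ ≤ δ * S →
      ∀ x ∈ ball y (ρ * r), |v x| ≤ ρ ^ 2 * S := by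
  set a := 5 * (Lam / lam) with ha
  have ha5 : 5 ≤ a := by have := (one_le_div hl).2 hL; linarith
  have ha3 : 125 ≤ a ^ 3 := by have := pow_le_pow_left₀ (by norm_num) ha5 3; norm_num at this; exact this
  set ρ := 1 / (256 * a ^ 3) with hρd
  have hρ : 0 < ρ := by positivity
  have hρ1 : ρ ≤ 1 / 64 := by
    rw [hρd]; apply one_div_le_one_div_of_le <;> linarith
  have hρa : 128 * a ^ 3 * ρ = 1 / 2 := by rw [hρd]; field_simp; norm_num
  set δ := ρ ^ 2 / (32 * (1 + 1 / lam)) with hδd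
  have hδ : 0 < δ := by positivity
  refine ⟨ρ, hρ, hρ1, δ, hδ, ?_⟩
  intro Q hQ v R κ hv hκ y hy r S hr hR hS h1 h2 x hx
  have hS0 : 0 < S := by
    by_contra! h
    have : δ * S ≤ 0 := mul_nonpos_of_nonneg_of_nonpos hδ.le h
    nlinarith [sq_pos_of_pos hr]
  set ε := min S (ρ ^ 2 * S / (32 * (1 + r)))
  have hε : 0 < ε := by positivity
  have hεS : ε ≤ S := min_le_left _ _
  have hε2 : ε * (1 + r) ≤ ρ ^ 2 * S / 32 := by
    have : ε ≤ ρ ^ 2 * S / (32 * (1 + r)) := min_le_right _ _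
    calc ε * (1 + r) ≤ ρ ^ 2 * S / (32 * (1 + r)) * (1 + r) := by gcongr
      _ = _ := by field_simp
  obtain ⟨h, hh, hsph, happ⟩ := approx_bdry hQ hv hκ hy (ρ := r / 2) (ε := ε) (by linarith) (by positivity) hε
  set E := ε + (κ + ε) * (r / 2) + (r / 2) ^ 2 / (2 * lam) with hEd
  have hE : 8 * E ≤ ρ ^ 2 * S / 2 := by
    have e1 : δ * (1 + 1 / lam) = ρ ^ 2 / 32 := by rw [hδd]; field_simp
    have e2 : (r / 2) ^ 2 / (2 * lam) ≤ δ * S * (1 / lam) / 8 := by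
      rw [show (r / 2) ^ 2 / (2 * lam) = r ^ 2 * (1 / lam) / 8 by field_simp; norm_num]
      gcongr
    have e3 : (κ + ε) * (r / 2) ≤ δ * S / 2 + ε * r / 2 := by nlinarith
    have e4 : δ * S * (1 + 1 / lam) = ρ ^ 2 * S / 32 := by
      rw [mul_right_comm, e1]; ring
    have e5 : 0 ≤ δ * S * (1 / lam) := by positivity
    have e6 : 0 ≤ ε * r := by positivity
    have e7 : 0 < ρ ^ 2 * S := by positivity
    nlinarith
  have hb0 : ∀ x ∈ closedBall y (r / 2), |ev h x| ≤ 2 * S := by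
    refine harm_abs hQ hh fun x hx => ?_
    have k1 := hsph x hx
    have k2 := hS x (by rw [mem_sphere] at hx; rw [mem_ball]; linarith)
    have := abs_sub_abs_le_abs_sub (ev h x) (v x)
    linarith
  have hh1 : Lpoly Q (pderiv 0 h) = 0 := by rw [Lpoly_pderiv, hh, map_zero]
  have hh2 : Lpoly Q (pderiv 0 (pderiv 0 h)) = 0 := by rw [Lpoly_pderiv, hh1, map_zero]
  have b1 := bernstein hQ (by positivity) hh hb0 0
  have b2 := bernstein hQ (by positivity) hh1 b1 0
  have b3 := bernstein hQ (by positivity) hh2 b2 0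
  rw [← ha] at b3
  rcases le_or_gt (x 0) 0 with hx0 | hx0
  · rw [hv.zero x hx0, abs_zero]; positivity
  rw [mem_ball, dist_eq_norm] at hx
  set s := ρ * r
  have hs : 0 < s := by positivity
  have hs64 : s ≤ r / 64 := by simp only [s]; nlinarith
  have hball : ∀ t ∈ Icc (-(3 * s)) 0, ‖x + t • e1 n - y‖ ≤ 4 * s := by
    intro t ht
    calc ‖x + t • e1 n - y‖ = ‖(x - y) + t • e1 n‖ := by congr 1; abel
      _ ≤ ‖x - y‖ + ‖t • e1 n‖ := norm_add_le _ _
      _ ≤ s + 3 * s := by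
        rw [norm_smul, norm_e1, mul_one, Real.norm_eq_abs, abs_of_nonpos ht.2]
        linarith [ht.1]
      _ = _ := by ring
  have td := third_diff h x (s := s) (G := 128 * a ^ 3 * S / r ^ 3) hs.le (fun t ht => by
    refine (b3 _ ?_).trans (le_of_eq ?_)
    · rw [mem_closedBall, dist_eq_norm]
      have := hball t ht
      linarith
    · field_simp; norm_num)
  have hxs : x 0 < s := by
    have := (abs_le.1 (abs_coord (x - y) 0)).2
    simp only [PiLp.sub_apply, hy, sub_zero] at this
    linarith
  have hz : ∀ t ∈ Icc (-(3 * s)) (-s), |ev h (x + t • e1 n)| ≤ E := by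
    intro t ht
    have h1 := happ (x + t • e1 n) (by
      rw [mem_closedBall, dist_eq_norm]
      have := hball t ⟨ht.1, by linarith [ht.2]⟩
      linarith)
    rw [hv.zero _ (by rw [add_e1_zero]; linarith [ht.2]), zero_sub, abs_neg] at h1
    exact h1
  have z1 := abs_le.1 (hz (-s) ⟨by linarith, by linarith⟩)
  have z2 := abs_le.1 (hz (-(2 * s)) ⟨by linarith, by linarith⟩)
  have z3 := abs_le.1 (hz (-(3 * s)) ⟨by linarith, by linarith⟩)
  have z0 := abs_le.1 (happ x (by rw [mem_closedBall, dist_eq_norm]; linarith))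
  have e1 : 128 * a ^ 3 * S / r ^ 3 * s ^ 3 = ρ ^ 2 * S / 2 := by
    simp only [s]
    rw [mul_pow, div_mul_eq_mul_div, div_eq_iff (by positivity)]
    linear_combination (ρ ^ 2 * S * r ^ 3) * hρa
  rw [e1] at td
  have td := abs_le.1 td
  rw [abs_le]
  constructor <;> linarith [td.1, td.2, z0.1, z0.2, z1.1, z1.2, z2.1, z2.2, z3.1, z3.2]

lemma Loc.mono {v : En n → ℝ} {R κ R' κ' : ℝ} (h : Loc Q v R κ) (hR : R' ≤ R) (hκ : κ ≤ κ') : Loc Q v R' κ' :=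
  ⟨h.cont.mono (ball_subset_ball hR), h.zero, fun x hx => h.sub x (ball_subset_ball hR hx),
   fun x hx => h.sup x (ball_subset_ball hR hx), fun x hx => h.one x (ball_subset_ball hR hx),
   fun x hx h0 c hc => h.kink x (ball_subset_ball hR hx) h0 c (hκ.trans_lt hc)⟩

lemma growth_base (lam Lam M s1 : ℝ) (hl : 0 < lam) (hL : lam ≤ Lam) (hs1 : 0 ≤ s1) :
    ∃ C0 : ℝ, 0 < C0 ∧ ∀ (Q : Matrix (Fin n) (Fin n) ℝ), Ell lam Lam Q →
      ∀ (v : En n → ℝ), (∀ r, 0 < r → r ≤ 1 → Loc Q v r (r * s1)) → (∀ x ∈ ball (0 : En n) 1, |v x| ≤ M) →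
      ∀ x ∈ ball (0 : En n) 1, |v x| ≤ C0 * ‖x‖ ^ 2 := by
  obtain ⟨ρ, hρ, hρ1, δ, hδ, H⟩ := growth_step (n := n) lam Lam hl hL
  set K := max M ((1 + s1) / δ)
  have hK : (1 + s1) / δ ≤ K := le_max_right _ _
  have hK0 : 0 < K := lt_of_lt_of_le (by positivity) hK
  rw [div_le_iff₀ hδ] at hK
  refine ⟨K / ρ ^ 2, by positivity, fun Q hQ v hv hM x hx => ?_⟩
  have ind : ∀ k : ℕ, ∀ x ∈ ball (0 : En n) (ρ ^ k), |v x| ≤ K * (ρ ^ k) ^ 2 := by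
    intro k
    induction k with
    | zero =>
      intro x hx
      rw [pow_zero] at hx ⊢
      rw [one_pow, mul_one]
      exact (hM x hx).trans (le_max_left _ _)
    | succ k ih =>
      intro x hx
      have hk1 : ρ ^ k ≤ 1 := pow_le_one₀ hρ.le (by linarith)
      have hk0 : 0 < ρ ^ k := by positivity
      have := H Q hQ v (ρ ^ k) (ρ ^ k * s1) (hv _ hk0 hk1) (by positivity) 0 (by simp) (ρ ^ k) (K * (ρ ^ k) ^ 2) hk0
        (by simp) ih (by nlinarith [sq_pos_of_pos hk0]) (by nlinarith [sq_pos_of_pos hk0]) x (by rw [← pow_succ']; exact hx)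
      calc _ ≤ _ := this
        _ = _ := by ring
  rw [mem_ball, dist_zero_right] at hx
  rcases eq_or_ne x 0 with rfl | hx0
  · rw [(hv 1 one_pos le_rfl).zero 0 (by simp)]; simp
  have hxp : 0 < ‖x‖ := norm_pos_iff.2 hx0
  obtain ⟨k, h1, h2⟩ := exists_nat_pow_near_of_lt_one hxp hx.le hρ (by linarith)
  rcases h2.eq_or_lt with h2 | h2
  · cases k with
    | zero => simp at h2; linarith
    | succ k =>
      have h4 := ind k x (by
        rw [mem_ball, dist_zero_right, h2]
        exact pow_lt_pow_right_of_lt_one₀ hρ (by linarith) (by omega))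
      calc _ ≤ _ := h4
        _ = K / ρ ^ 2 * ‖x‖ ^ 2 := by
          rw [h2, div_mul_eq_mul_div, eq_div_iff (by positivity)]; ring
  · have h4 := ind k x (by rw [mem_ball, dist_zero_right]; exact h2)
    refine h4.trans ?_
    rw [div_mul_eq_mul_div, le_div_iff₀ (by positivity)]
    calc K * (ρ ^ k) ^ 2 * ρ ^ 2 = K * (ρ ^ (k + 1)) ^ 2 := by ring
      _ ≤ _ := by gcongr

lemma growth_pi (lam Lam C0 : ℝ) (hl : 0 < lam) (hL : lam ≤ Lam) :
    ∃ C1 : ℝ, 1 ≤ C1 ∧ ∀ (Q : Matrix (Fin n) (Fin n) ℝ), Ell lam Lam Q →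
      ∀ (v : En n → ℝ) (R κ : ℝ), 0 < R → 0 < κ → κ < R / 4 → Loc Q v R κ → (∀ x ∈ ball (0 : En n) R, |v x| ≤ C0 * ‖x‖ ^ 2) →
      ∀ x ∈ ball (0 : En n) (R / 4), |v x| ≤ C1 * ((x 0) ^ 2 + κ ^ 2) := by
  obtain ⟨ρ, hρ, hρ1, δ, hδ, H⟩ := growth_step (n := n) lam Lam hl hL
  set K := max (max 1 (4 * C0)) (1 / δ)
  have hK1 : 1 ≤ K := (le_max_left _ _).trans (le_max_left _ _)
  have hK : 1 / δ ≤ K := le_max_right _ _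
  have hKC : 4 * C0 ≤ K := (le_max_right _ _).trans (le_max_left _ _)
  rw [div_le_iff₀ hδ] at hK
  have hρ2 : ρ ^ 2 ≤ 1 := pow_le_one₀ hρ.le (by linarith)
  refine ⟨4 * K / ρ ^ 2, by rw [le_div_iff₀ (by positivity)]; linarith, fun Q hQ v R κ hR hκ hκR hv hM x hx => ?_⟩
  rw [mem_ball, dist_zero_right] at hx
  have hKp : 0 < K := by linarith
  rcases le_or_gt (x 0) 0 with hx0 | hx0
  · rw [hv.zero x hx0, abs_zero]; positivity
  set y : En n := x + (-(x 0)) • e1 n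
  have hy0 : y 0 = 0 := by simp only [y]; rw [add_e1_zero]; ring
  have hxy : ‖x - y‖ = x 0 := by
    simp [y, norm_smul, norm_e1, abs_of_pos hx0]
  have hxR : x 0 < R / 4 := (le_abs_self _).trans_lt ((abs_coord x 0).trans_lt hx)
  have hyR : ‖y‖ ≤ R / 2 := by
    calc ‖y‖ = ‖x - (x - y)‖ := by congr 1; abel
      _ ≤ ‖x‖ + ‖x - y‖ := norm_sub_le _ _
      _ ≤ _ := by rw [hxy]; linarith
  have ind : ∀ k : ℕ, κ ≤ ρ ^ k * (R / 2) → ∀ x ∈ ball y (ρ ^ k * (R / 2)), |v x| ≤ K * (ρ ^ k * (R / 2)) ^ 2 := by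
    intro k
    induction k with
    | zero =>
      intro _ x hx
      rw [pow_zero, one_mul] at hx ⊢
      have hxR := in_ball hx (R := R) (by linarith)
      refine (hM x hxR).trans ?_
      rw [mem_ball, dist_zero_right] at hxR
      rcases le_or_gt C0 0 with hC | hC
      · have : C0 * ‖x‖ ^ 2 ≤ 0 := mul_nonpos_of_nonpos_of_nonneg hC (by positivity)
        have : 0 ≤ K * (R / 2) ^ 2 := by positivity
        linarith
      · calc C0 * ‖x‖ ^ 2 ≤ C0 * R ^ 2 := by gcongr
          _ = 4 * C0 * (R / 2) ^ 2 := by ring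
          _ ≤ _ := by gcongr
    | succ k ih =>
      intro hk x hx
      have hk0 : 0 < ρ ^ k * (R / 2) := by positivity
      have hk1 : ρ ^ k * (R / 2) ≤ R / 2 := mul_le_of_le_one_left (by linarith) (pow_le_one₀ hρ.le (by linarith))
      have hk' : κ ≤ ρ ^ k * (R / 2) := hk.trans (by
        rw [pow_succ]; gcongr; exact mul_le_of_le_one_right (by positivity) (by linarith))
      have := H Q hQ v R κ hv hκ.le y hy0 (ρ ^ k * (R / 2)) (K * (ρ ^ k * (R / 2)) ^ 2) hk0
        (by linarith) (ih hk') (by nlinarith [sq_pos_of_pos hk0]) (by nlinarith [sq_pos_of_pos hk0]) x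
        (by rw [← mul_assoc, ← pow_succ']; exact hx)
      calc _ ≤ _ := this
        _ = _ := by ring
  set d := max (x 0) κ
  have hd : 0 < d := lt_max_of_lt_left hx0
  have hdR : d < R / 4 := max_lt hxR hκR
  obtain ⟨k, h1, h2⟩ := exists_nat_pow_near_of_lt_one (x := 2 * d / (R / 2)) (y := ρ) (by positivity)
    (by rw [div_le_one (by positivity)]; linarith) hρ (by linarith)
  rw [lt_div_iff₀ (by positivity)] at h1
  rw [div_le_iff₀ (by positivity)] at h2
  have h3 := ind k (by have := le_max_right (x 0) κ; linarith) x (by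
    rw [mem_ball, dist_eq_norm, hxy]; have := le_max_left (x 0) κ; linarith)
  have hd2 : d ^ 2 ≤ x 0 ^ 2 + κ ^ 2 := by
    rcases max_cases (x 0) κ with ⟨h, _⟩ | ⟨h, _⟩ <;> simp only [d, h] <;> nlinarith
  refine h3.trans ?_
  rw [div_mul_eq_mul_div, le_div_iff₀ (by positivity)]
  have h5 : (ρ ^ (k + 1) * (R / 2)) ^ 2 ≤ (2 * d) ^ 2 := by gcongr
  calc K * (ρ ^ k * (R / 2)) ^ 2 * ρ ^ 2 = K * (ρ ^ (k + 1) * (R / 2)) ^ 2 := by ring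
    _ ≤ K * (2 * d) ^ 2 := by gcongr
    _ = 4 * K * d ^ 2 := by ring
    _ ≤ _ := by gcongr
end TC

namespace TC
open Topology Asymptotics MvPolynomial

variable {n : ℕ} [NeZero n] {Q : Matrix (Fin n) (Fin n) ℝ} {lam Lam : ℝ}

lemma sd_poly (hQ : Ell lam Lam Q) {y a : En n} {ρ m : ℝ} (hρ : 0 < ρ) {h : Po n}
    (hh : Lpoly Q h = 0) (hb : ∀ x ∈ closedBall y ρ, |ev h x| ≤ m) (ha : ‖a‖ ≤ ρ / 4) :
    |ev h (y + a) + ev h (y - a) - 2 * ev h y| ≤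
      4 * n ^ 2 * (5 * (Lam / lam)) ^ 2 * (m / ρ ^ 2) * ‖a‖ ^ 2 := by
  have hl := hQ.lam_pos
  have hL : 0 < Lam := hl.trans_le hQ.lam_le
  have hm : 0 ≤ m := (abs_nonneg _).trans (hb y (by simp [hρ.le]))
  have key : ∀ i : Fin n, ∀ t ∈ Icc (0 : ℝ) 1,
      |ev (pderiv i h) (y + t • a) - ev (pderiv i h) (y + t • (-a))| ≤
        4 * n * (5 * (Lam / lam)) ^ 2 * (m / ρ ^ 2) * ‖a‖ := by
    intro i t ht
    have hin : ∀ b : En n, ‖b‖ ≤ ρ / 4 → y + t • b ∈ closedBall y (ρ / 2 / 2) := by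
      intro b hb
      rw [mem_closedBall, dist_eq_norm, add_sub_cancel_left, norm_smul, Real.norm_eq_abs, abs_of_nonneg ht.1]
      have : t * ‖b‖ ≤ 1 * ‖b‖ := by gcongr; exact ht.2
      linarith
    have := harm_lip hQ (y := y) (ρ := ρ / 2) (h := pderiv i h) (by positivity)
      (by rw [Lpoly_pderiv, hh, map_zero]) (bernstein hQ hρ hh hb i)
      (hin (-a) (by rwa [norm_neg])) (hin a ha)
    refine this.trans ?_
    have e : y + t • a - (y + t • (-a)) = (2 * t) • a := by
      rw [smul_neg, two_mul, add_smul]; abel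
    rw [e, norm_smul, Real.norm_eq_abs, abs_of_nonneg (by linarith [ht.1])]
    calc (n : ℝ) * (5 * (Lam / lam) * (5 * (Lam / lam) * m / ρ) / (ρ / 2)) * (2 * t * ‖a‖)
        ≤ (n : ℝ) * (5 * (Lam / lam) * (5 * (Lam / lam) * m / ρ) / (ρ / 2)) * (2 * 1 * ‖a‖) := by
          gcongr; exact ht.2
      _ = _ := by field_simp; ring
  have := mv (g := fun t => ev h (y + t • a) + ev h (y + t • (-a))) (a := 0) (b := 1)
    (G := 4 * n ^ 2 * (5 * (Lam / lam)) ^ 2 * (m / ρ ^ 2) * ‖a‖ ^ 2) zero_le_one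
    (fun t _ => (hasDeriv_ev h y a t).add (hasDeriv_ev h y (-a) t)) (fun t ht => by
      have e : dotp (fun i => ev (pderiv i h) (y + t • a)) a + dotp (fun i => ev (pderiv i h) (y + t • -a)) (-a)
        = dotp (fun i => ev (pderiv i h) (y + t • a) - ev (pderiv i h) (y + t • -a)) a := by
        simp only [dotp, ← Finset.sum_add_distrib]
        exact Finset.sum_congr rfl fun i _ => by simp; ring
      rw [e]
      refine (dotp_bound _ _).trans ?_
      calc _ ≤ (∑ _i : Fin n, 4 * n * (5 * (Lam / lam)) ^ 2 * (m / ρ ^ 2) * ‖a‖) * ‖a‖ := by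
            gcongr with i _; exact key i t ht
        _ = _ := by simp; ring)
  simp only [one_smul, zero_smul, add_zero, sub_zero, mul_one] at this
  refine le_trans (le_of_eq ?_) this
  congr 1; rw [← sub_eq_add_neg]; ring

lemma sd_int (hQ : Ell lam Lam Q) {U : En n → ℝ} {y : En n} {r S : ℝ} (hr : 0 < r) (hS : 0 ≤ S)
    (hc : ContinuousOn U (closedBall y r)) (h1 : ∀ x ∈ ball y r, SubAt Q U (-1) x)
    (h2 : ∀ x ∈ ball y r, SubAt Q (fun z => - U z) (-1) x)
    (hb : ∀ x ∈ closedBall y r, |U x| ≤ S * r ^ 2) (k : ℕ) (a : En n) (ha : ‖a‖ ≤ r / 2 ^ k / 4) :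
    |U (y + a) + U (y - a) - 2 * U y| ≤
      (4 * n ^ 2 * (5 * (Lam / lam)) ^ 2 * (S + 8 / lam) + 4 / lam) * (k + 1) * (r / 2 ^ k) ^ 2 := by
  have hl := hQ.lam_pos
  have hL : 0 < Lam := hl.trans_le hQ.lam_le
  set D := 4 * (n : ℝ) ^ 2 * (5 * (Lam / lam)) ^ 2 with hD
  have hD0 : 0 ≤ D := by positivity
  have app : ∀ ρ, 0 < ρ → ρ ≤ r → ∃ h : Po n, Lpoly Q h = 0 ∧ ∀ x ∈ closedBall y ρ, |U x - ev h x| ≤ ρ ^ 2 / lam := by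
    intro ρ hρ hρr
    obtain ⟨h, hh, hx⟩ := approx_int hQ (U := U) (y := y) (ρ := ρ) (ε := ρ ^ 2 / (2 * lam)) hρ (by positivity)
      (hc.mono (closedBall_subset_closedBall hρr)) (fun x hx => h1 x (ball_subset_ball hρr hx))
      (fun x hx => h2 x (ball_subset_ball hρr hx))
    refine ⟨h, hh, fun x hxx => (hx x hxx).trans (le_of_eq ?_)⟩
    field_simp; norm_num
  have ind : ∀ k : ℕ, ∃ h : Po n, Lpoly Q h = 0 ∧ (∀ x ∈ closedBall y (r / 2 ^ k), |U x - ev h x| ≤ (r / 2 ^ k) ^ 2 / lam) ∧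
      ∀ a : En n, ‖a‖ ≤ r / 2 ^ k / 4 →
        |ev h (y + a) + ev h (y - a) - 2 * ev h y| ≤ D * (S + 8 / lam) * (k + 1) * ‖a‖ ^ 2 := by
    intro k
    induction k with
    | zero =>
      obtain ⟨h, hh, hx⟩ := app r hr le_rfl
      refine ⟨h, hh, by simpa using hx, fun a ha => ?_⟩
      have := sd_poly hQ (y := y) (a := a) (m := (S + 1 / lam) * r ^ 2) hr hh (fun x hxx => by
        have := hx x hxx; have h3 := hb x hxx
        have h4 := abs_sub_abs_le_abs_sub (ev h x) (U x)
        rw [abs_sub_comm] at h4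
        calc |ev h x| ≤ S * r ^ 2 + r ^ 2 / lam := by linarith
          _ = _ := by ring) (by simpa using ha)
      refine this.trans ?_
      rw [mul_div_cancel_right₀ _ (by positivity)]
      have : 1 / lam ≤ 8 / lam := by gcongr; norm_num
      simp only [Nat.cast_zero, zero_add, mul_one]
      gcongr
    | succ k ih =>
      obtain ⟨h, hh, hx, hsd⟩ := ih
      have hrk : r / 2 ^ (k + 1) = r / 2 ^ k / 2 := by rw [pow_succ]; field_simp
      have hk0 : 0 < r / 2 ^ k := by positivity
      set ρ := r / 2 ^ k with hρ
      have hρr : ρ ≤ r := div_le_self hr.le (one_le_pow₀ (by norm_num))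
      rw [hrk]
      obtain ⟨h', hh', hx'⟩ := app (ρ / 2) (by positivity) (by linarith)
      refine ⟨h', hh', hx', fun a ha => ?_⟩
      have b1 := hsd a (by linarith)
      have b2 := sd_poly hQ (y := y) (a := a) (ρ := ρ / 2) (h := h' - h) (m := 8 / lam * (ρ / 2) ^ 2) (by positivity)
        (by rw [Lpoly_sub, hh, hh', sub_zero]) (fun x hxx => by
          have c1 := abs_le.1 (hx' x hxx)
          have c2 := abs_le.1 (hx x (closedBall_subset_closedBall (by linarith) hxx))
          have e1 : (ρ / 2) ^ 2 / lam = ρ ^ 2 / lam / 4 := by ring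
          have e2 : 8 / lam * (ρ / 2) ^ 2 = 2 * (ρ ^ 2 / lam) := by ring
          have e3 : 0 < ρ ^ 2 / lam := by positivity
          rw [ev_sub, e2, abs_le]
          rw [e1] at c1
          constructor <;> linarith [c1.1, c1.2, c2.1, c2.2]) (by linarith)
      rw [mul_div_cancel_right₀ _ (by positivity)] at b2
      simp only [ev_sub] at b2
      have b1' := abs_le.1 b1
      have b2' := abs_le.1 b2
      have : D * (8 / lam) * ‖a‖ ^ 2 ≤ D * (S + 8 / lam) * ‖a‖ ^ 2 := by gcongr; linarith
      push_cast
      rw [abs_le]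
      constructor <;> nlinarith [b1'.1, b1'.2, b2'.1, b2'.2]
  obtain ⟨h, hh, hx, hsd⟩ := ind k
  set ρ := r / 2 ^ k with hρ
  have hk0 : 0 < ρ := by positivity
  have s1 := abs_le.1 (hsd a ha)
  have m1 := abs_le.1 (hx (y + a) (by rw [mem_closedBall, dist_eq_norm, add_sub_cancel_left]; linarith))
  have m2 := abs_le.1 (hx (y - a) (by
    rw [mem_closedBall, dist_eq_norm, sub_sub_cancel_left, norm_neg]; linarith))
  have m3 := abs_le.1 (hx y (by simp [hk0.le]))
  have e1 : ‖a‖ ^ 2 ≤ ρ ^ 2 := by gcongr; linarith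
  have e2 : D * (S + 8 / lam) * (k + 1) * ‖a‖ ^ 2 ≤ D * (S + 8 / lam) * (k + 1) * ρ ^ 2 := by gcongr
  have e3 : 4 * (ρ ^ 2 / lam) ≤ 4 / lam * (k + 1) * ρ ^ 2 := by
    have : 0 ≤ ρ ^ 2 / lam * k := by positivity
    calc 4 * (ρ ^ 2 / lam) ≤ 4 * (ρ ^ 2 / lam) + 4 * (ρ ^ 2 / lam * k) := by linarith
      _ = _ := by ring
  have e4 : (D * (S + 8 / lam) + 4 / lam) * (k + 1) * ρ ^ 2 = D * (S + 8 / lam) * (k + 1) * ρ ^ 2 + 4 / lam * (k + 1) * ρ ^ 2 := by ring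
  rw [e4, abs_le]
  constructor <;> linarith [s1.1, s1.2, m1.1, m1.2, m2.1, m2.2, m3.1, m3.2]

lemma strip (hQ : Ell lam Lam Q) {w : En n → ℝ} {W t A S : ℝ} (hW : 0 < W) (hS : 0 ≤ S)
    {U : Set (En n)} (hU : IsOpen U)
    (hc : ContinuousOn w {x | ‖x‖ ≤ W ∧ 0 ≤ x 0 ∧ x 0 ≤ t}) (hUK : U ⊆ {x | ‖x‖ ≤ W ∧ 0 ≤ x 0 ∧ x 0 ≤ t})
    (hs : ∀ x ∈ U, SubAt Q w 0 x)
    (hb : ∀ x ∉ U, ‖x‖ ≤ W → 0 ≤ x 0 → x 0 ≤ t → w x ≤ A ∨ (‖x‖ = W ∧ w x ≤ A + S)) :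
    ∀ x : En n, ‖x‖ ≤ W → 0 ≤ x 0 → x 0 ≤ t →
      w x ≤ A + S / W ^ 2 * (‖x‖ ^ 2 + Lam / lam * (x 0 * (t - x 0))) := by
  have hl := hQ.lam_pos
  have hL : 0 < Lam := hl.trans_le hQ.lam_le
  have hK : IsCompact {x : En n | ‖x‖ ≤ W ∧ 0 ≤ x 0 ∧ x 0 ≤ t} := by
    have e : {x : En n | ‖x‖ ≤ W ∧ 0 ≤ x 0 ∧ x 0 ≤ t} = closedBall (0 : En n) W ∩ ({x | 0 ≤ x 0} ∩ {x | x 0 ≤ t}) := by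
      ext x; simp
    rw [e]
    exact (isCompact_closedBall _ _).inter_right ((isClosed_le continuous_const (cont_coord 0)).inter
      (isClosed_le (cont_coord 0) continuous_const))
  set c := S / W ^ 2 with hcd
  have hc0 : 0 ≤ c := by positivity
  have hQ11 : lam ≤ Q 0 0 := by
    have := hQ.lower (e1 n)
    rw [norm_e1] at this
    have e : qf Q (e1 n) = Q 0 0 := by simp [qf, e1, Pi.single_apply]
    rw [e] at this; linarith
  have key := MP hQ (u := fun x => w x + (-c) * (‖x - 0‖ ^ 2 + (Lam / lam * t) * x 0 + (-(Lam / lam)) * x 0 ^ 2))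
    (m := A) hU hK hUK (hc.add (Continuous.continuousOn (by fun_prop))) (fun x hx => by
      have := (hs x hx).add_T2 hQ ((((LAt_dist (0 : En n) x).add ((LAt_coord (0 : Fin n) x).const_mul (Lam / lam * t))).add
        ((LAt_coord_sq (0 : Fin n) x).const_mul (-(Lam / lam)))).const_mul (-c))
      refine this.mono ?_
      have h1 : Lam ≤ Lam / lam * Q 0 0 := by
        rw [div_mul_eq_mul_div, le_div_iff₀ hl]; gcongr
      have h2 := hQ.tr_hi
      nlinarith) (fun x hx hxU => by
      obtain ⟨g1, g2, g3⟩ := hx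
      have hp : 0 ≤ Lam / lam * (x 0 * (t - x 0)) := by
        have : 0 ≤ t - x 0 := by linarith
        positivity
      have e : ‖x - 0‖ ^ 2 + (Lam / lam * t) * x 0 + (-(Lam / lam)) * x 0 ^ 2 = ‖x‖ ^ 2 + Lam / lam * (x 0 * (t - x 0)) := by
        rw [sub_zero]; ring
      beta_reduce
      rw [e]
      rcases hb x hxU g1 g2 g3 with h | ⟨h3, h⟩
      · have : 0 ≤ c * (‖x‖ ^ 2 + Lam / lam * (x 0 * (t - x 0))) := by positivity
        linarith
      · have : c * ‖x‖ ^ 2 = S := by rw [h3, hcd]; field_simp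
        have : 0 ≤ c * (Lam / lam * (x 0 * (t - x 0))) := by positivity
        linarith)
  intro x g1 g2 g3
  have := key x ⟨g1, g2, g3⟩
  have e : ‖x - 0‖ ^ 2 + (Lam / lam * t) * x 0 + (-(Lam / lam)) * x 0 ^ 2 = ‖x‖ ^ 2 + Lam / lam * (x 0 * (t - x 0)) := by
    rw [sub_zero]; ring
  rw [e] at this
  linarith
end TC

namespace TC
open Topology Asymptotics MvPolynomial

variable {n : ℕ} [NeZero n] {Q : Matrix (Fin n) (Fin n) ℝ} {lam Lam : ℝ}

lemma SubAt.add_open (hQ : Ell lam Lam Q) {u v : En n → ℝ} {a b : ℝ} {U : Set (En n)} (hU : IsOpen U)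
    (hu : ContinuousOn u U) (hv : ContinuousOn v U)
    (su : ∀ x ∈ U, SubAt Q u a x) (sv : ∀ x ∈ U, SubAt Q v b x) :
    ∀ x ∈ U, SubAt Q (fun x => u x + v x) (a + b) x := by
  intro x hx
  obtain ⟨r, hr, hrU⟩ := Metric.isOpen_iff.1 hU x hx
  exact SubAt.add hQ hr (hu.mono hrU) (hv.mono hrU) (fun z hz => su z (hrU hz)) (fun z hz => sv z (hrU hz))

def C3 (n : ℕ) (lam Lam C1 : ℝ) : ℝ :=
  260 * C1 + 64 * (4 * n ^ 2 * (5 * (Lam / lam)) ^ 2 * (10 * C1 + 8 / lam) + 4 / lam)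

lemma D2_bound (hQ : Ell lam Lam Q) {v : En n → ℝ} {R κ C1 H : ℝ} (hC1 : 0 ≤ C1) (hH : 0 < H) (hκ : 0 ≤ κ) (hκH : κ ≤ H)
    {N : ℕ} (hR : R = 8 * H * 2 ^ N) (hv : Loc Q v (4 * R) κ)
    (hg : ∀ x ∈ ball (0 : En n) (4 * R), |v x| ≤ C1 * ((x 0) ^ 2 + κ ^ 2)) {a : En n} (ha0 : a 0 = 0) (ha : ‖a‖ ≤ H)
    {x : En n} (hx : ‖x‖ ≤ R) (hx0 : 0 ≤ x 0) :
    |v (x + a) + v (x - a) - 2 * v x| ≤ C3 n lam Lam C1 * (N + 1) * H ^ 2 := by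
  have hl := hQ.lam_pos
  have hL : 0 < Lam := hl.trans_le hQ.lam_le
  have h2N : (1 : ℝ) ≤ 2 ^ N := one_le_pow₀ (by norm_num)
  have hRH : 8 * H ≤ R := by rw [hR]; nlinarith
  have e0 : 0 ≤ 4 * (n : ℝ) ^ 2 * (5 * (Lam / lam)) ^ 2 * (10 * C1 + 8 / lam) + 4 / lam := by positivity
  set E := 4 * (n : ℝ) ^ 2 * (5 * (Lam / lam)) ^ 2 * (10 * C1 + 8 / lam) + 4 / lam with hE
  have hNn : (0 : ℝ) ≤ N := Nat.cast_nonneg N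
  rcases lt_or_ge (x 0) (8 * H) with h8 | h8
  · have k : ∀ z : En n, z 0 = x 0 → ‖z‖ ≤ ‖x‖ + ‖a‖ → |v z| ≤ C1 * (65 * H ^ 2) := by
      intro z hz hzn
      refine (hg z (by rw [mem_ball, dist_zero_right]; linarith)).trans ?_
      gcongr
      rw [hz]; nlinarith
    have k1 := abs_le.1 (k (x + a) (by simp [ha0]) (norm_add_le _ _))
    have k2 := abs_le.1 (k (x - a) (by simp [ha0]) (norm_sub_le _ _))
    have k3 := abs_le.1 (k x rfl (by linarith [norm_nonneg a]))
    have : 4 * (C1 * (65 * H ^ 2)) ≤ C3 n lam Lam C1 * (N + 1) * H ^ 2 := by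
      have q1 : 260 * C1 ≤ C3 n lam Lam C1 := by rw [C3, ← hE]; linarith
      calc 4 * (C1 * (65 * H ^ 2)) = 260 * C1 * 1 * H ^ 2 := by ring
        _ ≤ _ := by gcongr <;> linarith
    rw [abs_le]; constructor <;> linarith [k1.1, k1.2, k2.1, k2.2, k3.1, k3.2]
  · set r := x 0 / 2 with hr
    have hxR : x 0 ≤ R := (le_abs_self _).trans ((abs_coord x 0).trans hx)
    have hr4 : 4 * H ≤ r := by linarith
    have hr0 : 0 < r := by linarith
    obtain ⟨k, hk1, hk2⟩ := exists_nat_pow_near (x := r / (4 * H)) (y := 2) (by rw [le_div_iff₀ (by positivity)]; linarith) (by norm_num)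
    rw [le_div_iff₀ (by positivity)] at hk1
    rw [div_lt_iff₀ (by positivity)] at hk2
    have hkN : k ≤ N := by
      by_contra! h
      have : (2 : ℝ) ^ (N + 1) ≤ 2 ^ k := pow_le_pow_right₀ (by norm_num) h
      rw [pow_succ] at this
      nlinarith
    have hin : ∀ z ∈ closedBall x r, z ∈ ball (0 : En n) (4 * R) ∧ 0 < z 0 ∧ z 0 ≤ 3 * r := by
      intro z hz
      rw [mem_closedBall, dist_eq_norm] at hz
      have h1 := abs_le.1 ((abs_coord (z - x) 0).trans hz)
      simp only [PiLp.sub_apply] at h1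
      refine ⟨?_, by linarith [h1.1], by linarith [h1.2]⟩
      rw [mem_ball, dist_zero_right]
      calc ‖z‖ = ‖x + (z - x)‖ := by congr 1; abel
        _ ≤ ‖x‖ + ‖z - x‖ := norm_add_le _ _
        _ < _ := by linarith
    have := sd_int hQ (U := v) (y := x) (r := r) (S := 10 * C1) hr0 (by positivity)
      (hv.cont.mono fun z hz => (hin z hz).1)
      (fun z hz => by
        have := hin z (ball_subset_closedBall hz); exact (hv.sub z this.1 this.2.1).mono (by norm_num))
      (fun z hz => by
        have := hin z (ball_subset_closedBall hz); exact (hv.sup z this.1 this.2.1))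
      (fun z hz => by
        have h3 := hin z hz
        refine (hg z h3.1).trans ?_
        have : z 0 ^ 2 ≤ (3 * r) ^ 2 := by gcongr; exacts [h3.2.1.le, h3.2.2]
        have h4 : κ ^ 2 ≤ r ^ 2 := by gcongr; linarith
        nlinarith) k a (by
        rw [div_div, le_div_iff₀ (by positivity)]
        calc ‖a‖ * (2 ^ k * 4) ≤ H * (2 ^ k * 4) := by gcongr
          _ = 2 ^ k * (4 * H) := by ring
          _ ≤ r := hk1)
    refine this.trans ?_
    rw [← hE]
    have hrk : r / 2 ^ k ≤ 8 * H := by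
      rw [div_le_iff₀ (by positivity)]; rw [pow_succ] at hk2; linarith
    have hkN' : (k : ℝ) ≤ N := by exact_mod_cast hkN
    calc E * (k + 1) * (r / 2 ^ k) ^ 2 ≤ E * (N + 1) * (8 * H) ^ 2 := by gcongr
      _ = 64 * E * (N + 1) * H ^ 2 := by ring
      _ ≤ _ := by gcongr; rw [C3, ← hE]; linarith

lemma D2_lower (hQ : Ell lam Lam Q) {v : En n → ℝ} {R κ C1 H η : ℝ} (hC1 : 0 ≤ C1) (hH : 0 < H) (hκ : 0 ≤ κ) (hκH : κ ≤ H)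
    {N : ℕ} (hR : R = 8 * H * 2 ^ N) (hv : Loc Q v (4 * R) κ)
    (hg : ∀ x ∈ ball (0 : En n) (4 * R), |v x| ≤ C1 * ((x 0) ^ 2 + κ ^ 2)) (hη : 0 ≤ η)
    (hlow : ∀ x ∈ ball (0 : En n) (2 * R), -η ≤ v x) {a : En n} (ha0 : a 0 = 0) (ha : ‖a‖ ≤ H)
    {x : En n} (hx : ‖x‖ ≤ R) (hx0 : 0 ≤ x 0) :
    -(2 * η + C3 n lam Lam C1 * (N + 1) * H ^ 2 * (1 + Lam / lam) * ‖x‖ / R) ≤ v (x + a) + v (x - a) - 2 * v x := by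
  have hl := hQ.lam_pos
  have hL : 0 < Lam := hl.trans_le hQ.lam_le
  have h2N : (1 : ℝ) ≤ 2 ^ N := one_le_pow₀ (by norm_num)
  have hRH : 8 * H ≤ R := by rw [hR]; nlinarith
  have hR0 : 0 < R := by linarith
  have hC3 : 0 ≤ C3 n lam Lam C1 := by unfold C3; positivity
  set S := C3 n lam Lam C1 * (N + 1) * H ^ 2 with hS
  have hS0 : 0 ≤ S := by positivity
  have hin : ∀ z : En n, ‖z‖ ≤ R → ∀ b : En n, ‖b‖ ≤ H → z + b ∈ ball (0 : En n) (2 * R) := by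
    intro z hz b hb
    rw [mem_ball, dist_zero_right]
    have := norm_add_le z b; linarith
  have h24 : ball (0 : En n) (2 * R) ⊆ ball 0 (4 * R) := ball_subset_ball (by linarith)
  have hna : ‖-a‖ ≤ H := by rwa [norm_neg]
  have hcv : ContinuousOn v {x : En n | ‖x‖ ≤ R} := hv.cont.mono fun z hz => by
    simpa using h24 (hin z hz 0 (by simp [hH.le]))
  have hct : ∀ b : En n, ‖b‖ ≤ H → ContinuousOn (fun z => - v (z + b)) {x : En n | ‖x‖ ≤ R} := fun b hb =>
    (hv.cont.comp (f := fun z => z + b) (Continuous.continuousOn (by fun_prop)) fun z hz => h24 (hin z hz b hb)).neg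
  set U : Set (En n) := (ball 0 R ∩ {x | v x ≠ 0}) ∩ {x | 0 < x 0} with hUd
  have hU : IsOpen U := by
    refine IsOpen.inter ?_ (isOpen_lt continuous_const (cont_coord 0))
    exact (hv.cont.mono (ball_subset_ball (by linarith))).isOpen_inter_preimage isOpen_ball isOpen_ne
  have hUR : U ⊆ {x : En n | ‖x‖ ≤ R} := fun z hz => by
    have := hz.1.1; rw [mem_ball, dist_zero_right] at this; exact this.le
  have hz4 : ∀ z ∈ U, z ∈ ball (0 : En n) (4 * R) := fun z hz => by
    simpa using h24 (hin z (hUR hz) 0 (by simp [hH.le]))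
  have sv : ∀ z ∈ U, SubAt Q v 1 z := fun z hz => hv.one z (hz4 z hz) hz.2 hz.1.2
  have st : ∀ b : En n, b 0 = 0 → ‖b‖ ≤ H → ∀ z ∈ U, SubAt Q (fun z => - v (z + b)) (-1) z := fun b hb0 hb z hz =>
    (hv.sup (z + b) (h24 (hin z (hUR hz) b hb)) (by
      have : 0 < z 0 := hz.2
      simpa [hb0] using this)).translate
  have sw := SubAt.add_open hQ hU ((hcv.mono hUR).add (hcv.mono hUR)) (((hct a ha).mono hUR).add ((hct (-a) hna).mono hUR))
    (SubAt.add_open hQ hU (hcv.mono hUR) (hcv.mono hUR) sv sv)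
    (SubAt.add_open hQ hU ((hct a ha).mono hUR) ((hct (-a) hna).mono hUR) (st a ha0 ha) (st (-a) (by simp [ha0]) hna))
  have key := strip hQ (w := fun z => (v z + v z) + (- v (z + a) + - v (z + -a))) (W := R) (t := R) (A := 2 * η) (S := S)
    hR0 hS0 hU (((hcv.add hcv).add ((hct a ha).add (hct (-a) hna))).mono fun z hz => hz.1)
    (fun z hz => ⟨hUR hz, le_of_lt hz.2, (le_abs_self _).trans ((abs_coord z 0).trans (hUR hz))⟩)
    (fun z hz => (sw z hz).mono (by norm_num))
    (fun z hz z1 z2 z3 => by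
      rcases eq_or_lt_of_le z1 with h | h
      · right
        refine ⟨h, ?_⟩
        have := (abs_le.1 (D2_bound hQ hC1 hH hκ hκH hR hv hg ha0 ha z1 z2)).1
        rw [← sub_eq_add_neg z a]; linarith
      · left
        have h0 : v z = 0 := by
          rcases eq_or_lt_of_le z2 with h' | h'
          · exact hv.zero z h'.ge
          · by_contra hne
            exact hz ⟨⟨by simpa using h, hne⟩, h'⟩
        have q1 := hlow _ (hin z z1 a ha)
        have q2 := hlow _ (hin z z1 (-a) hna)
        rw [h0]; linarith) x hx hx0 ((le_abs_self _).trans ((abs_coord x 0).trans hx))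
  rw [← sub_eq_add_neg x a] at key
  have hb : S / R ^ 2 * (‖x‖ ^ 2 + Lam / lam * (x 0 * (R - x 0))) ≤ S * (1 + Lam / lam) * ‖x‖ / R := by
    have q1 : x 0 * (R - x 0) ≤ ‖x‖ * R := by
      have := (le_abs_self _).trans (abs_coord x 0)
      nlinarith
    have q2 : ‖x‖ ^ 2 ≤ ‖x‖ * R := by nlinarith [norm_nonneg x]
    calc _ ≤ S / R ^ 2 * (‖x‖ * R + Lam / lam * (‖x‖ * R)) := by gcongr
      _ = _ := by field_simp
  linarith

lemma conv_seq {g : ℕ → ℝ} {m : ℕ} {e B : ℝ} (hm : 1 ≤ m) (he : 0 ≤ e) (hB : ∀ k ≤ m, |g k| ≤ B)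
    (h2 : ∀ k, k + 2 ≤ m → -e ≤ g (k + 2) + g k - 2 * g (k + 1)) : g 1 - g 0 ≤ 2 * B / m + m * e := by
  have s1 : ∀ k, k + 1 ≤ m → g 1 - g 0 - m * e ≤ g (k + 1) - g k := by
    have : ∀ k : ℕ, k + 1 ≤ m → g 1 - g 0 - k * e ≤ g (k + 1) - g k := by
      intro k
      induction k with
      | zero => intro _; simp
      | succ k ih =>
        intro hk
        have := ih (by omega); have := h2 k (by omega)
        push_cast; linarith
    intro k hk
    have h3 := this k hk
    have : (k : ℝ) ≤ m := by exact_mod_cast (by omega : k ≤ m)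
    nlinarith
  have s2 : ∀ k : ℕ, k ≤ m → k * (g 1 - g 0 - m * e) ≤ g k - g 0 := by
    intro k
    induction k with
    | zero => intro _; simp
    | succ k ih =>
      intro hk
      have := ih (by omega); have := s1 k hk
      push_cast; linarith
  have h3 := s2 m le_rfl
  have h4 := abs_le.1 (hB m le_rfl)
  have h5 := abs_le.1 (hB 0 (by omega))
  have hm0 : (0 : ℝ) < m := by exact_mod_cast hm
  have : g 1 - g 0 - m * e ≤ 2 * B / m := by
    rw [le_div_iff₀ hm0]; linarith [h4.2, h5.1]
  linarith

lemma tang (lam Lam C1 H δ : ℝ) (hl : 0 < lam) (hL : lam ≤ Lam) (hC1 : 0 < C1) (hH : 1 ≤ H) (hδ : 0 < δ) :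
    ∃ R η : ℝ, 8 * H ≤ R ∧ 0 < η ∧ ∀ (Q : Matrix (Fin n) (Fin n) ℝ), Ell lam Lam Q →
      ∀ (v : En n → ℝ) (κ : ℝ), 0 ≤ κ → κ ≤ 1 → Loc Q v (4 * R) κ →
      (∀ x ∈ ball (0 : En n) (4 * R), |v x| ≤ C1 * ((x 0) ^ 2 + κ ^ 2)) →
      (∀ x ∈ ball (0 : En n) (2 * R), -η ≤ v x) →
      ∀ x a : En n, a 0 = 0 → ‖a‖ ≤ H → 0 ≤ x 0 → x 0 ≤ 1 → ‖x‖ ≤ H → v (x + a) ≤ v x + δ := by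
  obtain ⟨m, hm⟩ := exists_nat_gt (8 * C1 / δ)
  have hm0 : (0 : ℝ) < m := lt_trans (by positivity) hm
  have hL0 : 0 < Lam := by linarith
  have hm1 : 1 ≤ m := by exact_mod_cast hm0
  have hC3 : 0 ≤ C3 n lam Lam C1 := by unfold C3; positivity
  set T := C3 n lam Lam C1 * H ^ 2 * (1 + Lam / lam) * (m + 1) with hT
  have hT0 : 0 ≤ T := by positivity
  have lim : Tendsto (fun N : ℕ => ((N : ℝ) + 1) / 2 ^ N) atTop (𝓝 0) := by
    have h1 : Tendsto (fun N : ℕ => (N : ℝ) ^ 1 / 2 ^ N) atTop (𝓝 0) :=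
      tendsto_pow_const_div_const_pow_of_one_lt 1 (by norm_num)
    have h0 : Tendsto (fun N : ℕ => (N : ℝ) ^ 0 / 2 ^ N) atTop (𝓝 0) :=
      tendsto_pow_const_div_const_pow_of_one_lt 0 (by norm_num)
    have := h1.add h0
    simp only [pow_one, pow_zero, add_zero] at this
    refine this.congr fun N => ?_
    ring
  have hev := lim.eventually (gt_mem_nhds (show (0 : ℝ) < δ / (4 * m * (T + 1)) by positivity))
  have hev2 := (tendsto_pow_atTop_atTop_of_one_lt (r := (2 : ℝ)) (by norm_num)).eventually_ge_atTop ((m : ℝ) + 1)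
  obtain ⟨N, hN1, hN2⟩ := (hev.and hev2).exists
  rw [lt_div_iff₀ (by positivity)] at hN1
  have h2N : (1 : ℝ) ≤ 2 ^ N := one_le_pow₀ (by norm_num)
  refine ⟨8 * H * 2 ^ N, δ / (8 * m), by nlinarith, by positivity, ?_⟩
  intro Q hQ v κ hκ hκ1 hv hg hlow x a ha0 ha hx0 hx1 hx
  have hkn : ∀ k : ℕ, k ≤ m → ‖x + (k : ℝ) • a‖ ≤ H * (m + 1) := by
    intro k hk
    have : (k : ℝ) ≤ m := by exact_mod_cast hk
    calc _ ≤ ‖x‖ + ‖(k : ℝ) • a‖ := norm_add_le _ _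
      _ = ‖x‖ + k * ‖a‖ := by rw [norm_smul]; simp
      _ ≤ H + m * H := by gcongr
      _ = _ := by ring
  have hRm : H * (m + 1) ≤ 8 * H * 2 ^ N := by nlinarith
  have hk0 : ∀ k : ℕ, (x + (k : ℝ) • a) 0 = x 0 := by intro k; simp [ha0]
  set R := 8 * H * 2 ^ N with hR
  have hRp : 0 < R := by positivity
  have hC3' : 0 ≤ C3 n lam Lam C1 * (N + 1) * H ^ 2 * (1 + Lam / lam) := by positivity
  have := conv_seq (g := fun k => v (x + (k : ℝ) • a)) (m := m) (e := δ / (2 * m)) (B := 2 * C1) hm1 (by positivity)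
    (fun k hk => by
      refine (hg _ (by rw [mem_ball, dist_zero_right]; have := hkn k hk; linarith)).trans ?_
      rw [hk0]
      have : κ ^ 2 ≤ 1 := pow_le_one₀ hκ hκ1
      have : x 0 ^ 2 ≤ 1 := pow_le_one₀ hx0 hx1
      nlinarith) (fun k hk => by
      have := D2_lower hQ hC1.le (by linarith) hκ (by linarith) hR hv hg (by positivity) hlow ha0 ha
        (x := x + ((k + 1 : ℕ) : ℝ) • a) ((hkn _ (by omega)).trans hRm) (by rw [hk0]; exact hx0)
      have e1 : x + ((k + 1 : ℕ) : ℝ) • a + a = x + ((k + 2 : ℕ) : ℝ) • a := by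
        push_cast; module
      have e2 : x + ((k + 1 : ℕ) : ℝ) • a - a = x + ((k : ℕ) : ℝ) • a := by
        push_cast; module
      rw [e1, e2] at this
      refine le_trans (neg_le_neg ?_) this
      have q : C3 n lam Lam C1 * (N + 1) * H ^ 2 * (1 + Lam / lam) * ‖x + ((k + 1 : ℕ) : ℝ) • a‖ / R ≤ δ / (4 * m) := by
        calc _ ≤ C3 n lam Lam C1 * (N + 1) * H ^ 2 * (1 + Lam / lam) * (H * (m + 1)) / R := by
              gcongr; exact hkn _ (by omega)
          _ = T * ((N + 1) / 2 ^ N) / 8 := by rw [hT, hR]; field_simp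
          _ ≤ δ / (4 * m) := by
            rw [le_div_iff₀ (by positivity)]
            have : 0 ≤ (N + 1 : ℝ) / 2 ^ N * m * T := by positivity
            have : 0 ≤ (N + 1 : ℝ) / 2 ^ N * m := by positivity
            nlinarith
      have : 2 * (δ / (8 * m)) + δ / (4 * m) = δ / (2 * m) := by field_simp; norm_num
      linarith)
  simp only [Nat.cast_one, one_smul, Nat.cast_zero, zero_smul, add_zero] at this
  have q1 : 2 * (2 * C1) / m ≤ δ / 2 := by
    rw [div_lt_iff₀ hδ] at hm
    rw [div_le_iff₀ hm0]; linarith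
  have q2 : m * (δ / (2 * m)) = δ / 2 := by field_simp
  linarith
end TC

namespace TC
open Topology Asymptotics MvPolynomial

variable {n : ℕ} [NeZero n] {Q : Matrix (Fin n) (Fin n) ℝ} {lam Lam : ℝ}

lemma fin1 (lam Lam C1 ε : ℝ) (hl : 0 < lam) (hL : lam ≤ Lam) (hC1 : 0 < C1) (hε : 0 < ε) (hε1 : ε ≤ 1) :
    ∃ R η : ℝ, 1 ≤ R ∧ 0 < η ∧ ∀ (Q : Matrix (Fin n) (Fin n) ℝ), Ell lam Lam Q →
      ∀ (v : En n → ℝ) (κ : ℝ), 0 ≤ κ → κ ≤ ε → Loc Q v (4 * R) κ →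
      (∀ x ∈ ball (0 : En n) (4 * R), |v x| ≤ C1 * ((x 0) ^ 2 + κ ^ 2)) →
      (∀ x ∈ ball (0 : En n) (2 * R), -η ≤ v x) →
      ∀ p : En n, ‖p‖ = 1 → ε ≤ p 0 → v p = 0 → ∀ x : En n, ‖x‖ ≤ p 0 / 2 → 0 ≤ x 0 →
      v x < (p 0 / 2) ^ 2 / (8 * Lam) := by
  have hL0 : 0 < Lam := by linarith
  set W := 1 + 128 * C1 * Lam * (1 + Lam / lam) with hW
  have hWp : 0 < 128 * C1 * Lam * (1 + Lam / lam) := by positivity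
  have hW1 : 1 ≤ W := by linarith
  obtain ⟨R, η, hR, hη, H⟩ := tang (n := n) lam Lam C1 (W + 1) (ε ^ 2 / (128 * Lam)) hl hL hC1 (by linarith) (by positivity)
  refine ⟨R, η, by linarith, hη, ?_⟩
  intro Q hQ v κ hκ hκε hv hg hlow p hp hpε hvp x hx hx0
  have T := H Q hQ v κ hκ (by linarith) hv hg hlow
  set t := p 0 with ht
  have ht0 : 0 < t := by linarith
  have ht1 : t ≤ 1 := by rw [← hp]; exact (le_abs_self _).trans (abs_coord p 0)
  have hin : ∀ z : En n, ‖z‖ ≤ W → z ∈ ball (0 : En n) (4 * R) := by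
    intro z hz; rw [mem_ball, dist_zero_right]; linarith
  set U : Set (En n) := (ball 0 W ∩ {x | 0 < x 0}) ∩ {x | x 0 < t}
  have hU : IsOpen U := (isOpen_ball.inter (isOpen_lt continuous_const (cont_coord 0))).inter
    (isOpen_lt (cont_coord 0) continuous_const)
  have hUW : ∀ z ∈ U, ‖z‖ ≤ W := fun z hz => by
    have := hz.1.1; rw [mem_ball, dist_zero_right] at this; exact this.le
  have key := strip hQ (w := v) (W := W) (t := t) (A := ε ^ 2 / (128 * Lam)) (S := 2 * C1 * t ^ 2) (by linarith) (by positivity)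
    hU (hv.cont.mono fun z hz => hin z hz.1)
    (fun z hz => ⟨hUW z hz, le_of_lt hz.1.2, le_of_lt hz.2⟩)
    (fun z hz => hv.sub z (hin z (hUW z hz)) hz.1.2)
    (fun z hz z1 z2 z3 => by
      have hpos : 0 < ε ^ 2 / (128 * Lam) := by positivity
      rcases eq_or_lt_of_le z2 with h | h2
      · left; rw [hv.zero z h.ge]; positivity
      rcases eq_or_lt_of_le z3 with h | h3
      · left
        have := T p (z - p) (by simp [h, ht]) ((norm_sub_le _ _).trans (by linarith)) (by linarith) ht1 (by linarith)
        rw [hvp, add_sub_cancel] at this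
        linarith
      · right
        have : ‖z‖ = W := by
          by_contra hne
          exact hz ⟨⟨by simpa using lt_of_le_of_ne z1 hne, h2⟩, h3⟩
        refine ⟨this, ?_⟩
        have h4 := (le_abs_self _).trans (hg z (hin z z1))
        have h5 : z 0 ^ 2 ≤ t ^ 2 := by gcongr
        have h6 : κ ^ 2 ≤ t ^ 2 := by gcongr; linarith
        nlinarith) x (by linarith) hx0 ((le_abs_self _).trans ((abs_coord x 0).trans (by linarith)))
  have hxt : x 0 ≤ t := (le_abs_self _).trans ((abs_coord x 0).trans (by linarith))
  have b1 : ‖x‖ ^ 2 + Lam / lam * (x 0 * (t - x 0)) ≤ 1 + Lam / lam := by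
    have q1 : ‖x‖ ^ 2 ≤ 1 := pow_le_one₀ (norm_nonneg _) (by linarith)
    have q2 : x 0 * (t - x 0) ≤ 1 := by nlinarith
    have : Lam / lam * (x 0 * (t - x 0)) ≤ Lam / lam * 1 := by gcongr
    linarith
  have b2 : 2 * C1 * t ^ 2 / W ^ 2 * (‖x‖ ^ 2 + Lam / lam * (x 0 * (t - x 0))) ≤ t ^ 2 / (64 * Lam) := by
    calc _ ≤ 2 * C1 * t ^ 2 / W ^ 2 * (1 + Lam / lam) := by gcongr
      _ ≤ _ := by
        rw [div_mul_eq_mul_div, div_le_div_iff₀ (by positivity) (by positivity)]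
        have : 128 * C1 * Lam * (1 + Lam / lam) ≤ W ^ 2 := by nlinarith
        calc _ = t ^ 2 * (128 * C1 * Lam * (1 + Lam / lam)) := by ring
          _ ≤ _ := by gcongr
  have b3 : ε ^ 2 / (128 * Lam) ≤ t ^ 2 / (128 * Lam) := by gcongr
  have b4 : (t / 2) ^ 2 / (8 * Lam) = 4 * (t ^ 2 / (128 * Lam)) := by field_simp; norm_num
  have b5 : t ^ 2 / (64 * Lam) = 2 * (t ^ 2 / (128 * Lam)) := by field_simp; norm_num
  have b6 : 0 < t ^ 2 / (128 * Lam) := by positivity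
  linarith

lemma low_vol (lam Lam C1 R η : ℝ) (hl : 0 < lam) (hL : lam ≤ Lam) (hC1 : 0 < C1) (hR : 1 ≤ R) (hη : 0 < η) :
    ∃ ϱ κ0 : ℝ, 0 < ϱ ∧ 0 < κ0 ∧ ∀ (Q : Matrix (Fin n) (Fin n) ℝ), Ell lam Lam Q →
      ∀ (v : En n → ℝ) (κ : ℝ), 0 ≤ κ → κ ≤ κ0 → Loc Q v (4 * R) κ →
      (∀ x ∈ ball (0 : En n) (4 * R), |v x| ≤ C1 * ((x 0) ^ 2 + κ ^ 2)) →
      volume ({z : En n | 0 < z 0 ∧ v z < 0} ∩ ball 0 (4 * R)) < volume (ball (0 : En n) ϱ) →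
      ∀ x ∈ ball (0 : En n) (2 * R), -η ≤ v x := by
  have hL0 : 0 < Lam := by linarith
  set τ := √(η / (2 * C1)) with hτ
  have hτ0 : 0 < τ := Real.sqrt_pos.2 (by positivity)
  have hτ2 : τ ^ 2 = η / (2 * C1) := Real.sq_sqrt (by positivity)
  set r := min (τ / 2) (min R (√(lam * η / 4))) with hr
  have hr0 : 0 < r := by
    have : 0 < √(lam * η / 4) := Real.sqrt_pos.2 (by positivity)
    positivity
  have hr1 : r ≤ τ / 2 := min_le_left _ _
  have hr2 : r ≤ R := (min_le_right _ _).trans (min_le_left _ _)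
  have hr3 : r ^ 2 / lam ≤ η / 4 := by
    have : r ≤ √(lam * η / 4) := (min_le_right _ _).trans (min_le_right _ _)
    have h2 : r ^ 2 ≤ lam * η / 4 := by
      calc r ^ 2 ≤ √(lam * η / 4) ^ 2 := by gcongr
        _ = _ := Real.sq_sqrt (by positivity)
    rw [div_le_iff₀ hl]; linarith
  set m := C1 * ((4 * R) ^ 2 + τ ^ 2) + η / 4 with hm
  set G := n * (5 * (Lam / lam) * m / r) with hG
  have hG0 : 0 ≤ G := by positivity
  set ϱ := min (r / 2) (η / (4 * (G + 1))) with hϱ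
  have hϱ0 : 0 < ϱ := by positivity
  refine ⟨ϱ, τ, hϱ0, hτ0, ?_⟩
  intro Q hQ v κ hκ hκτ hv hg hvol x hx
  by_contra! hlt
  have hx4 : x ∈ ball (0 : En n) (4 * R) := ball_subset_ball (by linarith) hx
  have hx0 : 0 < x 0 := by
    by_contra! h
    rw [hv.zero x h] at hlt; linarith
  have hxτ : τ ≤ x 0 := by
    by_contra! h
    have h1 := (abs_le.1 (hg x hx4)).1
    have h2 : x 0 ^ 2 < τ ^ 2 := by gcongr
    have h3 : κ ^ 2 ≤ τ ^ 2 := by gcongr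
    have h4 : C1 * (x 0 ^ 2 + κ ^ 2) < C1 * (τ ^ 2 + τ ^ 2) := by gcongr ?_ * ?_; linarith
    have h5 : C1 * (τ ^ 2 + τ ^ 2) = η := by rw [hτ2]; field_simp; norm_num
    linarith
  have hin : ∀ z ∈ closedBall x r, z ∈ ball (0 : En n) (4 * R) ∧ 0 < z 0 := by
    intro z hz
    rw [mem_closedBall, dist_eq_norm] at hz
    have h1 := abs_le.1 ((abs_coord (z - x) 0).trans hz)
    simp only [PiLp.sub_apply] at h1
    refine ⟨?_, by linarith [h1.1]⟩
    rw [mem_ball, dist_zero_right] at hx ⊢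
    calc ‖z‖ = ‖x + (z - x)‖ := by congr 1; abel
      _ ≤ ‖x‖ + ‖z - x‖ := norm_add_le _ _
      _ < _ := by linarith
  obtain ⟨h, hh, happ⟩ := approx_int hQ (U := v) (y := x) (ρ := r) (ε := r ^ 2 / (2 * lam)) hr0 (by positivity)
    (hv.cont.mono fun z hz => (hin z hz).1)
    (fun z hz => by
        have := hin z (ball_subset_closedBall hz); exact (hv.sub z this.1 this.2).mono (by norm_num))
    (fun z hz => by
        have := hin z (ball_subset_closedBall hz); exact (hv.sup z this.1 this.2))
  have happ' : ∀ z ∈ closedBall x r, |v z - ev h z| ≤ η / 4 := fun z hz => by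
    refine (happ z hz).trans (le_trans (le_of_eq ?_) hr3)
    field_simp; norm_num
  have hb : ∀ z ∈ closedBall x r, |ev h z| ≤ m := by
    intro z hz
    have h1 := happ' z hz
    have h2 := hg z (hin z hz).1
    have h3 := abs_sub_abs_le_abs_sub (ev h z) (v z)
    rw [abs_sub_comm] at h3
    have h4 : z 0 ^ 2 ≤ (4 * R) ^ 2 := by
      have := (hin z hz).1
      rw [mem_ball, dist_zero_right] at this
      have h6 := (hin z hz).2
      gcongr
      exact (le_abs_self _).trans ((abs_coord z 0).trans this.le)
    have h5 : κ ^ 2 ≤ τ ^ 2 := by gcongr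
    have : C1 * (z 0 ^ 2 + κ ^ 2) ≤ C1 * ((4 * R) ^ 2 + τ ^ 2) := by gcongr
    linarith
  have hsub : ball x ϱ ⊆ {z : En n | 0 < z 0 ∧ v z < 0} ∩ ball 0 (4 * R) := by
    intro z hz
    rw [mem_ball, dist_eq_norm] at hz
    have hz1 : ‖z - x‖ ≤ r / 2 := hz.le.trans (min_le_left _ _)
    have hz2 : ‖z - x‖ ≤ η / (4 * (G + 1)) := hz.le.trans (min_le_right _ _)
    have hzr : z ∈ closedBall x r := by rw [mem_closedBall, dist_eq_norm]; linarith
    refine ⟨⟨(hin z hzr).2, ?_⟩, (hin z hzr).1⟩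
    have l1 := harm_lip hQ hr0 hh hb (x := x) (z := z) (by rw [mem_closedBall, dist_self]; linarith) (by rwa [mem_closedBall, dist_eq_norm])
    have l2 : G * ‖z - x‖ ≤ η / 4 := by
      calc G * ‖z - x‖ ≤ (G + 1) * (η / (4 * (G + 1))) := by gcongr <;> linarith
        _ = _ := by field_simp
    have l3 := abs_le.1 (l1.trans l2)
    have l4 := abs_le.1 (happ' z hzr)
    have l5 := abs_le.1 (happ' x (by simp [hr0.le]))
    linarith [l3.2, l4.2, l5.1]
  have := measure_mono (μ := volume) hsub
  rw [Measure.addHaar_ball_center] at this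
  exact absurd hvol (not_lt.2 this)
end TC

namespace TC
open Topology Asymptotics MvPolynomial

variable {n : ℕ} [NeZero n] {Q : Matrix (Fin n) (Fin n) ℝ} {lam Lam : ℝ}

lemma LAt_dist4 (y x : En n) :
    LAt Q (fun z => ‖z - y‖ ^ 2 * ‖z - y‖ ^ 2) x (4 * trQ Q 1 * ‖x - y‖ ^ 2 + 8 * qf Q (x - y)) := by
  have := (T2_dist y x).mul (T2_dist y x)
  refine ⟨_, _, ?_, this, ?_⟩
  · exact ((Matrix.isSymm_one.smul _).smul _ |>.add ((Matrix.isSymm_one.smul _).smul _)).add (outer_symm _ _)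
  · have e : trQ Q (outer (fun i => 2 * (x i - y i)) (fun i => 2 * (x i - y i))) = 8 * qf Q (x - y) := by
      simp only [trQ, outer, qf, Finset.mul_sum, PiLp.sub_apply]
      exact Finset.sum_congr rfl fun i _ => Finset.sum_congr rfl fun j _ => by ring
    rw [trQ_add, trQ_add, trQ_smul, trQ_smul, e]; ring

lemma hopf (hQ : Ell lam Lam Q) {v : En n → ℝ} {p q : En n} {d : ℝ} (hd : 0 < d) (hq : ‖q - p‖ = d)
    {D : Set (En n)} (hD : IsOpen D) (hqD : closedBall p d ⊆ D) (hc : ContinuousOn v D)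
    (hs : ∀ x ∈ D, SubAt Q v 0 x) (hv : ∀ x ∈ D, v x ≤ 0) (hneg : ∀ x ∈ ball p d, v x < 0) (hvq : v q = 0) : False := by
  have hl := hQ.lam_pos
  have hL : 0 < Lam := hl.trans_le hQ.lam_le
  set μ := lam / (2 * (lam + Lam)) with hμ
  have hμ0 : 0 < μ := by positivity
  have hμ1 : μ ≤ 1 / 2 := by rw [hμ, div_le_iff₀ (by positivity)]; linarith
  have hμ2 : 4 * Lam * μ ≤ 2 * lam := by
    rw [hμ, ← mul_div_assoc, div_le_iff₀ (by positivity)]; nlinarith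
  set K := (2 * Lam + 1) / (2 * lam * d ^ 2) with hK
  have hK0 : 0 < K := by positivity
  have hKd : K * (2 * lam * d ^ 2) = 2 * Lam + 1 := by rw [hK]; field_simp
  set φ : En n → ℝ := fun z => (d ^ 2 + K * d ^ 4) + (-(1 + 2 * K * d ^ 2)) * ‖z - p‖ ^ 2 + K * (‖z - p‖ ^ 2 * ‖z - p‖ ^ 2) with hφ
  have hφe : ∀ z, φ z = (d ^ 2 - ‖z - p‖ ^ 2) * (1 + K * (d ^ 2 - ‖z - p‖ ^ 2)) := fun z => by simp only [hφ]; ring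
  have hφL : ∀ x, ∃ l, LAt Q φ x l ∧ ((1 - μ) * d ^ 2 ≤ ‖x - p‖ ^ 2 → 1 ≤ l) := by
    intro x
    refine ⟨_, ((LAt_const (d ^ 2 + K * d ^ 4) x).add ((LAt_dist p x).const_mul _)).add ((LAt_dist4 p x).const_mul K), ?_⟩
    intro hx
    have h1 := hQ.lower (x - p)
    have h2 := hQ.tr_hi
    have h3 := hQ.T_pos
    set N := ‖x - p‖ ^ 2
    set T := trQ Q 1
    have e1 : lam * ((1 - μ) * d ^ 2) ≤ qf Q (x - p) := le_trans (by gcongr) h1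
    have e2 : T * (d ^ 2 - N) ≤ Lam * (μ * d ^ 2) := by
      rcases le_or_gt 0 (d ^ 2 - N) with h | h
      · have : d ^ 2 - N ≤ μ * d ^ 2 := by linarith
        gcongr
      · have : T * (d ^ 2 - N) ≤ 0 := mul_nonpos_of_nonneg_of_nonpos h3.le h.le
        have : 0 ≤ Lam * (μ * d ^ 2) := by positivity
        linarith
    have e3 : 2 * lam * d ^ 2 ≤ 8 * qf Q (x - p) - 4 * (T * (d ^ 2 - N)) := by
      have : 0 < d ^ 2 := by positivity
      have : 4 * lam * d ^ 2 ≤ 8 * (lam * ((1 - μ) * d ^ 2)) := by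
        have : lam * d ^ 2 * μ ≤ lam * d ^ 2 * (1 / 2) := by gcongr
        nlinarith
      have : 4 * (Lam * (μ * d ^ 2)) ≤ 2 * lam * d ^ 2 := by nlinarith
      linarith
    have e4 : K * (2 * lam * d ^ 2) ≤ K * (8 * qf Q (x - p) - 4 * (T * (d ^ 2 - N))) := by gcongr
    rw [hKd] at e4
    nlinarith
  have hqq : d ^ 2 = ‖q - p‖ ^ 2 := by rw [hq]
  set ρ := √(1 - μ) * d with hρ
  have hρ2 : ρ ^ 2 = (1 - μ) * d ^ 2 := by rw [hρ, mul_pow, Real.sq_sqrt (by linarith)]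
  have hρ0 : 0 < ρ := by have : 0 < √(1 - μ) := Real.sqrt_pos.2 (by linarith); positivity
  have hρd : ρ < d := by
    have : ρ ^ 2 < d ^ 2 := by rw [hρ2]; have : 0 < d ^ 2 := by positivity
                               nlinarith
    exact lt_of_pow_lt_pow_left₀ 2 hd.le this
  obtain ⟨z0, hz0, hzm⟩ := (isCompact_closedBall p ρ).exists_isMaxOn ⟨p, by simp [hρ0.le]⟩
    (hc.mono ((closedBall_subset_closedBall hρd.le).trans hqD))
  have hm : v z0 < 0 := hneg z0 (closedBall_subset_ball hρd hz0)
  set B := μ * d ^ 2 * (1 + K * (μ * d ^ 2)) with hB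
  have hB0 : 0 < B := by positivity
  set ε := -v z0 / B with hε
  have hε0 : 0 < ε := div_pos (by linarith) hB0
  have hφc : Continuous φ := by simp only [hφ]; fun_prop
  have key := MP hQ (u := fun z => v z + ε * φ z) (U := ball p d ∩ {z | ρ < ‖z - p‖}) (K := closedBall p d ∩ {z | ρ ≤ ‖z - p‖})
    (m := 0) (isOpen_ball.inter (isOpen_lt continuous_const (by fun_prop)))
    ((isCompact_closedBall _ _).inter_right (isClosed_le continuous_const (by fun_prop)))
    (inter_subset_inter ball_subset_closedBall fun z (hz : ρ < ‖z - p‖) => show ρ ≤ ‖z - p‖ from le_of_lt hz)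
    ((hc.mono (inter_subset_left.trans hqD)).add (hφc.const_mul ε |>.continuousOn)) (fun x hx => by
      obtain ⟨l, hl1, hl2⟩ := hφL x
      refine ((hs x (hqD (ball_subset_closedBall hx.1))).add_T2 hQ (hl1.const_mul ε)).mono ?_
      have hx2 : ρ < ‖x - p‖ := hx.2
      have := hl2 (by rw [← hρ2]; gcongr)
      have : 0 ≤ ε * l := by positivity
      linarith) (fun x hx hxU => by
      have h1 : ‖x - p‖ ≤ d := by simpa [dist_eq_norm] using hx.1
      have h2 : ρ ≤ ‖x - p‖ := hx.2
      beta_reduce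
      rcases eq_or_lt_of_le h1 with h | h
      · rw [hφe, h, sub_self, zero_mul, mul_zero, add_zero]; exact hv x (hqD hx.1)
      · rcases eq_or_lt_of_le h2 with h' | h'
        · rw [hφe, ← h', hρ2]
          have e : d ^ 2 - (1 - μ) * d ^ 2 = μ * d ^ 2 := by ring
          rw [e, ← hB, hε, div_mul_cancel₀ _ hB0.ne']
          have : v x ≤ v z0 := hzm (by rw [mem_closedBall, dist_eq_norm]; exact h'.ge)
          linarith
        · exact absurd ⟨by rw [mem_ball, dist_eq_norm]; exact h, h'⟩ hxU)
  have hqm : q ∈ closedBall p d := by rw [mem_closedBall, dist_eq_norm, hq]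
  obtain ⟨l, hl1, hl2⟩ := hφL q
  have hl3 := hl2 (by rw [← hqq]; nlinarith [sq_nonneg d])
  have hsub := (hs q (hqD hqm)).add_T2 hQ (hl1.const_mul ε)
  have hφq : φ q = 0 := by rw [hφe, hqq, sub_self, zero_mul]
  have ev1 : ∀ᶠ z in 𝓝 q, z ∈ D := hD.mem_nhds (hqD hqm)
  have cn : Continuous fun z : En n => ‖z - p‖ := by fun_prop
  have ev2 : ∀ᶠ z in 𝓝 q, ρ < ‖z - p‖ := cn.continuousAt.eventually (lt_mem_nhds (by beta_reduce; rw [hq]; exact hρd))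
  have ev3 : ∀ᶠ z in 𝓝 q, 0 < 1 + K * (d ^ 2 - ‖z - p‖ ^ 2) := by
    have cc : Continuous fun z : En n => 1 + K * (d ^ 2 - ‖z - p‖ ^ 2) := by fun_prop
    exact cc.continuousAt.eventually (lt_mem_nhds (by beta_reduce; rw [hq]; simp))
  have := hsub.le_of_max (by
    filter_upwards [ev1, ev2, ev3] with z z1 z2 z3
    rw [hφq, hvq, mul_zero, add_zero]
    rcases le_or_gt ‖z - p‖ d with h | h
    · exact key z ⟨by rw [mem_closedBall, dist_eq_norm]; exact h, z2.le⟩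
    · have h1 : φ z ≤ 0 := by
        rw [hφe]; refine mul_nonpos_of_nonpos_of_nonneg ?_ z3.le
        have : d ^ 2 < ‖z - p‖ ^ 2 := by gcongr
        linarith
      have := hv z z1
      nlinarith)
  nlinarith

lemma smp (hQ : Ell lam Lam Q) {v : En n → ℝ} {D : Set (En n)} (hD : IsOpen D) (hpre : IsPreconnected D)
    (hc : ContinuousOn v D) (hs : ∀ x ∈ D, SubAt Q v 0 x) (hv : ∀ x ∈ D, v x ≤ 0) {z : En n} (hz : z ∈ D) (hvz : v z = 0) :
    ∀ x ∈ D, v x = 0 := by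
  have loc : ∀ z ∈ D, v z = 0 → ∀ᶠ x in 𝓝 z, v x = 0 := by
    intro z hz hvz
    obtain ⟨δ, hδ, hδD⟩ := Metric.isOpen_iff.1 hD z hz
    filter_upwards [ball_mem_nhds z (show 0 < δ / 8 by positivity)] with p hp
    by_contra hne
    have hcb : closedBall z (δ / 2) ⊆ D := (closedBall_subset_ball (by linarith)).trans hδD
    have hZ : IsClosed (closedBall z (δ / 2) ∩ v ⁻¹' {0}) :=
      (hc.mono hcb).preimage_isClosed_of_isClosed isClosed_closedBall isClosed_singleton
    have hzZ : z ∈ closedBall z (δ / 2) ∩ v ⁻¹' {0} := ⟨by rw [mem_closedBall, dist_self]; linarith, hvz⟩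
    obtain ⟨q, hq, hqd⟩ := hZ.exists_infDist_eq_dist ⟨z, hzZ⟩ p
    have hdz := infDist_le_dist_of_mem (x := p) hzZ
    rw [mem_ball] at hp
    set d := dist p q with hd
    have hdle : d ≤ dist p z := by rw [← hqd]; exact hdz
    have hd0 : 0 < d := by
      rw [hd, dist_pos]; rintro rfl; exact hne hq.2
    have hpd : closedBall p d ⊆ closedBall z (δ / 2) := closedBall_subset_closedBall' (by linarith)
    refine hopf hQ hd0 (by rw [hd, dist_comm, dist_eq_norm]) hD (hpd.trans hcb) hc hs hv (fun x hx => ?_) hq.2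
    have hxz := hpd (ball_subset_closedBall hx)
    refine lt_of_le_of_ne (hv x (hcb hxz)) fun h0 => ?_
    have := infDist_le_dist_of_mem (x := p) (show x ∈ closedBall z (δ / 2) ∩ v ⁻¹' {0} from ⟨hxz, h0⟩)
    rw [hqd, dist_comm] at this
    rw [mem_ball] at hx
    linarith
  intro x hx
  by_contra hne
  have := hpre (D ∩ v ⁻¹' (Iio 0)) {z | ∀ᶠ x in 𝓝 z, v x = 0} (hc.isOpen_inter_preimage hD isOpen_Iio)
    isOpen_setOfPred_eventually_nhds (fun y hy => by
      rcases eq_or_lt_of_le (hv y hy) with h | h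
      · exact Or.inr (loc y hy h)
      · exact Or.inl ⟨hy, h⟩) ⟨x, hx, hx, lt_of_le_of_ne (hv x hx) hne⟩ ⟨z, hz, loc z hz hvz⟩
  obtain ⟨y, _, ⟨_, hy1⟩, hy2⟩ := this
  have hy3 : ∀ᶠ x in 𝓝 y, v x = 0 := hy2
  have h3 : v y = 0 := hy3.self_of_nhds
  have h4 : v y < 0 := hy1
  linarith

lemma pos_pts (hQ : Ell lam Lam Q) {v : En n → ℝ} {R κ : ℝ} (hR : 0 < R) (hv : Loc Q v R κ)
    (hneg : ∀ δ > 0, ∃ x : En n, ‖x‖ < δ ∧ 0 < x 0 ∧ 0 ≤ v x)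
    (hΩ : ∀ δ > 0, ∃ x : En n, ‖x‖ < δ ∧ 0 < x 0 ∧ SubAt Q v 1 x) :
    ∀ δ > 0, ∃ x : En n, ‖x‖ < δ ∧ 0 < v x := by
  intro δ hδ
  by_contra! hall
  set r := min δ R
  have hr : 0 < r := by positivity
  set D : Set (En n) := ball 0 r ∩ {x | 0 < x 0}
  have hDo : IsOpen D := isOpen_ball.inter (isOpen_lt continuous_const (cont_coord 0))
  have hDc : Convex ℝ D := by
    refine (convex_ball _ _).inter ?_
    intro x hx y hy a b ha hb hab
    have hx' : 0 < x 0 := hx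
    have hy' : 0 < y 0 := hy
    show 0 < (a • x + b • y) 0
    simp only [PiLp.add_apply, PiLp.smul_apply, smul_eq_mul]
    rcases ha.eq_or_lt with h | h
    · subst h; have : b = 1 := by linarith
      subst this; simpa using hy'
    · positivity
  have hDR : ∀ x ∈ D, x ∈ ball (0 : En n) R := fun x hx => ball_subset_ball (min_le_right _ _) hx.1
  obtain ⟨z, z1, z2, z3⟩ := hneg r hr
  have hDd : ∀ x ∈ D, v x ≤ 0 := fun x hx => hall x (by
    have := hx.1; rw [mem_ball, dist_zero_right] at this; exact this.trans_le (min_le_left _ _))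
  have hzD : z ∈ D := ⟨by simpa using z1, z2⟩
  have hz := smp hQ hDo hDc.isPreconnected (hv.cont.mono fun x hx => hDR x hx) (fun x hx => hv.sub x (hDR x hx) hx.2)
    hDd hzD (le_antisymm (hDd z hzD) z3)
  obtain ⟨x, x1, x2, x3⟩ := hΩ r hr
  have hxD : x ∈ D := ⟨by simpa using x1, x2⟩
  have := x3.le_of_max (by
    filter_upwards [hDo.mem_nhds hxD] with y hy
    rw [hz y hy, hz x hxD])
  linarith

lemma nondeg (hQ : Ell lam Lam Q) {v : En n → ℝ} {R κ : ℝ} (hv : Loc Q v R κ)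
    (hpos : ∀ δ > 0, ∃ x : En n, ‖x‖ < δ ∧ 0 < v x) {ρ : ℝ} (hρ : 0 < ρ) (hρR : ρ < R) :
    ∃ x : En n, ‖x‖ ≤ ρ ∧ 0 ≤ x 0 ∧ ρ ^ 2 / (8 * Lam) ≤ v x := by
  have hT := hQ.T_pos
  have hTL := hQ.tr_hi
  obtain ⟨p, hp, hvp⟩ := hpos (ρ / 4) (by positivity)
  by_contra! hall
  have hpos0 : ∀ x : En n, 0 < v x → 0 < x 0 := by
    intro x hx; by_contra! h; rw [hv.zero x h] at hx; exact lt_irrefl _ hx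
  have hin : ∀ x ∈ closedBall p (ρ / 2), ‖x‖ ≤ ρ := by
    intro x hx
    rw [mem_closedBall, dist_eq_norm] at hx
    calc ‖x‖ = ‖p + (x - p)‖ := by congr 1; abel
      _ ≤ ‖p‖ + ‖x - p‖ := norm_add_le _ _
      _ ≤ ρ := by linarith
  have hin' : closedBall p (ρ / 2) ⊆ ball 0 R := fun x hx => by
    rw [mem_ball, dist_zero_right]; exact (hin x hx).trans_lt hρR
  have hcv := hv.cont.mono hin'
  set c := -(1 / (2 * trQ Q 1))
  have key := MP hQ (u := fun z => v z + c * ‖z - p‖ ^ 2) (U := ball p (ρ / 2) ∩ v ⁻¹' (Ioi 0)) (K := closedBall p (ρ / 2))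
    (m := 0) ((hcv.mono ball_subset_closedBall).isOpen_inter_preimage isOpen_ball isOpen_Ioi) (isCompact_closedBall _ _)
    (inter_subset_left.trans ball_subset_closedBall) (hcv.add (Continuous.continuousOn (by fun_prop)))
    (fun x hx => by
      have hx2 : 0 < v x := hx.2
      have := (hv.one x (hin' (ball_subset_closedBall hx.1)) (hpos0 x hx2) hx2.ne').add_T2 hQ ((LAt_dist p x).const_mul c)
      refine this.mono (le_of_eq ?_)
      simp only [c]; field_simp; norm_num) (fun x hx hxU => by
      beta_reduce
      have hc0 : c < 0 := by simp only [c]; have : 0 < 1 / (2 * trQ Q 1) := by positivity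
                             linarith
      rcases le_or_gt (v x) 0 with h | h
      · nlinarith [sq_nonneg ‖x - p‖]
      · have hd : ‖x - p‖ = ρ / 2 := by
          rw [mem_closedBall, dist_eq_norm] at hx
          by_contra hne
          exact hxU ⟨by rw [mem_ball, dist_eq_norm]; exact lt_of_le_of_ne hx hne, h⟩
        have h1 := hall x (hin x hx) (hpos0 x h).le
        rw [hd]
        have e : c * (ρ / 2) ^ 2 = -(ρ ^ 2 / (8 * trQ Q 1)) := by simp only [c]; field_simp; norm_num
        have : ρ ^ 2 / (8 * Lam) ≤ ρ ^ 2 / (8 * trQ Q 1) := by gcongr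
        rw [e]; linarith)
  have := key p (by rw [mem_closedBall, dist_self]; linarith)
  simp only [sub_self, norm_zero] at this
  simp at this
  linarith
end TC

namespace TC
open Topology Asymptotics MvPolynomial
variable {n : ℕ} [NeZero n] {Q : Matrix (Fin n) (Fin n) ℝ} {lam Lam : ℝ}

lemma Loc.scale {v : En n → ℝ} {R κ s : ℝ} (hs : 0 < s) (hv : Loc Q v R κ) :
    Loc Q (fun x => v (s • x) / s ^ 2) (R / s) (κ / s) := by
  have hin : ∀ x ∈ ball (0 : En n) (R / s), s • x ∈ ball (0 : En n) R := by
    intro x hx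
    rw [mem_ball_zero_iff, lt_div_iff₀ hs] at hx
    rw [mem_ball_zero_iff, norm_smul, Real.norm_of_nonneg hs.le]; linarith
  have hc0 : ∀ x : En n, (s • x) 0 = s * x 0 := fun x => by simp
  refine ⟨?_, ?_, ?_, ?_, ?_, ?_⟩
  · refine ContinuousOn.div_const ?_ _
    exact hv.cont.comp (by fun_prop) hin
  · intro x hx
    rw [hv.zero (s • x) (by rw [hc0]; exact mul_nonpos_of_nonneg_of_nonpos hs.le hx)]; simp
  · intro x hx h0
    exact (hv.sub _ (hin x hx) (by rw [hc0]; positivity)).scale hs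
  · intro x hx h0
    have := (hv.sup _ (hin x hx) (by rw [hc0]; positivity)).scale hs
    simpa only [neg_div] using this
  · intro x hx h0 h1
    refine (hv.one _ (hin x hx) (by rw [hc0]; positivity) ?_).scale hs
    intro h; apply h1; rw [h]; simp
  · intro x hx h0 c hc
    have := hv.kink _ (hin x hx) (by rw [hc0, h0]; simp) (c * s) (by rwa [gt_iff_lt, div_lt_iff₀ hs] at hc)
    have ht : Tendsto (fun t : ℝ => s * t) (𝓝[>] 0) (𝓝[>] 0) := by
      refine tendsto_nhdsWithin_iff.2 ⟨?_, ?_⟩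
      · have : Continuous (fun t : ℝ => s * t) := by fun_prop
        simpa using (this.tendsto 0).mono_left nhdsWithin_le_nhds
      · filter_upwards [self_mem_nhdsWithin] with t ht
        exact mul_pos hs ht
    filter_upwards [ht.eventually this] with t ht
    rw [smul_add, smul_smul, abs_div, abs_of_pos (by positivity : 0 < s ^ 2), div_le_iff₀ (by positivity)]
    nlinarith

lemma vol_scale {v : En n → ℝ} {s ρ : ℝ} (hs : 0 < s) :
    volume ({z : En n | 0 < z 0 ∧ v (s • z) / s ^ 2 < 0} ∩ ball 0 ρ)
      = ENNReal.ofReal (s⁻¹ ^ n) * volume ({z : En n | 0 < z 0 ∧ v z < 0} ∩ ball 0 (s * ρ)) := by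
  have : {z : En n | 0 < z 0 ∧ v (s • z) / s ^ 2 < 0} ∩ ball 0 ρ
      = (fun z => s • z) ⁻¹' ({z : En n | 0 < z 0 ∧ v z < 0} ∩ ball 0 (s * ρ)) := by
    ext z
    simp only [mem_inter_iff, mem_preimage, Set.mem_ofPred_eq, mem_ball_zero_iff, norm_smul,
      Real.norm_of_nonneg hs.le, PiLp.smul_apply, smul_eq_mul, mul_pos_iff_of_pos_left hs, mul_lt_mul_iff_right₀ hs]
    rw [div_lt_iff₀ (by positivity)]; simp
  rw [this, Measure.addHaar_preimage_smul _ hs.ne']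
  congr 2
  simp [abs_of_pos hs]

lemma matOpNorm_vec (ξ : En n) : matOpNorm (Matrix.vecMulVec (fun i => ξ i) (fun i => ξ i)) = ‖ξ‖ ^ 2 := by
  have key : ∀ x : En n, (Matrix.toEuclideanCLM (𝕜 := ℝ) (Matrix.vecMulVec (fun i => ξ i) (fun i => ξ i))) x
      = (inner ℝ ξ x) • ξ := by
    intro x
    ext i
    simp [Matrix.ofLp_toEuclideanCLM, Matrix.mulVec, dotProduct, Matrix.vecMulVec, PiLp.inner_apply, Finset.mul_sum,
      Finset.sum_mul]
    refine Finset.sum_congr rfl fun j _ => by ring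
  unfold matOpNorm
  apply le_antisymm
  · refine ContinuousLinearMap.opNorm_le_bound _ (by positivity) fun x => ?_
    rw [key, norm_smul]
    nlinarith [norm_inner_le_norm (𝕜 := ℝ) ξ x, norm_nonneg ξ]
  · rcases eq_or_ne ξ 0 with rfl | h
    · simp
    have := ContinuousLinearMap.le_opNorm (Matrix.toEuclideanCLM (𝕜 := ℝ) (Matrix.vecMulVec (fun i => ξ i) (fun i => ξ i))) ξ
    rw [key, norm_smul, real_inner_self_eq_norm_sq, norm_pow, norm_norm] at this
    exact le_of_mul_le_mul_right this (norm_pos_iff.2 h)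

lemma exists_Q {F : Matrix (Fin n) (Fin n) ℝ → ℝ} (hF : EllipticF n lam Lam F) :
    ∃ Q : Matrix (Fin n) (Fin n) ℝ, Ell lam Lam Q ∧ ∀ A : Matrix (Fin n) (Fin n) ℝ, A.IsSymm → F A = trQ Q A := by
  have hF0 : F 0 = 0 := by simpa using hF.homogeneous 0 0
  have hneg : ∀ A, F (-A) = -F A := fun A => by simpa using hF.homogeneous (-1) A
  have hle : ∀ A B : Matrix (Fin n) (Fin n) ℝ, A.IsSymm → B.IsSymm → F (A + B) ≤ F A + F B := by
    intro A B hA hB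
    have := hF.convexF.2 (show A ∈ {A : Matrix (Fin n) (Fin n) ℝ | A.IsSymm} from hA) (show B ∈ {A : Matrix (Fin n) (Fin n) ℝ | A.IsSymm} from hB) (show (0:ℝ) ≤ 1/2 by norm_num) (show (0:ℝ) ≤ 1/2 by norm_num) (by norm_num)
    rw [← smul_add, hF.homogeneous] at this
    simp only [smul_eq_mul] at this
    linarith
  have hadd : ∀ A B : Matrix (Fin n) (Fin n) ℝ, A.IsSymm → B.IsSymm → F (A + B) = F A + F B := by
    intro A B hA hB
    refine le_antisymm (hle A B hA hB) ?_
    have := hle (-A) (-B) hA.neg hB.neg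
    rw [← neg_add, hneg, hneg, hneg] at this
    linarith
  have hsy : ∀ A : Matrix (Fin n) (Fin n) ℝ, (A + A.transpose).IsSymm := fun A => by
    unfold Matrix.IsSymm; rw [Matrix.transpose_add, Matrix.transpose_transpose, add_comm]
  let G : Matrix (Fin n) (Fin n) ℝ →ₗ[ℝ] ℝ :=
    { toFun := fun A => (1 / 2) * F (A + A.transpose)
      map_add' := fun A B => by
        have : A + B + (A + B).transpose = (A + A.transpose) + (B + B.transpose) := by
          rw [Matrix.transpose_add]; abel
        rw [this, hadd _ _ (hsy A) (hsy B)]; ring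
      map_smul' := fun c A => by
        rw [Matrix.transpose_smul, ← smul_add, hF.homogeneous]; simp; ring }
  have hG : ∀ A : Matrix (Fin n) (Fin n) ℝ, A.IsSymm → F A = G A := by
    intro A hA
    simp only [G, LinearMap.coe_mk, AddHom.coe_mk]
    rw [hA.eq, ← two_smul ℝ A, hF.homogeneous]; ring
  let Q : Matrix (Fin n) (Fin n) ℝ := fun i j => G (Matrix.single i j 1)
  have hGQ : ∀ A, G A = trQ Q A := by
    intro A
    conv_lhs => rw [Matrix.matrix_eq_sum_single A]
    rw [map_sum]
    refine Finset.sum_congr rfl fun i _ => ?_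
    rw [map_sum]
    refine Finset.sum_congr rfl fun j _ => ?_
    have : Matrix.single i j (A i j) = (A i j) • Matrix.single i j (1 : ℝ) := by simp
    rw [this, map_smul, smul_eq_mul, mul_comm]
  have hsymP : ∀ N : Matrix (Fin n) (Fin n) ℝ, N.PosSemidef → N.IsSymm := by
    intro N hN
    have := hN.isHermitian
    unfold Matrix.IsHermitian at this
    rwa [Matrix.conjTranspose_eq_transpose_of_trivial] at this
  have h0s : (0 : Matrix (Fin n) (Fin n) ℝ).IsSymm := Matrix.isSymm_zero
  have hlo : ∀ N : Matrix (Fin n) (Fin n) ℝ, N.PosSemidef → lam * matOpNorm N ≤ trQ Q N := by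
    intro N hN
    have := hF.elliptic_lower 0 N h0s hN
    rwa [zero_add, hF0, sub_zero, hG N (hsymP N hN), hGQ] at this
  have hhi : ∀ N : Matrix (Fin n) (Fin n) ℝ, N.PosSemidef → trQ Q N ≤ Lam * matOpNorm N := by
    intro N hN
    have := hF.elliptic_upper 0 N h0s hN
    rwa [zero_add, hF0, sub_zero, hG N (hsymP N hN), hGQ] at this
  have hvec : ∀ ξ : En n, trQ Q (Matrix.vecMulVec (fun i => ξ i) (fun i => ξ i)) = qf Q ξ := by
    intro ξ
    simp only [trQ, qf, Matrix.vecMulVec_apply]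
    refine Finset.sum_congr rfl fun i _ => Finset.sum_congr rfl fun j _ => by ring
  have hvp : ∀ ξ : En n, (Matrix.vecMulVec (fun i => ξ i) (fun i => ξ i)).PosSemidef := by
    intro ξ
    have := Matrix.posSemidef_vecMulVec_self_star (R := ℝ) (fun i => ξ i)
    rwa [star_trivial] at this
  have hone : matOpNorm (1 : Matrix (Fin n) (Fin n) ℝ) = 1 := by
    unfold matOpNorm
    rw [map_one, norm_one]
  refine ⟨Q, ⟨hF.lam_pos, ?_, ?_, ?_, ?_, ?_, ?_⟩, fun A hA => by rw [hG A hA, hGQ]⟩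
  · intro i j
    simp only [Q, G, LinearMap.coe_mk, AddHom.coe_mk, Matrix.transpose_single]
    rw [add_comm]
  · intro N hN
    exact (mul_nonneg hF.lam_pos.le (norm_nonneg _)).trans (hlo N hN)
  · intro ξ
    rw [← hvec, ← matOpNorm_vec]; exact hlo _ (hvp ξ)
  · intro ξ
    rw [← hvec, ← matOpNorm_vec]; exact hhi _ (hvp ξ)
  · simpa [hone] using hlo 1 Matrix.PosSemidef.one
  · simpa [hone] using hhi 1 Matrix.PosSemidef.one
end TC

namespace TC
open Topology Asymptotics MvPolynomial
variable {n : ℕ} [NeZero n] {Q : Matrix (Fin n) (Fin n) ℝ} {lam Lam : ℝ}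

def ext0 (u : En n → ℝ) (x : En n) : ℝ := if 0 < x 0 then u x else 0

lemma quad_center (a : ℝ) (b : Fin n → ℝ) (A : Matrix (Fin n) (Fin n) ℝ) (hA : A.IsSymm) (x0 : En n) :
    ∃ (c : ℝ) (b' : En n), ∀ y : En n, quadPoly c b' A (x0 + y) = a + dotp b y + 1 / 2 * qf A y := by
  refine ⟨a - dotp b x0 + 1 / 2 * qf A x0, WithLp.toLp 2 (fun i => b i - ∑ j, A i j * x0 j), fun y => ?_⟩
  have h1 : ∑ i, (b i - ∑ j, A i j * x0 j) * (x0 i + y i)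
      = dotp b x0 + dotp b y - qf A x0 - ∑ i, ∑ j, A i j * y i * x0 j := by
    unfold dotp qf
    rw [← Finset.sum_add_distrib, ← Finset.sum_sub_distrib, ← Finset.sum_sub_distrib]
    refine Finset.sum_congr rfl fun i _ => ?_
    have e1 : ∑ j, A i j * x0 i * x0 j = (∑ j, A i j * x0 j) * x0 i := by
      rw [Finset.sum_mul]; exact Finset.sum_congr rfl fun j _ => by ring
    have e2 : ∑ j, A i j * y i * x0 j = (∑ j, A i j * x0 j) * y i := by
      rw [Finset.sum_mul]; exact Finset.sum_congr rfl fun j _ => by ring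
    rw [e1, e2]; ring
  have h2 : ∑ i, ∑ j, A i j * x0 i * y j = ∑ i, ∑ j, A i j * y i * x0 j := by
    rw [Finset.sum_comm]
    refine Finset.sum_congr rfl fun i _ => Finset.sum_congr rfl fun j _ => ?_
    rw [hA.apply]; ring
  have h3 : ∑ i, ∑ j, A i j * (x0 i + y i) * (x0 j + y j)
      = qf A x0 + qf A y + ∑ i, ∑ j, A i j * x0 i * y j + ∑ i, ∑ j, A i j * y i * x0 j := by
    unfold qf
    simp only [← Finset.sum_add_distrib]
    refine Finset.sum_congr rfl fun i _ => Finset.sum_congr rfl fun j _ => by ring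
  unfold quadPoly
  simp only [PiLp.add_apply]
  rw [h1, h3, h2]; ring

lemma isOpen_Bplus (r : ℝ) : IsOpen (Bplus n 0 r) :=
  (isOpen_lt continuous_const (cont_coord 0)).inter isOpen_ball

lemma ext0_ev {u : En n → ℝ} {x : En n} (hx : 0 < x 0) : ∀ᶠ z in 𝓝 x, u z = ext0 u z := by
  filter_upwards [(isOpen_lt continuous_const (cont_coord 0)).mem_nhds (show x ∈ {z : En n | 0 < z 0} from hx)] with z hz
  have hz' : 0 < z 0 := hz
  simp [ext0, hz']

lemma visc_sub {F : Matrix (Fin n) (Fin n) ℝ → ℝ} (hF : ∀ A : Matrix (Fin n) (Fin n) ℝ, A.IsSymm → F A = trQ Q A)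
    {g u : En n → ℝ} (hs : ViscositySol F g (Bplus n 0 1) u) {x : En n} (hx : x ∈ Bplus n 0 1) :
    SubAt Q u (g x) x ∧ SubAt Q (fun z => - u z) (- g x) x := by
  have ht : Tendsto (fun z : En n => z - x) (𝓝 x) (𝓝 0) := by
    have : Continuous (fun z : En n => z - x) := by fun_prop
    simpa using this.tendsto x
  constructor
  · intro b A hA hv
    obtain ⟨c, b', h⟩ := quad_center (u x) b A hA x
    rw [← hF A hA]
    refine (hs x hx).1 c b' A hA ?_
    have hh : ∀ᶠ z in 𝓝 x, u z - quadPoly c b' A z ≤ u x - quadPoly c b' A x := by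
      filter_upwards [ht.eventually hv] with z hz
      have h0 := h 0
      have h1 := h (z - x)
      have e : x + (z - x) = z := by abel
      rw [e] at h1 hz
      have z1 : dotp b (0 : En n) = 0 := by simp [dotp]
      have z2 : qf A (0 : En n) = 0 := by simp [qf]
      rw [add_zero, z1, z2] at h0
      linarith
    exact hh.filter_mono nhdsWithin_le_nhds
  · intro b A hA hv
    obtain ⟨c, b', h⟩ := quad_center (u x) (-b) (-A) hA.neg x
    have hneg : trQ Q (-A) = - trQ Q A := by simp [trQ]
    have : F (-A) ≤ g x := by
      refine (hs x hx).2 c b' (-A) hA.neg ?_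
      have hh : ∀ᶠ z in 𝓝 x, u x - quadPoly c b' (-A) x ≤ u z - quadPoly c b' (-A) z := by
        filter_upwards [ht.eventually hv] with z hz
        have h0 := h 0
        have h1 := h (z - x)
        have e : x + (z - x) = z := by abel
        rw [e] at h1 hz
        have z1 : dotp (-b) (0 : En n) = 0 := by simp [dotp]
        have z2 : qf (-A) (0 : En n) = 0 := by simp [qf]
        have z3 : dotp (-b) (z - x) = - dotp b (z - x) := by simp [dotp]
        have z4 : qf (-A) (z - x) = - qf A (z - x) := by simp [qf]
        rw [add_zero, z1, z2] at h0
        rw [z3, z4] at h1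
        linarith
      exact hh.filter_mono nhdsWithin_le_nhds
    rw [hF _ hA.neg, hneg] at this
    linarith

lemma loc_of {F : Matrix (Fin n) (Fin n) ℝ → ℝ} (hF : ∀ A : Matrix (Fin n) (Fin n) ℝ, A.IsSymm → F A = trQ Q A)
    {M : ℝ} {u : En n → ℝ} {Ω : Set (En n)} (hP : MemPplus F 0 1 M u Ω) {σ : ℝ → ℝ} (hσ : IsModulus σ)
    (hg : ∀ x ∈ PiSet n ∩ ball (0 : En n) 1,
            ∃ g : En n, HasGradientWithinAt u g (closure (Bplus n 0 1)) x ∧ ‖g‖ ≤ ‖x‖ * σ ‖x‖)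
    {r : ℝ} (hr : 0 < r) (hr1 : r ≤ 1) : Loc Q (ext0 u) r (r * σ r) := by
  have hb : ball (0 : En n) r ⊆ ball 0 1 := ball_subset_ball hr1
  refine ⟨?_, ?_, ?_, ?_, ?_, ?_⟩
  · intro x hx
    refine ContinuousAt.continuousWithinAt ?_
    rcases lt_trichotomy (x 0) 0 with h | h | h
    · have : ∀ᶠ z in 𝓝 x, ext0 u z = 0 := by
        filter_upwards [(isOpen_lt (cont_coord 0) continuous_const).mem_nhds (show x ∈ {z : En n | z 0 < 0} from h)] with z hz
        have hz' : z 0 < 0 := hz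
        simp [ext0, hz'.le]
      exact (continuousAt_const (y := (0:ℝ))).congr (this.mono fun _ h => h.symm)
    · have hux : u x = 0 := hP.bdry_zero x ⟨h, hb hx⟩
      have hcl : x ∈ closure (Bplus n 0 1) := by
        have ht : Tendsto (fun t : ℝ => x + t • e1 n) (𝓝[>] 0) (𝓝 x) := by
          have : Continuous (fun t : ℝ => x + t • e1 n) := by fun_prop
          simpa using (this.tendsto 0).mono_left nhdsWithin_le_nhds
        refine mem_closure_of_tendsto ht ?_
        filter_upwards [self_mem_nhdsWithin, ht.eventually (isOpen_ball.mem_nhds (hb hx))] with t h1 h2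
        refine ⟨?_, h2⟩
        have h1' : 0 < t := h1
        show 0 < (x + t • e1 n) 0
        rw [add_e1_zero, h]; linarith
      have hc := hP.cont x hcl
      rw [Metric.continuousAt_iff']
      intro ε hε
      have hc' := (Metric.continuousWithinAt_iff'.1 hc) ε hε
      rw [eventually_nhdsWithin_iff] at hc'
      filter_upwards [hc', isOpen_ball.mem_nhds (hb hx)] with z hz hz1
      have : ext0 u x = 0 := by simp [ext0, h]
      rw [this]
      by_cases h2 : 0 < z 0
      · have := hz (subset_closure ⟨h2, hz1⟩)
        rw [hux] at this
        simpa [ext0, h2] using this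
      · simp [ext0, h2, hε]
    · have hm : x ∈ Bplus n 0 1 := ⟨h, hb hx⟩
      have : ContinuousAt u x := (hP.cont.mono subset_closure).continuousAt ((isOpen_Bplus 1).mem_nhds hm)
      exact this.congr (ext0_ev h)
  · intro x hx
    simp [ext0, not_lt.2 hx]
  · intro x hx h0
    refine SubAt.congr ?_ (ext0_ev h0)
    refine (visc_sub hF hP.sol ⟨h0, hb hx⟩).1.mono ?_
    exact Set.indicator_nonneg (fun _ _ => zero_le_one) _
  · intro x hx h0
    refine SubAt.congr (u := fun z => -u z) ?_ ((ext0_ev (u := u) h0).mono fun z hz => by rw [hz])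
    refine (visc_sub hF hP.sol ⟨h0, hb hx⟩).2.mono ?_
    exact neg_le_neg (Set.indicator_le_self' (fun _ _ => zero_le_one) x)
  · intro x hx h0 hne
    refine SubAt.congr ?_ (ext0_ev h0)
    refine (visc_sub hF hP.sol ⟨h0, hb hx⟩).1.mono ?_
    have : x ∈ Ω := by
      by_contra hno
      have := (hP.vanish x ⟨⟨h0, hb hx⟩, hno⟩).1
      simp [ext0, this] at hne
    simp [this]
  · intro x hx h0 c hc
    have hux : u x = 0 := hP.bdry_zero x ⟨h0, hb hx⟩
    obtain ⟨g, hg1, hg2⟩ := hg x ⟨h0, hb hx⟩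
    have hgr : ‖g‖ ≤ r * σ r := by
      refine hg2.trans ?_
      rw [mem_ball_zero_iff] at hx
      rcases eq_or_ne x 0 with rfl | hne
      · simp only [norm_zero, zero_mul]; exact mul_nonneg hr.le (hσ.1 r hr)
      · have hx0 := norm_pos_iff.2 hne
        exact mul_le_mul hx.le (hσ.2.1 hx0 hx.le) (hσ.1 _ hx0) hr.le
    have ht : Tendsto (fun t : ℝ => x + t • e1 n) (𝓝[>] 0) (𝓝 x) := by
      have : Continuous (fun t : ℝ => x + t • e1 n) := by fun_prop
      simpa using (this.tendsto 0).mono_left nhdsWithin_le_nhds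
    have hpos : ∀ᶠ t in 𝓝[>] (0:ℝ), 0 < (x + t • e1 n) 0 := by
      filter_upwards [self_mem_nhdsWithin] with t h1
      have h1' : 0 < t := h1
      rw [add_e1_zero, h0]; linarith
    have ht' : Tendsto (fun t : ℝ => x + t • e1 n) (𝓝[>] 0) (𝓝[closure (Bplus n 0 1)] x) := by
      refine tendsto_nhdsWithin_iff.2 ⟨ht, ?_⟩
      filter_upwards [hpos, ht.eventually (isOpen_ball.mem_nhds (hb hx))] with t h1 h2
      exact subset_closure ⟨h1, h2⟩
    have hlo := hg1.hasFDerivWithinAt.isLittleO.def (show 0 < c - r * σ r by linarith)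
    filter_upwards [ht'.eventually hlo, hpos, self_mem_nhdsWithin] with t h1 h2 h3
    have h3' : 0 < t := h3
    have e : x + t • e1 n - x = t • e1 n := by abel
    rw [e, hux, norm_smul, norm_e1, Real.norm_of_nonneg h3'.le, InnerProductSpace.toDual_apply_apply, inner_smul_right, Real.norm_eq_abs] at h1
    have h4 : |inner ℝ g (e1 n)| ≤ ‖g‖ := by
      have := abs_real_inner_le_norm g (e1 n)
      rwa [norm_e1, mul_one] at this
    have h5 : ext0 u (x + t • e1 n) = u (x + t • e1 n) := by simp only [ext0, h2, if_true]
    rw [h5]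
    have h6 : |t * inner ℝ g (e1 n)| ≤ r * σ r * t := by
      rw [abs_mul, abs_of_pos h3']; nlinarith
    rw [abs_le] at h1 h6 ⊢
    constructor <;> nlinarith [h1.1, h1.2, h6.1, h6.2]
end TC

namespace TC
open Topology Asymptotics MvPolynomial
variable {n : ℕ} [NeZero n] {Q : Matrix (Fin n) (Fin n) ℝ} {lam Lam : ℝ}

lemma vol_le {F : Matrix (Fin n) (Fin n) ℝ → ℝ} {M : ℝ} {u : En n → ℝ} {Ω : Set (En n)} (hP : MemPplus F 0 1 M u Ω)
    {σ : ℝ → ℝ} {r : ℝ} (hr : 0 < r) (hr1 : r < 1) (hV : Vr u Ω 0 r ≤ σ r) :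
    volume ({z : En n | 0 < z 0 ∧ ext0 u z < 0} ∩ ball 0 r) ≤ ENNReal.ofReal (σ r * r ^ n) := by
  have hsub : {z : En n | 0 < z 0 ∧ ext0 u z < 0} ∩ ball 0 r ⊆ {x ∈ Ω | u x < 0} ∩ Bplus n 0 r := by
    rintro z ⟨⟨h0, h1⟩, h2⟩
    have h1' : u z < 0 := by simpa [ext0, h0] using h1
    have hz : z ∈ Ω := by
      by_contra hno
      have := (hP.vanish z ⟨⟨h0, ball_subset_ball hr1.le h2⟩, hno⟩).1
      linarith
    exact ⟨⟨hz, h1'⟩, h0, h2⟩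
  have hfin : volume ({x ∈ Ω | u x < 0} ∩ Bplus n 0 r) ≠ ⊤ :=
    ((measure_mono (inter_subset_right.trans inter_subset_right)).trans_lt (measure_ball_lt_top (x := (0 : En n)) (r := r))).ne
  refine (measure_mono hsub).trans ?_
  rw [← ENNReal.ofReal_toReal hfin]
  refine ENNReal.ofReal_le_ofReal ?_
  unfold Vr at hV
  rwa [div_le_iff₀ (by positivity)] at hV

lemma small_sigma {σ : ℝ → ℝ} (hσ : IsModulus σ) {c : ℝ} (hc : 0 < c) :
    ∃ d > 0, d ≤ 1 ∧ ∀ r, 0 < r → r < d → σ r < c := by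
  have := hσ.2.2.eventually (gt_mem_nhds hc)
  rw [eventually_nhdsWithin_iff, Metric.eventually_nhds_iff] at this
  obtain ⟨d, hd, h⟩ := this
  refine ⟨min d 1, by positivity, min_le_right _ _, fun r hr hrd => h ?_ hr⟩
  rw [Real.dist_eq, sub_zero, abs_of_pos hr]
  exact hrd.trans_le (min_le_left _ _)

lemma hneg_of {F : Matrix (Fin n) (Fin n) ℝ → ℝ} {M : ℝ} {u : En n → ℝ} {Ω : Set (En n)} (hP : MemPplus F 0 1 M u Ω)
    {σ : ℝ → ℝ} (hσ : IsModulus σ) (hV : ∀ r : ℝ, 0 < r → r < 1 → Vr u Ω 0 r ≤ σ r) :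
    ∀ δ > 0, ∃ x : En n, ‖x‖ < δ ∧ 0 < x 0 ∧ 0 ≤ ext0 u x := by
  intro δ hδ
  by_contra! hall
  have hVpos : 0 < (volume (ball (0 : En n) 1)).toReal :=
    ENNReal.toReal_pos (measure_ball_pos _ _ one_pos).ne' measure_ball_lt_top.ne
  set V := (volume (ball (0 : En n) 1)).toReal
  obtain ⟨d, hd, hd1, hds⟩ := small_sigma hσ (c := V / 2 ^ n) (by positivity)
  set t := min (d / 2) δ
  have ht : 0 < t := by positivity
  have htd : t < d := (min_le_left _ _).trans_lt (by linarith)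
  have h1 := vol_le hP ht (by linarith) (hV t ht (by linarith))
  have hsub : ball ((t / 2) • e1 n) (t / 2) ⊆ {z : En n | 0 < z 0 ∧ ext0 u z < 0} ∩ ball 0 t := by
    intro z hz
    rw [mem_ball, dist_eq_norm] at hz
    have h2 : |(z - (t / 2) • e1 n) 0| ≤ _ := abs_coord _ _
    have h3 : (z - (t / 2) • e1 n) 0 = z 0 - t / 2 := by simp [e1]
    rw [h3] at h2
    have hz0 : 0 < z 0 := by have := (abs_le.1 h2).1; linarith
    have hzt : ‖z‖ < t := by
      calc ‖z‖ = ‖(z - (t / 2) • e1 n) + (t / 2) • e1 n‖ := by congr 1; abel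
        _ ≤ ‖z - (t / 2) • e1 n‖ + ‖(t / 2) • e1 n‖ := norm_add_le _ _
        _ < t := by rw [norm_smul, norm_e1, Real.norm_of_nonneg (by positivity)]; linarith
    exact ⟨⟨hz0, hall z (hzt.trans_le (min_le_right _ _)) hz0⟩, by rwa [mem_ball_zero_iff]⟩
  have h4 := (measure_mono (μ := volume) hsub).trans h1
  rw [Measure.addHaar_ball _ _ (by positivity : 0 ≤ t / 2), ← ENNReal.ofReal_toReal (measure_ball_lt_top (x := (0 : En n)) (r := 1)).ne,
    ← ENNReal.ofReal_mul (by positivity), finrank_euclideanSpace_fin,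
    ENNReal.ofReal_le_ofReal_iff (mul_nonneg (hσ.1 t ht) (by positivity))] at h4
  have h5 := hds t ht htd
  rw [lt_div_iff₀ (by positivity)] at h5
  rw [div_pow, div_mul_eq_mul_div, div_le_iff₀ (by positivity)] at h4
  have : 0 < t ^ n := by positivity
  change t ^ n * V ≤ _ at h4
  nlinarith

lemma hΩ_of {F : Matrix (Fin n) (Fin n) ℝ → ℝ} (hF : ∀ A : Matrix (Fin n) (Fin n) ℝ, A.IsSymm → F A = trQ Q A)
    {M : ℝ} {u : En n → ℝ} {Ω : Set (En n)} (hP : MemPplus F 0 1 M u Ω) :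
    ∀ δ > 0, ∃ x : En n, ‖x‖ < δ ∧ 0 < x 0 ∧ SubAt Q (ext0 u) 1 x := by
  intro δ hδ
  have h0 : (0 : En n) ∈ closure Ω := hP.z_bdry.1
  rw [Metric.mem_closure_iff] at h0
  obtain ⟨x, hx, hxd⟩ := h0 (min δ 1) (by positivity)
  rw [dist_zero_left, lt_min_iff] at hxd
  have hx0 : 0 < x 0 := hP.Ω_sub hx
  refine ⟨x, hxd.1, hx0, SubAt.congr ?_ (ext0_ev hx0)⟩
  refine (visc_sub hF hP.sol ⟨hx0, by rw [mem_ball_zero_iff]; exact hxd.2⟩).1.mono ?_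
  simp [hx]

lemma main_eps (M : ℝ) (hM : 0 < M) (σ : ℝ → ℝ) (hσ : IsModulus σ) (hl : 0 < lam) (hL : lam ≤ Lam)
    {ε : ℝ} (hε : 0 < ε) (hε1 : ε ≤ 1) :
    ∃ r : ℝ, 0 < r ∧ ∀ (F : Matrix (Fin n) (Fin n) ℝ → ℝ), EllipticF n lam Lam F →
        ∀ (u : En n → ℝ) (Ω : Set (En n)), MemPplus F 0 1 M u Ω →
          (∀ r : ℝ, 0 < r → r < 1 → Vr u Ω 0 r ≤ σ r) →
          (∀ x ∈ PiSet n ∩ ball (0 : En n) 1,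
            ∃ g : En n, HasGradientWithinAt u g (closure (Bplus n 0 1)) x ∧
              ‖g‖ ≤ ‖x‖ * σ ‖x‖) →
          ∀ x ∈ frontier Ω, ‖x‖ < r → x 0 ≤ ε * ‖x‖ := by
  have hs1 : 0 ≤ σ 1 := hσ.1 1 one_pos
  obtain ⟨C0, hC0, HB⟩ := growth_base (n := n) lam Lam M (σ 1) hl hL hs1
  obtain ⟨C1, hC1, HP⟩ := growth_pi (n := n) lam Lam C0 hl hL
  obtain ⟨R, η, hR, hη, HF⟩ := fin1 (n := n) lam Lam C1 ε hl hL (by linarith) hε hε1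
  obtain ⟨ϱ, κ0, hϱ, hκ0, HV⟩ := low_vol (n := n) lam Lam C1 R η hl hL (by linarith) hR hη
  have hVpos : 0 < (volume (ball (0 : En n) ϱ)).toReal :=
    ENNReal.toReal_pos (measure_ball_pos _ _ hϱ).ne' measure_ball_lt_top.ne
  set V := (volume (ball (0 : En n) ϱ)).toReal with hVd
  set κ := min ε (min κ0 1) with hκd
  have hκ : 0 < κ := by positivity
  have hκε : κ ≤ ε := min_le_left _ _
  have hκκ : κ ≤ κ0 := (min_le_right _ _).trans (min_le_left _ _)
  have hκ1 : κ ≤ 1 := (min_le_right _ _).trans (min_le_right _ _)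
  have hR0 : 0 < R := by linarith
  obtain ⟨d, hd, hd1, hds⟩ := small_sigma hσ (c := min (κ / (16 * R)) (V / (4 * R) ^ n)) (by positivity)
  refine ⟨d / (16 * R), by positivity, fun F hF u Ω hP hVr hg x hx hxr => ?_⟩
  obtain ⟨Q, hQ, hFQ⟩ := exists_Q hF
  by_contra! hcon
  have hx0 : 0 < x 0 := lt_of_le_of_lt (by positivity) hcon
  set s := ‖x‖ with hsd
  have hs : 0 < s := norm_pos_iff.2 (fun h => by rw [h] at hx0; simp at hx0)
  rw [lt_div_iff₀ (by positivity)] at hxr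
  have hs1' : s < 1 := by nlinarith
  have hxb : x ∈ Bplus n 0 1 := ⟨hx0, by rw [mem_ball_zero_iff]; exact hs1'⟩
  have hxΩ : x ∉ Ω := by
    intro h
    rw [hP.Ω_open.frontier_eq] at hx
    exact hx.2 h
  have hux : u x = 0 := (hP.vanish x ⟨hxb, hxΩ⟩).1
  have hloc : ∀ r, 0 < r → r ≤ 1 → Loc Q (ext0 u) r (r * σ r) := fun r h1 h2 => loc_of hFQ hP hσ hg h1 h2
  have hbd : ∀ z ∈ ball (0 : En n) 1, |ext0 u z| ≤ M := by
    intro z hz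
    by_cases h : 0 < z 0
    · simpa [ext0, h] using hP.bdd z ⟨h, hz⟩
    · simp [ext0, h, hM.le]
  have hgr := HB Q hQ (ext0 u) (fun r h1 h2 => (hloc r h1 h2).mono le_rfl
    (mul_le_mul_of_nonneg_left (hσ.2.1 h1 h2) h1.le)) hbd
  set v : En n → ℝ := fun z => ext0 u (s • z) / s ^ 2 with hv
  have hr16 : 0 < s * (16 * R) := by positivity
  have hr4 : 0 < s * (4 * R) := by positivity
  have hσ16 := (hds _ hr16 hxr).le.trans (min_le_left _ _)
  have hσ4 := (hds _ hr4 (by nlinarith)).trans_le (min_le_right _ _)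
  rw [le_div_iff₀ (by positivity)] at hσ16
  rw [lt_div_iff₀ (by positivity)] at hσ4
  have hL16 : Loc Q v (16 * R) κ := by
    refine ((hloc _ hr16 (by linarith)).scale hs).mono (le_of_eq ?_) ?_
    · field_simp
    · rw [div_le_iff₀ hs]; nlinarith
  have hL4 : Loc Q v (4 * R) κ := hL16.mono (by linarith) le_rfl
  have hg16 : ∀ z ∈ ball (0 : En n) (16 * R), |v z| ≤ C0 * ‖z‖ ^ 2 := by
    intro z hz
    rw [mem_ball_zero_iff] at hz
    have hn : ‖s • z‖ = s * ‖z‖ := by rw [norm_smul, Real.norm_of_nonneg hs.le]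
    have := hgr (s • z) (by rw [mem_ball_zero_iff, hn]; nlinarith)
    rw [hn] at this
    simp only [hv]
    rw [abs_div, abs_of_pos (by positivity : 0 < s ^ 2), div_le_iff₀ (by positivity)]
    linarith
  have hg4 := HP Q hQ v (16 * R) κ (by positivity) hκ (by linarith) hL16 hg16
  rw [show 16 * R / 4 = 4 * R by ring] at hg4
  have hvol : volume ({z : En n | 0 < z 0 ∧ v z < 0} ∩ ball 0 (4 * R)) < volume (ball (0 : En n) ϱ) := by
    simp only [hv]
    rw [vol_scale hs]
    have h1 := vol_le hP hr4 (by nlinarith) (hVr _ hr4 (by nlinarith))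
    refine (mul_le_mul_right h1 _).trans_lt ?_
    rw [← ENNReal.ofReal_toReal (measure_ball_lt_top (x := (0 : En n)) (r := ϱ)).ne, ← ENNReal.ofReal_mul (by positivity)]
    rw [← hVd, ENNReal.ofReal_lt_ofReal_iff hVpos]
    refine lt_of_eq_of_lt ?_ hσ4
    rw [mul_pow s, inv_pow]
    field_simp
  have hlow := HV Q hQ v κ hκ.le hκκ hL4 hg4 hvol
  have hp0 : (s⁻¹ • x) 0 = s⁻¹ * x 0 := by simp
  have hpn : ‖s⁻¹ • x‖ = 1 := by
    rw [norm_smul, norm_inv, Real.norm_of_nonneg hs.le, ← hsd]; field_simp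
  have hpe : ε ≤ (s⁻¹ • x) 0 := by
    rw [hp0, inv_mul_eq_div, le_div_iff₀ hs]; exact hcon.le
  have hvp : v (s⁻¹ • x) = 0 := by
    simp only [hv]
    rw [smul_inv_smul₀ hs.ne']
    simp [ext0, hux]
  have hup := HF Q hQ v κ hκ.le hκε hL4 hg4 hlow (s⁻¹ • x) hpn hpe hvp
  have hpos := pos_pts hQ one_pos (hloc 1 one_pos le_rfl) (hneg_of hP hσ hVr) (hΩ_of hFQ hP)
  have hp1 : (s⁻¹ • x) 0 ≤ 1 := by
    have := abs_coord (s⁻¹ • x) 0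
    rw [hpn] at this
    exact (le_abs_self _).trans this
  obtain ⟨z, hz1, hz2, hz3⟩ := nondeg hQ hL4 (fun δ hδ => by
    obtain ⟨y, hy1, hy2⟩ := hpos (s * δ) (by positivity)
    refine ⟨s⁻¹ • y, ?_, ?_⟩
    · rw [norm_smul, norm_inv, Real.norm_of_nonneg hs.le, inv_mul_eq_div, div_lt_iff₀ hs]; linarith
    · simp only [hv]
      rw [smul_inv_smul₀ hs.ne']; positivity) (ρ := (s⁻¹ • x) 0 / 2) (by linarith) (by linarith)
  exact absurd (hup z hz1 hz2) (not_lt.2 hz3)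

theorem final (M : ℝ) (hM : 0 < M) (σ : ℝ → ℝ) (hσ : IsModulus σ) :
    ∃ r₀ : ℝ, 0 < r₀ ∧ ∃ σ₁ : ℝ → ℝ, IsModulus σ₁ ∧
      ∀ (F : Matrix (Fin n) (Fin n) ℝ → ℝ), EllipticF n lam Lam F →
        ∀ (u : En n → ℝ) (Ω : Set (En n)), MemPplus F 0 1 M u Ω →
          (∀ r : ℝ, 0 < r → r < 1 → Vr u Ω 0 r ≤ σ r) →
          (∀ x ∈ PiSet n ∩ ball (0 : En n) 1,
            ∃ g : En n, HasGradientWithinAt u g (closure (Bplus n 0 1)) x ∧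
              ‖g‖ ≤ ‖x‖ * σ ‖x‖) →
          ∀ x ∈ frontier Ω ∩ ball (0 : En n) r₀, x 0 ≤ σ₁ ‖x‖ * ‖x‖ := by
  let adm : En n → Prop := fun x => ∃ (F : Matrix (Fin n) (Fin n) ℝ → ℝ) (u : En n → ℝ) (Ω : Set (En n)),
    EllipticF n lam Lam F ∧ MemPplus F 0 1 M u Ω ∧ (∀ r : ℝ, 0 < r → r < 1 → Vr u Ω 0 r ≤ σ r) ∧
    (∀ x ∈ PiSet n ∩ ball (0 : En n) 1,
            ∃ g : En n, HasGradientWithinAt u g (closure (Bplus n 0 1)) x ∧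
              ‖g‖ ≤ ‖x‖ * σ ‖x‖) ∧ x ∈ frontier Ω
  let S : ℝ → Set ℝ := fun r => insert 0 {q | ∃ x : En n, adm x ∧ 0 < ‖x‖ ∧ ‖x‖ ≤ r ∧ q = x 0 / ‖x‖}
  have hle1 : ∀ x : En n, 0 < ‖x‖ → x 0 / ‖x‖ ≤ 1 := fun x hx => by
    rw [div_le_one hx]; exact (le_abs_self _).trans (abs_coord x 0)
  have hbdd : ∀ r, BddAbove (S r) := fun r => ⟨1, by
    rintro q (rfl | ⟨x, _, h0, _, rfl⟩)
    · exact zero_le_one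
    · exact hle1 x h0⟩
  have h0S : ∀ r, (0 : ℝ) ∈ S r := fun r => mem_insert _ _
  refine ⟨1, one_pos, fun r => sSup (S r), ⟨fun r _ => le_csSup (hbdd r) (h0S r), fun r s _ hrs => ?_, ?_⟩, ?_⟩
  · refine csSup_le_csSup (hbdd s) ⟨0, h0S r⟩ ?_
    rintro q (rfl | ⟨x, h1, h0, h2, rfl⟩)
    · exact h0S s
    · exact Or.inr ⟨x, h1, h0, h2.trans hrs, rfl⟩
  · rw [Metric.tendsto_nhdsWithin_nhds]
    intro ε hε
    set e := min (ε / 2) 1 with he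
    have he0 : 0 < e := by positivity
    have hee : e < ε := (min_le_left _ _).trans_lt (by linarith)
    by_cases hlL : 0 < lam ∧ lam ≤ Lam
    · obtain ⟨r1, hr1, H⟩ := main_eps (n := n) M hM σ hσ hlL.1 hlL.2 he0 (min_le_right _ _)
      refine ⟨r1, hr1, fun {r} hr hrd => ?_⟩
      rw [Real.dist_eq, sub_zero] at hrd ⊢
      rw [abs_of_nonneg (le_csSup (hbdd r) (h0S r))]
      refine lt_of_le_of_lt (csSup_le ⟨0, h0S r⟩ ?_) hee
      rintro q (rfl | ⟨x, ⟨F, u, Ω, a1, a2, a3, a4, a5⟩, h0, h2, rfl⟩)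
      · exact he0.le
      · rw [div_le_iff₀ h0]
        exact H F a1 u Ω a2 a3 a4 x a5 (h2.trans_lt ((le_abs_self r).trans_lt hrd))
    · refine ⟨1, one_pos, fun {r} hr hrd => ?_⟩
      rw [Real.dist_eq, sub_zero, abs_of_nonneg (le_csSup (hbdd r) (h0S r))]
      refine lt_of_le_of_lt (csSup_le ⟨0, h0S r⟩ ?_) hε
      rintro q (rfl | ⟨x, ⟨F, u, Ω, a1, a2, a3, a4, a5⟩, h0, h2, rfl⟩)
      · exact le_rfl
      · exact absurd ⟨a1.lam_pos, a1.lam_le_Lam⟩ hlL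
  · rintro F hF u Ω hP hV hg x ⟨hx, _⟩
    rcases eq_or_ne x 0 with rfl | hne
    · simp
    have hx0 := norm_pos_iff.2 hne
    rw [← div_le_iff₀ hx0]
    exact le_csSup (hbdd _) (Or.inr ⟨x, ⟨F, u, Ω, hF, hP, hV, hg, hx⟩, hx0, le_rfl, rfl⟩)
end TC

/-- **Theorem C** (tangential touch): for every `M > 0` and modulus of continuity `σ` there exist
`r₀ > 0` and a modulus of continuity `σ₁` such that for every `u ∈ P₁⁺(0,M,σ)` the free boundary
satisfies `∂Ω ∩ B(0,r₀) ⊆ {x : x₁ ≤ σ₁(|x|)|x|}`. -/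
theorem theoremC (n : ℕ) [NeZero n] (hn : 2 ≤ n) (lam Lam M : ℝ) (hM : 0 < M)
    (σ : ℝ → ℝ) (hσ : IsModulus σ) :
    ∃ r₀ : ℝ, 0 < r₀ ∧ ∃ σ₁ : ℝ → ℝ, IsModulus σ₁ ∧
      ∀ (F : Matrix (Fin n) (Fin n) ℝ → ℝ), EllipticF n lam Lam F →
        ∀ (u : En n → ℝ) (Ω : Set (En n)), MemPplus F 0 1 M u Ω →
          (∀ r : ℝ, 0 < r → r < 1 → Vr u Ω 0 r ≤ σ r) →
          (∀ x ∈ PiSet n ∩ ball (0 : En n) 1,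
            ∃ g : En n, HasGradientWithinAt u g (closure (Bplus n 0 1)) x ∧
              ‖g‖ ≤ ‖x‖ * σ ‖x‖) →
          ∀ x ∈ frontier Ω ∩ ball (0 : En n) r₀, x 0 ≤ σ₁ ‖x‖ * ‖x‖ := by
  exact TC.final M hM σ hσ
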